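/- Let n ≥ 1 and let u : ℝⁿ → ℝ be a smooth solution of (−Δ)³u = |u|^{p−1}u that is stable outside some compact set Θ ⊂ ℝⁿ, where 1 < p and, in the case n ≥ 15, additionally p < p_c(n). Then there exist constants C > 0 and R₀ > 0 such that |u(x)| ≤ C |x|^{−6/(p−1)} for all x ∈ ℝⁿ with |x| ≥ R₀. -/

import Mathlib

open MeasureTheory Filter

noncomputable section

/-- The Euclidean Laplacian of `u` at `x`. -/
def laplacian {n : ℕ} (u : EuclideanSpace ℝ (Fin n) → ℝ) (x : EuclideanSpace ℝ (Fin n)) : ℝ :=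
  ∑ i : Fin n, iteratedFDeriv ℝ 2 u x ![EuclideanSpace.single i 1, EuclideanSpace.single i 1]

def dd1 (n : ℝ) : ℝ :=
  -108*n^6 + 1296*n^5 - 3024*n^4 - 10368*n^3 + 103104*n^2 + 20736*n - 94976

def dd2 (n : ℝ) : ℝ :=
  9*n^12 - 216*n^11 + 1800*n^10 - 4320*n^9 - 30864*n^8 + 251136*n^7 - 690432*n^6
    - 1936384*n^5 + 6915840*n^4 + 4818944*n^3 - 16644096*n^2 - 3039232*n + 6131712

/-- `d₀(n)`, the real cube root of `-(d₁(n) + 36√(d₂(n)))`. -/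
def dd0 (n : ℝ) : ℝ := (-(dd1 n + 36 * Real.sqrt (dd2 n))) ^ ((1 : ℝ)/3)

def dfn (n : ℝ) : ℝ :=
  (1/6) * Real.sqrt (9*n^2 + 96 - (1536 + 1152*n^2) / dd0 n - (3/2) * dd0 n)

/-- The Joseph–Lundgren exponent `p_c(n)` (for `n ≥ 15`; `p_c(n) = +∞` for `n ≤ 14`,
which is encoded by imposing the bound `p < pc n` only when `15 ≤ n`). -/
def pc (n : ℝ) : ℝ := (n + 4 - 2 * dfn n) / (n - 8 - 2 * dfn n)

/-- Abstract calculus on the punctured space, in cylindrical variables. -/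
structure Cyl (A : Type) [CommRing A] [Algebra ℝ A] (P : Type) where
  ev : P → A →ₐ[ℝ] ℝ
  D : A →ₗ[ℝ] A
  leibniz : ∀ f g, D (f * g) = D f * g + f * D g
  Lam : A →ₗ[ℝ] A
  Gam : A →ₗ[ℝ] A →ₗ[ℝ] A
  CS : Ideal A
  Rad : Subalgebra ℝ A
  I : A →ₗ[ℝ] ℝ
  D_CS : ∀ f ∈ CS, D f ∈ CS
  D_Rad : ∀ f ∈ Rad, D f ∈ Rad
  Lam_D : ∀ f, Lam (D f) = D (Lam f)
  Lam_CS : ∀ f ∈ CS, Lam f ∈ CS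
  Gam_symm : ∀ f g, Gam f g = Gam g f
  Gam_D : ∀ f g, D (Gam f g) = Gam (D f) g + Gam f (D g)
  Gam_rad : ∀ r ∈ Rad, ∀ f g, Gam (r * f) g = r * Gam f g
  Lam_rad : ∀ r ∈ Rad, ∀ f, Lam (r * f) = r * Lam f
  Gam_nonneg : ∀ x f, 0 ≤ ev x (Gam f f)
  Gam_CS : ∀ f ∈ CS, ∀ g, Gam f g ∈ CS
  I_nonneg : ∀ f ∈ CS, (∀ x, 0 ≤ ev x f) → 0 ≤ I f
  I_D : ∀ f ∈ CS, I (D f) = 0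
  I_Lam : ∀ f ∈ CS, ∀ g, I (f * Lam g) = I (Gam f g)
  I_Lam' : ∀ f ∈ CS, ∀ g, I (Lam f * g) = I (Gam f g)

namespace Cyl

variable {A : Type} [CommRing A] [Algebra ℝ A] {P : Type} (c : Cyl A P)

/-- Nonnegative symmetric bilinear forms compatible with the structure. -/
structure Form where
  b : A →ₗ[ℝ] A →ₗ[ℝ] A
  symm : ∀ f g, b f g = b g f
  leib : ∀ f g, c.D (b f g) = b (c.D f) g + b f (c.D g)
  rad : ∀ r ∈ c.Rad, ∀ f g, b (r * f) g = r * b f g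
  nonneg : ∀ x f, 0 ≤ c.ev x (b f f)
  cs : ∀ f ∈ c.CS, ∀ g, b f g ∈ c.CS

def beta0 : c.Form where
  b := LinearMap.mul ℝ A
  symm f g := by simp [mul_comm]
  leib f g := by simp [c.leibniz]
  rad r _ f g := by simp [mul_assoc]
  nonneg x f := by simp [mul_self_nonneg]
  cs f hf g := by simpa using c.CS.mul_mem_right g hf

def beta1 : c.Form where
  b := c.Gam
  symm := c.Gam_symm
  leib := c.Gam_D
  rad := c.Gam_rad
  nonneg := c.Gam_nonneg
  cs := c.Gam_CS

/-- Precompose a form with `Λ`. -/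
def Form.lam {c : Cyl A P} (b : c.Form) : c.Form where
  b := b.b.compl₁₂ c.Lam c.Lam
  symm f g := by simpa using b.symm _ _
  leib f g := by simp [b.leib, c.Lam_D]
  rad r hr f g := by simp [c.Lam_rad r hr, b.rad r hr]
  nonneg x f := by simpa using b.nonneg _ _
  cs f hf g := by simpa using b.cs _ (c.Lam_CS f hf) _

def beta2 : c.Form := c.beta0.lam
def beta3 : c.Form := c.beta1.lam

variable {c}

@[simp] lemma beta0_apply (f g : A) : c.beta0.b f g = f * g := by simp [beta0]
@[simp] lemma beta1_apply (f g : A) : c.beta1.b f g = c.Gam f g := rfl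
@[simp] lemma beta2_apply (f g : A) : c.beta2.b f g = c.Lam f * c.Lam g := by
  simp [beta2, Form.lam]
@[simp] lemma beta3_apply (f g : A) : c.beta3.b f g = c.Gam (c.Lam f) (c.Lam g) := rfl

lemma I_mono {f g : A} (hf : f ∈ c.CS) (hg : g ∈ c.CS) (h : ∀ x, c.ev x f ≤ c.ev x g) :
    c.I f ≤ c.I g := by
  have := c.I_nonneg (g - f) (c.CS.sub_mem hg hf) (fun x => by simpa using h x)
  simpa using this

lemma I_congr {f g : A} (hf : f ∈ c.CS) (hg : g ∈ c.CS) (h : ∀ x, c.ev x f = c.ev x g) :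
    c.I f = c.I g :=
  le_antisymm (I_mono hf hg fun x => (h x).le) (I_mono hg hf fun x => (h x).ge)

lemma Form.rad' (b : c.Form) (r : A) (hr : r ∈ c.Rad) (f g : A) : b.b f (r * g) = r * b.b f g := by
  rw [b.symm, b.rad r hr, b.symm]

lemma Form.cs' (b : c.Form) (f g : A) (hg : g ∈ c.CS) : b.b f g ∈ c.CS := by
  rw [b.symm]; exact b.cs g hg f

lemma Form.ibp (b : c.Form) {f : A} (hf : f ∈ c.CS) (g : A) :
    c.I (b.b f (c.D g)) = - c.I (b.b (c.D f) g) := by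
  have h := c.I_D (b.b f g) (b.cs f hf g)
  rw [b.leib, map_add] at h
  linarith

/-- Weighted Cauchy–Schwarz, pointwise. -/
lemma Form.cauchy (b : c.Form) (x : P) (f g : A) {t : ℝ} (ht : 0 < t) :
    2 * |c.ev x (b.b f g)| ≤ t * c.ev x (b.b f f) + t⁻¹ * c.ev x (b.b g g) := by
  have h1 := b.nonneg x (t • f - g)
  have h2 := b.nonneg x (t • f + g)
  simp only [map_sub, map_add, map_smul, LinearMap.sub_apply, LinearMap.add_apply,
    LinearMap.smul_apply, smul_eq_mul, b.symm g f] at h1 h2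
  have hti : t * t⁻¹ = 1 := mul_inv_cancel₀ ht.ne'
  have htp : 0 < t⁻¹ := inv_pos.mpr ht
  have e1 : 2 * c.ev x (b.b f g) ≤ t * c.ev x (b.b f f) + t⁻¹ * c.ev x (b.b g g) := by
    have := mul_nonneg htp.le h1
    have e : t⁻¹ * (t * (t * (c.ev x) ((b.b f) f)) - (c.ev x) ((b.b f) g) * 0) = t * c.ev x (b.b f f) := by
      field_simp; ring
    have : 0 ≤ (t⁻¹ * t) * (t * c.ev x (b.b f f)) - 2 * ((t⁻¹ * t) * c.ev x (b.b f g))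
        + t⁻¹ * c.ev x (b.b g g) := by
      nlinarith [this]
    rw [mul_comm t⁻¹ t, hti] at this; linarith
  have e2 : -(2 * c.ev x (b.b f g)) ≤ t * c.ev x (b.b f f) + t⁻¹ * c.ev x (b.b g g) := by
    have := mul_nonneg htp.le h2
    have : 0 ≤ (t⁻¹ * t) * (t * c.ev x (b.b f f)) + 2 * ((t⁻¹ * t) * c.ev x (b.b f g))
        + t⁻¹ * c.ev x (b.b g g) := by
      nlinarith [this]
    rw [mul_comm t⁻¹ t, hti] at this; linarith
  rcases abs_cases (c.ev x (b.b f g)) with h | h <;> rw [h.1] <;> linarith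

/-- Term bound: `|e| ≤ C Y Z` gives `|e β(f,g)| ≤ C (t⁻¹ Y² β(f,f) + t Z² β(g,g))`. -/
lemma Form.term (b : c.Form) (x : P) (f g : A) {t C Y Z e : ℝ} (ht : 0 < t) (hC : 0 ≤ C)
    (hY : 0 ≤ Y) (hZ : 0 ≤ Z) (he : |e| ≤ C * (Y * Z)) :
    |e * c.ev x (b.b f g)| ≤
      C * (t⁻¹ * (Y ^ 2 * c.ev x (b.b f f)) + t * (Z ^ 2 * c.ev x (b.b g g))) := by
  have h := b.cauchy x (Y • f) (Z • g) (t := t⁻¹) (inv_pos.mpr ht)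
  simp only [map_smul, LinearMap.smul_apply, smul_eq_mul, inv_inv, abs_mul, abs_of_nonneg hY,
    abs_of_nonneg hZ] at h
  rw [abs_mul]
  have hg : 0 ≤ |c.ev x (b.b f g)| := abs_nonneg _
  have hp : 0 ≤ t⁻¹ * (Y ^ 2 * c.ev x (b.b f f)) + t * (Z ^ 2 * c.ev x (b.b g g)) := by
    have := b.nonneg x f; have := b.nonneg x g; positivity
  calc |e| * |c.ev x (b.b f g)| ≤ (C * (Y * Z)) * |c.ev x (b.b f g)| := by gcongr
    _ = C * (Y * (Z * |c.ev x (b.b f g)|)) := by ring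
    _ ≤ C * (t⁻¹ * (Y ^ 2 * c.ev x (b.b f f)) + t * (Z ^ 2 * c.ev x (b.b g g))) := by
        gcongr
        nlinarith

/-- The operator `P₀(D+α)` with `μ² = m2 + Λ`. -/
def PP (c : Cyl A P) (α m2 : ℝ) (w : A) : A :=
  (α^6 - α^4*(8+3*m2) + α^2*(16+3*m2^2) - m2*(m2-4)^2) • w
  + (-3*α^4 + 6*α^2*m2 - (m2-4)*(3*m2-4)) • c.Lam w
  + (3*α^2 - (3*m2-8)) • c.Lam (c.Lam w)
  - c.Lam (c.Lam (c.Lam w))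
  + (6*α^5 - 4*α^3*(8+3*m2) + 2*α*(16+3*m2^2)) • c.D w
  + (-12*α^3 + 12*α*m2) • c.Lam (c.D w)
  + (6*α) • c.Lam (c.Lam (c.D w))
  + (15*α^4 - 6*α^2*(8+3*m2) + 16 + 3*m2^2) • c.D (c.D w)
  + (-18*α^2 + 6*m2) • c.Lam (c.D (c.D w))
  + (3:ℝ) • c.Lam (c.Lam (c.D (c.D w)))
  + (20*α^3 - 4*α*(8+3*m2)) • c.D (c.D (c.D w))
  + (-12*α) • c.Lam (c.D (c.D (c.D w)))
  + (15*α^2 - 8 - 3*m2) • c.D (c.D (c.D (c.D w)))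
  + (-3:ℝ) • c.Lam (c.D (c.D (c.D (c.D w))))
  + (6*α) • c.D (c.D (c.D (c.D (c.D w))))
  + c.D (c.D (c.D (c.D (c.D (c.D w)))))

lemma I_L1 {g : A} (hg : g ∈ c.CS) (h : A) : c.I (g * c.Lam h) = c.I (c.beta1.b g h) :=
  c.I_Lam g hg h
lemma I_L2 {g : A} (hg : g ∈ c.CS) (h : A) : c.I (g * c.Lam (c.Lam h)) = c.I (c.beta2.b g h) := by
  rw [c.I_Lam g hg, ← c.I_Lam' g hg, beta2_apply]
lemma I_L3 {g : A} (hg : g ∈ c.CS) (h : A) :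
    c.I (g * c.Lam (c.Lam (c.Lam h))) = c.I (c.beta3.b g h) := by
  rw [I_L2 hg, beta2_apply, c.I_Lam _ (c.Lam_CS g hg), beta3_apply]

/-- Weak form of the operator. -/
lemma I_PP (α m2 : ℝ) {g : A} (hg : g ∈ c.CS) (w : A) :
    c.I (g * c.PP α m2 w) =
      ((α^6 - α^4*(8+3*m2) + α^2*(16+3*m2^2) - m2*(m2-4)^2) * c.I (c.beta0.b g w)
      + (-3*α^4 + 6*α^2*m2 - (m2-4)*(3*m2-4)) * c.I (c.beta1.b g w)
      + (3*α^2 - (3*m2-8)) * c.I (c.beta2.b g w)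
      - c.I (c.beta3.b g w))
      + ((6*α^5 - 4*α^3*(8+3*m2) + 2*α*(16+3*m2^2)) * c.I (c.beta0.b g (c.D w))
      + (-12*α^3 + 12*α*m2) * c.I (c.beta1.b g (c.D w))
      + (6*α) * c.I (c.beta2.b g (c.D w)))
      - ((15*α^4 - 6*α^2*(8+3*m2) + 16 + 3*m2^2) * c.I (c.beta0.b (c.D g) (c.D w))
      + (-18*α^2 + 6*m2) * c.I (c.beta1.b (c.D g) (c.D w))
      + 3 * c.I (c.beta2.b (c.D g) (c.D w)))
      - ((20*α^3 - 4*α*(8+3*m2)) * c.I (c.beta0.b (c.D g) (c.D (c.D w)))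
      + (-12*α) * c.I (c.beta1.b (c.D g) (c.D (c.D w))))
      + ((15*α^2 - 8 - 3*m2) * c.I (c.beta0.b (c.D (c.D g)) (c.D (c.D w)))
      + (-3) * c.I (c.beta1.b (c.D (c.D g)) (c.D (c.D w))))
      + (6*α) * c.I (c.beta0.b (c.D (c.D g)) (c.D (c.D (c.D w))))
      - c.I (c.beta0.b (c.D (c.D (c.D g))) (c.D (c.D (c.D w)))) := by
  have h1 := c.D_CS g hg
  have h2 := c.D_CS _ h1
  have e : ∀ h : A, c.I (g * h) = c.I (c.beta0.b g h) := fun h => by rw [beta0_apply]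
  simp only [PP, mul_add, mul_sub, map_add, map_sub, mul_smul_comm, map_smul, smul_eq_mul]
  rw [I_L1 hg, I_L2 hg, I_L3 hg, I_L1 hg, I_L2 hg, I_L1 hg, I_L2 hg, I_L1 hg, I_L1 hg]
  simp only [e]
  rw [c.beta0.ibp hg (c.D w), c.beta1.ibp hg (c.D w), c.beta2.ibp hg (c.D w),
    c.beta0.ibp hg (c.D (c.D w)), c.beta1.ibp hg (c.D (c.D w)),
    c.beta0.ibp hg (c.D (c.D (c.D w))), c.beta0.ibp h1 (c.D (c.D w)),
    c.beta1.ibp hg (c.D (c.D (c.D w))), c.beta1.ibp h1 (c.D (c.D w)),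
    c.beta0.ibp hg (c.D (c.D (c.D (c.D w)))), c.beta0.ibp h1 (c.D (c.D (c.D w))),
    c.beta0.ibp hg (c.D (c.D (c.D (c.D (c.D w))))), c.beta0.ibp h1 (c.D (c.D (c.D (c.D w)))),
    c.beta0.ibp h2 (c.D (c.D (c.D w)))]
  ring

/-- The stability form is the weak form with `α = 0`. -/
def SS (c : Cyl A P) (m2 : ℝ) (ψ : A) : ℝ :=
  (m2*(m2-4)^2) * c.I (c.beta0.b ψ ψ) + ((m2-4)*(3*m2-4)) * c.I (c.beta1.b ψ ψ)
  + (3*m2-8) * c.I (c.beta2.b ψ ψ) + c.I (c.beta3.b ψ ψ)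
  + (16+3*m2^2) * c.I (c.beta0.b (c.D ψ) (c.D ψ)) + (6*m2) * c.I (c.beta1.b (c.D ψ) (c.D ψ))
  + 3 * c.I (c.beta2.b (c.D ψ) (c.D ψ))
  + (8+3*m2) * c.I (c.beta0.b (c.D (c.D ψ)) (c.D (c.D ψ)))
  + 3 * c.I (c.beta1.b (c.D (c.D ψ)) (c.D (c.D ψ)))
  + c.I (c.beta0.b (c.D (c.D (c.D ψ))) (c.D (c.D (c.D ψ))))

lemma SS_eq (m2 : ℝ) {ψ : A} (hψ : ψ ∈ c.CS) : c.SS m2 ψ = - c.I (ψ * c.PP 0 m2 ψ) := by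
  rw [I_PP 0 m2 hψ, SS]; ring

lemma D_radmul1 (η w : A) : c.D (η * w) = c.D η * w + η * c.D w := c.leibniz _ _
lemma D_radmul2 (η w : A) : c.D (c.D (η * w)) =
    c.D (c.D η) * w + 2 • (c.D η * c.D w) + η * c.D (c.D w) := by
  simp only [c.leibniz, map_add]; ring
lemma D_radmul3 (η w : A) : c.D (c.D (c.D (η * w))) =
    c.D (c.D (c.D η)) * w + 3 • (c.D (c.D η) * c.D w) + 3 • (c.D η * c.D (c.D w))
      + η * c.D (c.D (c.D w)) := by
  simp only [c.leibniz, map_add]; ring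

end Cyl

namespace Cyl

variable {A : Type} [CommRing A] [Algebra ℝ A] {P : Type} {c : Cyl A P}

lemma I_abs_le {f g : A} (hf : f ∈ c.CS) (hg : g ∈ c.CS) (h : ∀ x, |c.ev x f| ≤ c.ev x g) :
    |c.I f| ≤ c.I g := by
  rw [abs_le]
  constructor
  · have := I_mono (c := c) (f := -g) (g := f) (c.CS.neg_mem hg) hf
      (fun x => by simpa using (abs_le.mp (h x)).1)
    simpa using this
  · exact I_mono hf hg fun x => (abs_le.mp (h x)).2

/-- Weighted quadratic quantity. -/
def Form.N (b : c.Form) (Y f : A) : ℝ := c.I (Y ^ 2 * b.b f f)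

lemma sq_CS {Y : A} (hY : Y ∈ c.CS) : Y ^ 2 ∈ c.CS := by
  rw [pow_two]; exact c.CS.mul_mem_right _ hY

lemma Form.N_nonneg (b : c.Form) {Y : A} (hY : Y ∈ c.CS) (f : A) : 0 ≤ b.N Y f := by
  refine c.I_nonneg _ (c.CS.mul_mem_right _ (sq_CS hY)) fun x => ?_
  rw [map_mul, map_pow]
  exact mul_nonneg (sq_nonneg _) (b.nonneg x f)

lemma Form.IT (b : c.Form) {e Y Z : A} (f g : A) {s C : ℝ} (hs : 0 < s) (hC : 0 ≤ C)
    (he : e ∈ c.CS) (hY : Y ∈ c.CS) (hZ : Z ∈ c.CS)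
    (hY0 : ∀ x, 0 ≤ c.ev x Y) (hZ0 : ∀ x, 0 ≤ c.ev x Z)
    (hb : ∀ x, |c.ev x e| ≤ C * (c.ev x Y * c.ev x Z)) :
    |c.I (e * b.b f g)| ≤ C * (s⁻¹ * b.N Y f + s * b.N Z g) := by
  have h := I_abs_le (c := c) (f := e * b.b f g)
    (g := C • (s⁻¹ • (Y ^ 2 * b.b f f) + s • (Z ^ 2 * b.b g g)))
    (c.CS.mul_mem_right _ he)
    (by
      refine Submodule.smul_of_tower_mem _ _ (c.CS.add_mem ?_ ?_)
      · exact Submodule.smul_of_tower_mem _ _ (c.CS.mul_mem_right _ (sq_CS hY))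
      · exact Submodule.smul_of_tower_mem _ _ (c.CS.mul_mem_right _ (sq_CS hZ)))
    (fun x => by
      have := b.term x f g hs hC (hY0 x) (hZ0 x) (hb x)
      simpa [mul_add] using this)
  simpa [Form.N, mul_add] using h

section terms
variable (b : c.Form) {r : A} (w : A) {s C : ℝ}

lemma Form.IT1 (hr : r ∈ c.Rad) (h : A) :
    c.I (b.b (c.D (r * w)) h) = c.I (c.D r * b.b w h) + c.I (r * b.b (c.D w) h) := by
  rw [D_radmul1, map_add, LinearMap.add_apply, b.rad _ (c.D_Rad r hr), b.rad _ hr, map_add]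

lemma Form.IT2 (hr : r ∈ c.Rad) (h : A) :
    c.I (b.b (c.D (c.D (r * w))) h) = c.I (c.D (c.D r) * b.b w h)
      + 2 * c.I (c.D r * b.b (c.D w) h) + c.I (r * b.b (c.D (c.D w)) h) := by
  rw [D_radmul2]
  simp only [map_add, LinearMap.add_apply, map_nsmul, LinearMap.smul_apply,
    b.rad _ (c.D_Rad r hr), b.rad _ (c.D_Rad _ (c.D_Rad r hr)), b.rad _ hr]
  simp

lemma Form.IT3 (hr : r ∈ c.Rad) (h : A) :
    c.I (b.b (c.D (c.D (c.D (r * w)))) h) = c.I (c.D (c.D (c.D r)) * b.b w h)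
      + 3 * c.I (c.D (c.D r) * b.b (c.D w) h)
      + 3 * c.I (c.D r * b.b (c.D (c.D w)) h) + c.I (r * b.b (c.D (c.D (c.D w))) h) := by
  rw [D_radmul3]
  simp only [map_add, LinearMap.add_apply, map_nsmul, LinearMap.smul_apply,
    b.rad _ (c.D_Rad r hr), b.rad _ (c.D_Rad _ (c.D_Rad r hr)),
    b.rad _ (c.D_Rad _ (c.D_Rad _ (c.D_Rad r hr))), b.rad _ hr]
  simp

end terms

/-- `β(f+g) ≤ (1+t) β(g) + (1+1/t) β(f)`. -/
lemma Form.add_le (b : c.Form) (x : P) (f g : A) {t : ℝ} (ht : 0 < t) :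
    c.ev x (b.b (f + g) (f + g)) ≤
      (1 + t) * c.ev x (b.b g g) + (1 + t⁻¹) * c.ev x (b.b f f) := by
  have h := b.cauchy x g f ht
  have h2 := le_abs_self (c.ev x (b.b g f))
  simp only [map_add, LinearMap.add_apply, b.symm f g]
  linarith

lemma Form.ev_rad (b : c.Form) {r : A} (hr : r ∈ c.Rad) (x : P) (f : A) :
    c.ev x (b.b (r * f) (r * f)) = (c.ev x r) ^ 2 * c.ev x (b.b f f) := by
  rw [b.rad r hr, b.rad' r hr, map_mul, map_mul]; ring

/-- expansions of `β(D^i(ηw),D^i(ηw))`, pointwise upper bounds -/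
lemma Form.U1 (b : c.Form) {η : A} (hη : η ∈ c.Rad) (w : A) (x : P) {t : ℝ} (ht : 0 < t) :
    c.ev x (b.b (c.D (η * w)) (c.D (η * w))) ≤
      (1 + t) * ((c.ev x η) ^ 2 * c.ev x (b.b (c.D w) (c.D w)))
      + (1 + t⁻¹) * ((c.ev x (c.D η)) ^ 2 * c.ev x (b.b w w)) := by
  rw [D_radmul1]
  have := b.add_le x (c.D η * w) (η * c.D w) ht
  rwa [b.ev_rad (c.D_Rad η hη), b.ev_rad hη] at this

lemma Form.U2 (b : c.Form) {η : A} (hη : η ∈ c.Rad) (w : A) (x : P) {t : ℝ} (ht : 0 < t) :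
    c.ev x (b.b (c.D (c.D (η * w))) (c.D (c.D (η * w)))) ≤
      (1 + t) * ((c.ev x η) ^ 2 * c.ev x (b.b (c.D (c.D w)) (c.D (c.D w))))
      + (1 + t⁻¹) * (8 * ((c.ev x (c.D η)) ^ 2 * c.ev x (b.b (c.D w) (c.D w)))
        + 2 * ((c.ev x (c.D (c.D η))) ^ 2 * c.ev x (b.b w w))) := by
  have hη1 := c.D_Rad η hη
  have hη2 := c.D_Rad _ hη1
  rw [D_radmul2]
  have h1 := b.add_le x (c.D (c.D η) * w + 2 • (c.D η * c.D w)) (η * c.D (c.D w)) ht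
  have h2 := b.add_le x (c.D (c.D η) * w) (2 • (c.D η * c.D w)) one_pos
  simp only [map_nsmul, LinearMap.smul_apply] at h2
  rw [b.ev_rad hη1, b.ev_rad hη2] at h2
  rw [b.ev_rad hη] at h1
  refine h1.trans ?_
  have h3 : 0 < 1 + t⁻¹ := by positivity
  gcongr
  refine h2.trans ?_
  simp only [nsmul_eq_mul]
  norm_num
  linarith

lemma Form.U3 (b : c.Form) {η : A} (hη : η ∈ c.Rad) (w : A) (x : P) {t : ℝ} (ht : 0 < t) :
    c.ev x (b.b (c.D (c.D (c.D (η * w)))) (c.D (c.D (c.D (η * w))))) ≤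
      (1 + t) * ((c.ev x η) ^ 2 * c.ev x (b.b (c.D (c.D (c.D w))) (c.D (c.D (c.D w)))))
      + (1 + t⁻¹) * (36 * ((c.ev x (c.D η)) ^ 2 * c.ev x (b.b (c.D (c.D w)) (c.D (c.D w))))
        + 36 * ((c.ev x (c.D (c.D η))) ^ 2 * c.ev x (b.b (c.D w) (c.D w)))
        + 2 * ((c.ev x (c.D (c.D (c.D η)))) ^ 2 * c.ev x (b.b w w))) := by
  have hη1 := c.D_Rad η hη
  have hη2 := c.D_Rad _ hη1
  have hη3 := c.D_Rad _ hη2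
  rw [D_radmul3]
  have h1 := b.add_le x (c.D (c.D (c.D η)) * w + 3 • (c.D (c.D η) * c.D w)
    + 3 • (c.D η * c.D (c.D w))) (η * c.D (c.D (c.D w))) ht
  have h2 := b.add_le x (c.D (c.D (c.D η)) * w)
    (3 • (c.D (c.D η) * c.D w) + 3 • (c.D η * c.D (c.D w))) one_pos
  rw [← add_assoc] at h2
  have h4 := b.add_le x (3 • (c.D (c.D η) * c.D w)) (3 • (c.D η * c.D (c.D w))) one_pos
  simp only [map_nsmul, LinearMap.smul_apply] at h4
  rw [b.ev_rad hη1, b.ev_rad hη2] at h4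
  rw [b.ev_rad hη3] at h2
  rw [b.ev_rad hη] at h1
  refine h1.trans ?_
  have h3 : 0 < 1 + t⁻¹ := by positivity
  gcongr
  refine h2.trans ?_
  simp only [nsmul_eq_mul] at h4
  norm_num at h4 ⊢
  linarith

lemma D_one : c.D 1 = 0 := by
  have h := c.leibniz 1 1
  simpa using h

lemma D_pow (ξ : A) (N : ℕ) : c.D (ξ ^ (N + 1)) = (N + 1 : ℝ) • (ξ ^ N * c.D ξ) := by
  induction N with
  | zero => simp
  | succ N ih =>
    rw [pow_succ, c.leibniz, ih]
    push_cast
    simp only [Algebra.smul_def, map_add, map_one, map_natCast]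
    ring

/-- Hypotheses on a radial cutoff. -/
structure Cut (c : Cyl A P) (ξ : A) (C0 : ℝ) : Prop where
  rad : ξ ∈ c.Rad
  cs : ξ ∈ c.CS
  nn : ∀ x, 0 ≤ c.ev x ξ
  le1 : ∀ x, c.ev x ξ ≤ 1
  d1 : ∀ x, |c.ev x (c.D ξ)| ≤ C0
  d2 : ∀ x, |c.ev x (c.D (c.D ξ))| ≤ C0
  d3 : ∀ x, |c.ev x (c.D (c.D (c.D ξ)))| ≤ C0

def powC (C0 : ℝ) (N : ℕ) : ℝ := 5 * (N + 3) ^ 3 * (C0 + 1) ^ 3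

lemma powC_pos {C0 : ℝ} (h : 0 ≤ C0) (N : ℕ) : 0 < powC C0 N := by
  unfold powC; positivity

lemma powC_one {C0 : ℝ} (h : 0 ≤ C0) (N : ℕ) : 1 ≤ powC C0 N := by
  unfold powC
  have h1 : (1:ℝ) ≤ ((N:ℝ) + 3) ^ 3 := one_le_pow₀ (by have : (0:ℝ) ≤ N := by positivity
                                                       linarith)
  have h2 : (1:ℝ) ≤ (C0 + 1) ^ 3 := one_le_pow₀ (by linarith)
  nlinarith

set_option maxHeartbeats 1000000 in
lemma Cut.pow_bounds {ξ : A} {C0 : ℝ} (h : c.Cut ξ C0) (hC : 0 ≤ C0) (N : ℕ) (x : P) :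
    |c.ev x (c.D (ξ ^ (N + 3)))| ≤ powC C0 N * (c.ev x ξ) ^ (N + 2) ∧
    |c.ev x (c.D (c.D (ξ ^ (N + 3))))| ≤ powC C0 N * (c.ev x ξ) ^ (N + 1) ∧
    |c.ev x (c.D (c.D (c.D (ξ ^ (N + 3)))))| ≤ powC C0 N * (c.ev x ξ) ^ N := by
  have e1 := D_pow (c := c) ξ (N + 2)
  have e2 := D_pow (c := c) ξ (N + 1)
  have e3 := D_pow (c := c) ξ N
  have hx0 := h.nn x
  have hx1 := h.le1 x
  have a1 := h.d1 x
  have a2 := h.d2 x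
  have a3 := h.d3 x
  have f1 : c.D (ξ ^ (N + 3)) = (N + 3 : ℝ) • (ξ ^ (N+2) * c.D ξ) := by
    have := e1; push_cast at this; rw [this]; congr 1; ring
  have f2 : c.D (c.D (ξ ^ (N + 3))) = ((N + 3) * (N + 2) : ℝ) • (ξ ^ (N+1) * (c.D ξ * c.D ξ))
      + (N + 3 : ℝ) • (ξ ^ (N+2) * c.D (c.D ξ)) := by
    rw [f1, map_smul, c.leibniz]
    have := e2; push_cast at this; rw [this, smul_add, smul_mul_assoc, smul_smul]
    congr 2 <;> ring
  have f3 : c.D (c.D (c.D (ξ ^ (N + 3)))) =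
      ((N + 3) * (N + 2) * (N + 1) : ℝ) • (ξ ^ N * (c.D ξ * (c.D ξ * c.D ξ)))
      + (3 * ((N + 3) * (N + 2)) : ℝ) • (ξ ^ (N+1) * (c.D ξ * c.D (c.D ξ)))
      + (N + 3 : ℝ) • (ξ ^ (N+2) * c.D (c.D (c.D ξ))) := by
    rw [f2, map_add, map_smul, map_smul, c.leibniz, c.leibniz, c.leibniz (ξ ^ (N + 2)), e3]
    have := e2; push_cast at this; rw [this]
    simp only [Algebra.smul_def, map_mul, map_add, map_natCast, map_one, map_ofNat]
    ring
  rw [f3, f2, f1]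
  simp only [map_add, map_smul, map_mul, map_pow, smul_eq_mul]
  set X := c.ev x ξ
  set u1 := c.ev x (c.D ξ)
  set u2 := c.ev x (c.D (c.D ξ))
  set u3 := c.ev x (c.D (c.D (c.D ξ)))
  set E := C0 + 1 with hE
  have hE1 : 1 ≤ E := by linarith
  have b1 : |u1| ≤ E := by linarith
  have b2 : |u2| ≤ E := by linarith
  have b3 : |u3| ≤ E := by linarith
  set n : ℝ := (N : ℝ) + 3 with hn
  have hn3 : 3 ≤ n := by have : (0:ℝ) ≤ N := by positivity
                         linarith
  have hN2 : (N:ℝ) + 2 = n - 1 := by rw [hn]; ring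
  have hN1 : (N:ℝ) + 1 = n - 2 := by rw [hn]; ring
  rw [hN2, hN1]
  have hE2 : E ≤ E ^ 2 := by nlinarith
  have hE3 : E ^ 2 ≤ E ^ 3 := by nlinarith [sq_nonneg E]
  have hEp : 0 < E := by linarith
  have p0 : 0 ≤ X ^ N := pow_nonneg hx0 _
  have p1 : 0 ≤ X ^ (N+1) := pow_nonneg hx0 _
  have p2 : 0 ≤ X ^ (N+2) := pow_nonneg hx0 _
  have q1 : X ^ (N+1) ≤ X ^ N := pow_le_pow_of_le_one hx0 hx1 (by omega)
  have q2 : X ^ (N+2) ≤ X ^ (N+1) := pow_le_pow_of_le_one hx0 hx1 (by omega)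
  have n2 : n ≤ n ^ 2 := by nlinarith
  have n3 : n ^ 2 ≤ n ^ 3 := by nlinarith [sq_nonneg n]
  have np : 0 < n := by linarith
  have v11 : |u1 * u1| ≤ E ^ 2 := by rw [abs_mul, pow_two]; gcongr
  have v111 : |u1 * (u1 * u1)| ≤ E ^ 3 := by
    rw [abs_mul, pow_succ' E 2]; gcongr
  have v12 : |u1 * u2| ≤ E ^ 2 := by rw [abs_mul, pow_two]; gcongr
  have key : ∀ a q v B m : ℝ, 0 ≤ a → a ≤ m → 0 ≤ q → |v| ≤ B → |a * (q * v)| ≤ m * (q * B) := by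
    intro a q v B m ha ham hq hv
    rw [abs_mul, abs_mul, abs_of_nonneg ha, abs_of_nonneg hq]
    have : 0 ≤ |v| := abs_nonneg v
    have : 0 ≤ B := le_trans this hv
    have : 0 ≤ m := ha.trans ham
    gcongr
  have hpc : powC C0 N = 5 * n ^ 3 * E ^ 3 := rfl
  have nE : 0 < n ^ 3 * E ^ 3 := by positivity
  rw [hpc]
  have c1 : n ^ 3 * (X ^ (N+2) * E) ≤ n ^ 3 * E ^ 3 * X ^ (N+2) := by
    have : n ^ 3 * (X ^ (N+2) * E) ≤ n ^ 3 * (X ^ (N+2) * E ^ 3) := by gcongr; linarith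
    linarith [this]
  have c2 : n ^ 3 * (X ^ (N+1) * E ^ 2) ≤ n ^ 3 * E ^ 3 * X ^ (N+1) := by
    have : n ^ 3 * (X ^ (N+1) * E ^ 2) ≤ n ^ 3 * (X ^ (N+1) * E ^ 3) := by gcongr
    linarith [this]
  have d21 : n ^ 3 * E ^ 3 * X ^ (N+2) ≤ n ^ 3 * E ^ 3 * X ^ (N+1) := by gcongr
  have d10 : n ^ 3 * E ^ 3 * X ^ (N+1) ≤ n ^ 3 * E ^ 3 * X ^ N := by gcongr
  have z2 : 0 ≤ n ^ 3 * E ^ 3 * X ^ (N+2) := by positivity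
  have k1 := key n (X^(N+2)) u1 E (n^3) np.le (by linarith) p2 b1
  have k2 := key (n*(n-1)) (X^(N+1)) (u1*u1) (E^2) (n^3) (by nlinarith) (by nlinarith) p1 v11
  have k3 := key n (X^(N+2)) u2 E (n^3) np.le (by linarith) p2 b2
  have k4 := key (n*(n-1)*(n-2)) (X^N) (u1*(u1*u1)) (E^3) (n^3)
    (by have : 0 ≤ n-1 := by linarith
        have : 0 ≤ n-2 := by linarith
        positivity) (by nlinarith) p0 v111
  have k5 := key (n*(n-1)) (X^(N+1)) (u1*u2) (E^2) (n^3) (by nlinarith) (by nlinarith) p1 v12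
  have k6 := key n (X^(N+2)) u3 E (n^3) np.le (by linarith) p2 b3
  refine ⟨?_, ?_, ?_⟩
  · linarith
  · refine (abs_add_le _ _).trans ?_
    linarith
  · refine (abs_add_le _ _).trans ?_
    have := abs_add_le (n*(n-1)*(n-2) * (X ^ N * (u1 * (u1 * u1))))
      (3 * (n * (n - 1)) * (X ^ (N + 1) * (u1 * u2)))
    have e : |3 * (n * (n - 1)) * (X ^ (N + 1) * (u1 * u2))| =
        3 * |n * (n - 1) * (X ^ (N + 1) * (u1 * u2))| := by
      rw [mul_assoc 3, abs_mul]; norm_num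
    rw [e] at this
    linarith

end Cyl

namespace Cyl

variable {A : Type} [CommRing A] [Algebra ℝ A] {P : Type} {c : Cyl A P}

lemma pow_CS {ξ : A} (h : ξ ∈ c.CS) {s : ℕ} (hs : 1 ≤ s) : ξ ^ s ∈ c.CS := by
  obtain ⟨k, rfl⟩ : ∃ k, s = k + 1 := ⟨s - 1, by omega⟩
  rw [pow_succ]; exact c.CS.mul_mem_left _ h

/-- Error term bound with weights being powers of the cutoff. -/
lemma Cut.err {ξ : A} {C0 : ℝ} (h : c.Cut ξ C0) (b : c.Form) {e : A} (f g : A) {q s s' : ℕ}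
    {Q t : ℝ} (hQ : 0 ≤ Q) (ht : 0 < t) (he : e ∈ c.CS)
    (hb : ∀ x, |c.ev x e| ≤ Q * (c.ev x ξ) ^ q) (hq : s + s' ≤ q) (hs : 1 ≤ s) (hs' : 1 ≤ s') :
    |c.I (e * b.b f g)| ≤ Q * (t⁻¹ * b.N (ξ ^ s) f + t * b.N (ξ ^ s') g) := by
  refine b.IT f g ht hQ he (pow_CS h.cs hs) (pow_CS h.cs hs')
    (fun x => by rw [map_pow]; exact pow_nonneg (h.nn x) _)
    (fun x => by rw [map_pow]; exact pow_nonneg (h.nn x) _) (fun x => ?_)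
  refine (hb x).trans ?_
  rw [map_pow, map_pow, ← pow_add]
  exact mul_le_mul_of_nonneg_left (pow_le_pow_of_le_one (h.nn x) (h.le1 x) hq) hQ

lemma Form.N_mono (b : c.Form) {Y Z : A} (hY : Y ∈ c.CS) (hZ : Z ∈ c.CS) (f : A) {Q : ℝ}
    (h : ∀ x, (c.ev x Y) ^ 2 ≤ Q * (c.ev x Z) ^ 2) : b.N Y f ≤ Q * b.N Z f := by
  have := I_mono (c := c) (f := Y ^ 2 * b.b f f) (g := Q • (Z ^ 2 * b.b f f))
    (c.CS.mul_mem_right _ (sq_CS hY))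
    (Submodule.smul_of_tower_mem _ _ (c.CS.mul_mem_right _ (sq_CS hZ)))
    (fun x => by
      simp only [map_mul, map_pow, map_smul, smul_eq_mul]
      rw [← mul_assoc]
      exact mul_le_mul_of_nonneg_right (h x) (b.nonneg x f))
  simpa [Form.N] using this

/-- interpolation in the `D` direction -/
lemma Cut.interpD {ξ : A} {C0 : ℝ} (h : c.Cut ξ C0) (hC : 0 ≤ C0) (b : c.Form) (f : A) (s : ℕ)
    {Q δ : ℝ} (hQ1 : 1 ≤ Q)
    (hQ : powC C0 (2 * s + 1) ≤ Q) (hδ : 0 < δ) (hδ1 : δ ≤ 1) :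
    b.N (ξ ^ (s + 2)) (c.D f) ≤
      δ * b.N (ξ ^ (s + 3)) (c.D (c.D f)) + (8 * Q ^ 2 / δ) * b.N (ξ ^ (s + 1)) f := by
  have hr : ξ ^ (2 * s + 1 + 3) ∈ c.Rad := c.Rad.pow_mem h.rad _
  have hrc : ξ ^ (2 * s + 1 + 3) ∈ c.CS := pow_CS h.cs (by omega)
  have e0 : b.N (ξ ^ (s + 2)) (c.D f) = c.I (b.b (ξ ^ (2 * s + 1 + 3) * c.D f) (c.D f)) := by
    rw [b.rad _ hr, Form.N, ← pow_mul]; congr 3; ring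
  have e1 := b.ibp (c.CS.mul_mem_right (c.D f) hrc) f
  have e2 := b.IT1 (r := ξ ^ (2 * s + 1 + 3)) (c.D f) hr f
  have hQ0 : 0 ≤ Q := by linarith
  have t1 := h.err b (e := ξ ^ (2 * s + 1 + 3)) (c.D (c.D f)) f (q := 2 * s + 4) (s := s + 3)
    (s' := s + 1) (Q := 1) (t := 2 / δ) (by norm_num) (by positivity) hrc
    (fun x => by rw [map_pow, abs_of_nonneg (pow_nonneg (h.nn x) _)]; simp) (by omega) (by omega)
    (by omega)
  have t2 := h.err b (e := c.D (ξ ^ (2 * s + 1 + 3))) (c.D f) f (q := 2 * s + 3) (s := s + 2)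
    (s' := s + 1) (Q := Q) (t := 2 * Q) hQ0 (by positivity) (c.D_CS _ hrc)
    (fun x => ((h.pow_bounds hC (2 * s + 1) x).1).trans
      (mul_le_mul_of_nonneg_right hQ (pow_nonneg (h.nn x) _))) (by omega) (by omega) (by omega)
  have n1 := b.N_nonneg (pow_CS h.cs (show 1 ≤ s + 1 by omega)) f
  rw [e0, e1, e2]
  rw [e0, e1, e2] at t2
  set X := c.I (c.D (ξ ^ (2 * s + 1 + 3)) * b.b (c.D f) f)
  set Y := c.I (ξ ^ (2 * s + 1 + 3) * b.b (c.D (c.D f)) f)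
  have hX := (abs_le.mp t2).1
  have hY := (abs_le.mp t1).1
  have i1 : Q * ((2 * Q)⁻¹ * -(X + Y) + 2 * Q * b.N (ξ ^ (s+1)) f) =
    -(X+Y)/2 + 2 * Q^2 * b.N (ξ ^ (s+1)) f := by field_simp
  have i2 : (1:ℝ) * ((2 / δ)⁻¹ * b.N (ξ ^ (s+3)) (c.D (c.D f)) + 2 / δ * b.N (ξ ^ (s+1)) f) =
    δ / 2 * b.N (ξ ^ (s+3)) (c.D (c.D f)) + 2 / δ * b.N (ξ ^ (s+1)) f := by field_simp
  rw [i1] at hX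
  rw [i2] at hY
  have i3 : 4 * Q ^ 2 * b.N (ξ ^ (s+1)) f + 4 / δ * b.N (ξ ^ (s+1)) f ≤
      8 * Q ^ 2 / δ * b.N (ξ ^ (s+1)) f := by
    rw [← add_mul]
    refine mul_le_mul_of_nonneg_right ?_ n1
    rw [le_div_iff₀ hδ]
    have : 4 / δ * δ = 4 := by field_simp
    nlinarith
  have i4 : 2 * (2 / δ * b.N (ξ ^ (s+1)) f) = 4 / δ * b.N (ξ ^ (s+1)) f := by ring
  linarith

lemma Cut.interpL1 {ξ : A} {C0 : ℝ} (h : c.Cut ξ C0) (f : A) (s : ℕ)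
    {Q δ : ℝ} (hQ1 : 1 ≤ Q) (hδ : 0 < δ) (_hδ1 : δ ≤ 1) :
    c.beta1.N (ξ ^ (s + 2)) f ≤
      δ * c.beta2.N (ξ ^ (s + 3)) f + (8 * Q ^ 2 / δ) * c.beta0.N (ξ ^ (s + 1)) f := by
  have hr : ξ ^ (2 * s + 4) ∈ c.Rad := c.Rad.pow_mem h.rad _
  have hrc : ξ ^ (2 * s + 4) ∈ c.CS := pow_CS h.cs (by omega)
  have e0 : c.beta1.N (ξ ^ (s + 2)) f = c.I (ξ ^ (2 * s + 4) * c.beta0.b f (c.Lam f)) := by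
    have := c.I_Lam (ξ ^ (2 * s + 4) * f) (c.CS.mul_mem_right _ hrc) f
    rw [c.Gam_rad _ hr] at this
    rw [Form.N, beta0_apply, ← mul_assoc, this, ← pow_mul, beta1_apply]; congr 3; ring
  have e2 : c.beta2.N (ξ ^ (s + 3)) f = c.beta0.N (ξ ^ (s + 3)) (c.Lam f) := by
    simp [Form.N]
  have t1 := h.err c.beta0 (e := ξ ^ (2 * s + 4)) f (c.Lam f) (q := 2 * s + 4) (s := s + 1)
    (s' := s + 3) (Q := 1) (t := δ) (by norm_num) (by positivity) hrc
    (fun x => by rw [map_pow, abs_of_nonneg (pow_nonneg (h.nn x) _)]; simp) (by omega) (by omega)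
    (by omega)
  have n1 := c.beta0.N_nonneg (pow_CS h.cs (show 1 ≤ s + 1 by omega)) f
  have hX := (abs_le.mp t1).2
  rw [e0, e2]
  refine hX.trans ?_
  have : δ⁻¹ * c.beta0.N (ξ ^ (s + 1)) f ≤ (8 * Q ^ 2 / δ) * c.beta0.N (ξ ^ (s + 1)) f := by
    refine mul_le_mul_of_nonneg_right ?_ n1
    rw [inv_eq_one_div]; gcongr; nlinarith
  linarith

lemma Cut.interpL2 {ξ : A} {C0 : ℝ} (h : c.Cut ξ C0) (f : A) (s : ℕ)
    {Q δ : ℝ} (hQ1 : 1 ≤ Q) (hδ : 0 < δ) (_hδ1 : δ ≤ 1) :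
    c.beta2.N (ξ ^ (s + 2)) f ≤
      δ * c.beta3.N (ξ ^ (s + 3)) f + (8 * Q ^ 2 / δ) * c.beta1.N (ξ ^ (s + 1)) f := by
  have hr : ξ ^ (2 * s + 4) ∈ c.Rad := c.Rad.pow_mem h.rad _
  have hrc : ξ ^ (2 * s + 4) ∈ c.CS := pow_CS h.cs (by omega)
  have e0 : c.beta2.N (ξ ^ (s + 2)) f = c.I (ξ ^ (2 * s + 4) * c.beta1.b f (c.Lam f)) := by
    have := c.I_Lam' (ξ ^ (2 * s + 4) * f) (c.CS.mul_mem_right _ hrc) (c.Lam f)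
    rw [c.Gam_rad _ hr, c.Lam_rad _ hr, mul_assoc] at this
    rw [Form.N, beta1_apply, ← this, ← pow_mul, beta2_apply]; congr 3; ring
  have e2 : c.beta3.N (ξ ^ (s + 3)) f = c.beta1.N (ξ ^ (s + 3)) (c.Lam f) := by
    simp [Form.N]
  have t1 := h.err c.beta1 (e := ξ ^ (2 * s + 4)) f (c.Lam f) (q := 2 * s + 4) (s := s + 1)
    (s' := s + 3) (Q := 1) (t := δ) (by norm_num) (by positivity) hrc
    (fun x => by rw [map_pow, abs_of_nonneg (pow_nonneg (h.nn x) _)]; simp) (by omega) (by omega)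
    (by omega)
  have n1 := c.beta1.N_nonneg (pow_CS h.cs (show 1 ≤ s + 1 by omega)) f
  have hX := (abs_le.mp t1).2
  rw [e0, e2]
  refine hX.trans ?_
  have : δ⁻¹ * c.beta1.N (ξ ^ (s + 1)) f ≤ (8 * Q ^ 2 / δ) * c.beta1.N (ξ ^ (s + 1)) f := by
    refine mul_le_mul_of_nonneg_right ?_ n1
    rw [inv_eq_one_div]; gcongr; nlinarith
  linarith

/-- chaining two interpolation inequalities -/
lemma chain (G : ℝ) (hG : 1 ≤ G) {δ : ℝ} (hδ : 0 < δ) (hδ1 : δ ≤ 1) {a b t z : ℝ}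
    (ha : 0 ≤ a) (hb : 0 ≤ b) (ht : 0 ≤ t) (hz : 0 ≤ z)
    (h1 : ∀ e : ℝ, 0 < e → e ≤ 1 → a ≤ e * b + G / e * z)
    (h2 : ∀ e : ℝ, 0 < e → e ≤ 1 → b ≤ e * t + G / e * a) :
    a + b ≤ δ * t + (100 * G ^ 3 / δ ^ 2) * z := by
  have hGp : 0 < G := by linarith
  have k2 := h2 (δ / 4) (by positivity) (by linarith)
  have k1 := h1 (δ / (8 * G)) (by positivity) (by
    rw [div_le_one (by positivity)]; nlinarith)
  have e1 : G / (δ / 4) = 4 * G / δ := by field_simp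
  have e2 : G / (δ / (8 * G)) = 8 * G ^ 2 / δ := by field_simp
  rw [e1] at k2
  rw [e2] at k1
  -- absorb twice
  have k3 : 4 * G / δ * a ≤ 4 * G / δ * (δ / (8 * G) * b + 8 * G ^ 2 / δ * z) := by gcongr
  have e3 : 4 * G / δ * (δ / (8 * G) * b + 8 * G ^ 2 / δ * z) = b / 2 + 32 * G ^ 3 / δ ^ 2 * z := by
    field_simp; ring
  rw [e3] at k3
  have k4 : δ / (8 * G) * b ≤ b / 8 := by
    have : δ / (8 * G) ≤ 1 / 8 := by
      rw [div_le_div_iff₀ (by positivity) (by norm_num)]; nlinarith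
    nlinarith
  have k5 : 8 * G ^ 2 / δ * z ≤ 8 * G ^ 3 / δ ^ 2 * z := by
    refine mul_le_mul_of_nonneg_right ?_ hz
    rw [div_le_div_iff₀ (by positivity) (by positivity)]
    have : G ^ 2 ≤ G ^ 3 := by nlinarith [sq_nonneg G]
    have : δ ^ 2 ≤ δ := by nlinarith
    have : 0 < G ^ 2 := by positivity
    nlinarith [mul_le_mul ‹G ^ 2 ≤ G ^ 3› ‹δ ^ 2 ≤ δ› (by positivity) (by positivity)]
  have e4 : 100 * G ^ 3 / δ ^ 2 * z = 100 * (G ^ 3 / δ ^ 2 * z) := by ring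
  have e5 : 32 * G ^ 3 / δ ^ 2 * z = 32 * (G ^ 3 / δ ^ 2 * z) := by ring
  have e6 : 8 * G ^ 3 / δ ^ 2 * z = 8 * (G ^ 3 / δ ^ 2 * z) := by ring
  rw [e4]; rw [e5] at k3; rw [e6] at k5
  have : 0 ≤ G ^ 3 / δ ^ 2 * z := by positivity
  have : 0 ≤ δ * t := by positivity
  linarith

end Cyl

namespace Cyl

variable {A : Type} [CommRing A] [Algebra ℝ A] {P : Type} {c : Cyl A P}

/-- lower order weighted energy -/
def Low (c : Cyl A P) (ξ : A) (k : ℕ) (w : A) : ℝ :=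
  c.beta0.N (ξ ^ (k+1)) w + c.beta0.N (ξ ^ (k+2)) (c.D w) + c.beta0.N (ξ ^ (k+3)) (c.D (c.D w))
  + c.beta1.N (ξ ^ (k+2)) w + c.beta1.N (ξ ^ (k+3)) (c.D w) + c.beta2.N (ξ ^ (k+3)) w

/-- top order weighted energy -/
def Top (c : Cyl A P) (ξ : A) (k : ℕ) (w : A) : ℝ :=
  c.beta0.N (ξ ^ (k+4)) (c.D (c.D (c.D w))) + 3 * c.beta1.N (ξ ^ (k+4)) (c.D (c.D w))
  + 3 * c.beta2.N (ξ ^ (k+4)) (c.D w) + c.beta3.N (ξ ^ (k+4)) w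

lemma Cut.N_nn {ξ : A} {C0 : ℝ} (h : c.Cut ξ C0) (b : c.Form) (s : ℕ) (f : A) :
    0 ≤ b.N (ξ ^ (s+1)) f := b.N_nonneg (pow_CS h.cs (by omega)) f

lemma powC_mono {C0 : ℝ} (h : 0 ≤ C0) {N M : ℕ} (hNM : N ≤ M) : powC C0 N ≤ powC C0 M := by
  unfold powC
  have : (N:ℝ) ≤ M := by exact_mod_cast hNM
  gcongr

set_option maxHeartbeats 1000000 in
lemma Cut.Fbound {ξ : A} {C0 : ℝ} (h : c.Cut ξ C0) (hC : 0 ≤ C0) (k : ℕ) (w : A) (α m2 : ℝ)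
    {t : ℝ} (ht : 0 < t) (ht1 : t ≤ 1) :
    |-c.I (ξ ^ (2*k+8) * w * c.PP α m2 w) - c.Top ξ k w| ≤
      (|(α^6 - α^4*(8+3*m2) + α^2*(16+3*m2^2) - m2*(m2-4)^2)| + |(-3*α^4 + 6*α^2*m2 - (m2-4)*(3*m2-4))| + |(3*α^2 - (3*m2-8))| + |(6*α^5 - 4*α^3*(8+3*m2) + 2*α*(16+3*m2^2))| + |(-12*α^3 + 12*α*m2)| + |(6*α)| + |(15*α^4 - 6*α^2*(8+3*m2) + 16 + 3*m2^2)| + |(-18*α^2 + 6*m2)| + |(20*α^3 - 4*α*(8+3*m2))| + |(-12*α)| + |(15*α^2 - 8 - 3*m2)| + |(6*α)| + 10) * (powC C0 (2*k+5) * (16 * (t⁻¹ * c.Low ξ k w) + 8 * (t * c.Top ξ k w))) := by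
  set Q := powC C0 (2*k+5) with hQdef
  have hQ1 : 1 ≤ Q := powC_one hC _
  have hQ0 : 0 ≤ Q := by linarith
  have hr : ξ ^ (2*k+8) ∈ c.Rad := c.Rad.pow_mem h.rad _
  have hrc : ξ ^ (2*k+8) ∈ c.CS := pow_CS h.cs (by omega)
  have hrc1 := c.D_CS _ hrc
  have hrc2 := c.D_CS _ hrc1
  have hrc3 := c.D_CS _ hrc2
  have b0 : ∀ x, |c.ev x (ξ ^ (2*k+8))| ≤ Q * (c.ev x ξ) ^ (2*k+8) := fun x => by
    rw [map_pow, abs_of_nonneg (pow_nonneg (h.nn x) _)]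
    exact le_mul_of_one_le_left (pow_nonneg (h.nn x) _) hQ1
  have b1 : ∀ x, |c.ev x (c.D (ξ ^ (2*k+8)))| ≤ Q * (c.ev x ξ) ^ (2*k+7) :=
    fun x => (h.pow_bounds hC (2*k+5) x).1
  have b2 : ∀ x, |c.ev x (c.D (c.D (ξ ^ (2*k+8))))| ≤ Q * (c.ev x ξ) ^ (2*k+6) :=
    fun x => (h.pow_bounds hC (2*k+5) x).2.1
  have b3 : ∀ x, |c.ev x (c.D (c.D (c.D (ξ ^ (2*k+8)))))| ≤ Q * (c.ev x ξ) ^ (2*k+5) :=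
    fun x => (h.pow_bounds hC (2*k+5) x).2.2
  have p00 := h.N_nn c.beta0 (k+0) w
  have p10 := h.N_nn c.beta0 (k+1) (c.D w)
  have p20 := h.N_nn c.beta0 (k+2) (c.D (c.D w))
  have p30 := h.N_nn c.beta0 (k+3) (c.D (c.D (c.D w)))
  have p01 := h.N_nn c.beta1 (k+1) w
  have p11 := h.N_nn c.beta1 (k+2) (c.D w)
  have p21 := h.N_nn c.beta1 (k+3) (c.D (c.D w))
  have p02 := h.N_nn c.beta2 (k+2) w
  have p12 := h.N_nn c.beta2 (k+3) (c.D w)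
  have p03 := h.N_nn c.beta3 (k+3) w
  have hti : 1 ≤ t⁻¹ := (one_le_inv₀ ht).mpr ht1
  set Lw := c.Low ξ k w with hLw
  set Tp := c.Top ξ k w with hTp
  set n00 := c.beta0.N (ξ ^ (k+1)) w with hn00
  replace p00 : 0 ≤ n00 := p00
  set n10 := c.beta0.N (ξ ^ (k+2)) (c.D w) with hn10
  replace p10 : 0 ≤ n10 := p10
  set n20 := c.beta0.N (ξ ^ (k+3)) (c.D (c.D w)) with hn20
  replace p20 : 0 ≤ n20 := p20
  set n30 := c.beta0.N (ξ ^ (k+4)) (c.D (c.D (c.D w))) with hn30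
  replace p30 : 0 ≤ n30 := p30
  set n01 := c.beta1.N (ξ ^ (k+2)) w with hn01
  replace p01 : 0 ≤ n01 := p01
  set n11 := c.beta1.N (ξ ^ (k+3)) (c.D w) with hn11
  replace p11 : 0 ≤ n11 := p11
  set n21 := c.beta1.N (ξ ^ (k+4)) (c.D (c.D w)) with hn21
  replace p21 : 0 ≤ n21 := p21
  set n02 := c.beta2.N (ξ ^ (k+3)) w with hn02
  replace p02 : 0 ≤ n02 := p02
  set n12 := c.beta2.N (ξ ^ (k+4)) (c.D w) with hn12
  replace p12 : 0 ≤ n12 := p12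
  set n03 := c.beta3.N (ξ ^ (k+4)) w with hn03
  replace p03 : 0 ≤ n03 := p03
  have hL : Lw = n00 + n10 + n20 + n01 + n11 + n02 := rfl
  have hT : Tp = n30 + 3 * n21 + 3 * n12 + n03 := rfl
  have hL0 : 0 ≤ Lw := by rw [hL]; positivity
  have hT0 : 0 ≤ Tp := by rw [hT]; positivity
  have g1 : ∀ a b : ℝ, 0 ≤ a → 0 ≤ b → a ≤ Lw → b ≤ Lw + Tp →
      Q * (t⁻¹ * a + t * b) ≤ Q * (2 * (t⁻¹ * Lw) + t * Tp) := by
    intro a b ha hb h1 h2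
    refine mul_le_mul_of_nonneg_left ?_ hQ0
    have e1 : t⁻¹ * a ≤ t⁻¹ * Lw := by gcongr
    have e2 : t * b ≤ t * (Lw + Tp) := by gcongr
    have e3 : t * Lw ≤ t⁻¹ * Lw := mul_le_mul_of_nonneg_right (by linarith) hL0
    linarith
  set Er := Q * (2 * (t⁻¹ * Lw) + t * Tp) with hEr
  have hEr0 : 0 ≤ Er := by rw [hEr]; positivity
  have e0_0_0_0 : |c.I ((ξ ^ (2*k+8)) * c.beta0.b w w)| ≤ Er := (h.err c.beta0 w w (q := 2*k+8) (s := k+1) (s' := k+1) hQ0 ht hrc b0 (by omega) (by omega) (by omega)).trans (g1 n00 n00 p00 p00 (by linarith) (by linarith))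
  have e0_0_0_1 : |c.I ((ξ ^ (2*k+8)) * c.beta1.b w w)| ≤ Er := (h.err c.beta1 w w (q := 2*k+8) (s := k+2) (s' := k+2) hQ0 ht hrc b0 (by omega) (by omega) (by omega)).trans (g1 n01 n01 p01 p01 (by linarith) (by linarith))
  have e0_0_0_2 : |c.I ((ξ ^ (2*k+8)) * c.beta2.b w w)| ≤ Er := (h.err c.beta2 w w (q := 2*k+8) (s := k+3) (s' := k+3) hQ0 ht hrc b0 (by omega) (by omega) (by omega)).trans (g1 n02 n02 p02 p02 (by linarith) (by linarith))
  have e0_0_1_0 : |c.I ((ξ ^ (2*k+8)) * c.beta0.b w (c.D w))| ≤ Er := (h.err c.beta0 w (c.D w) (q := 2*k+8) (s := k+1) (s' := k+2) hQ0 ht hrc b0 (by omega) (by omega) (by omega)).trans (g1 n00 n10 p00 p10 (by linarith) (by linarith))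
  have e0_0_1_1 : |c.I ((ξ ^ (2*k+8)) * c.beta1.b w (c.D w))| ≤ Er := (h.err c.beta1 w (c.D w) (q := 2*k+8) (s := k+2) (s' := k+3) hQ0 ht hrc b0 (by omega) (by omega) (by omega)).trans (g1 n01 n11 p01 p11 (by linarith) (by linarith))
  have e0_0_1_2 : |c.I ((ξ ^ (2*k+8)) * c.beta2.b w (c.D w))| ≤ Er := (h.err c.beta2 w (c.D w) (q := 2*k+8) (s := k+3) (s' := k+4) hQ0 ht hrc b0 (by omega) (by omega) (by omega)).trans (g1 n02 n12 p02 p12 (by linarith) (by linarith))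
  have e1_0_1_0 : |c.I ((c.D (ξ ^ (2*k+8))) * c.beta0.b w (c.D w))| ≤ Er := (h.err c.beta0 w (c.D w) (q := 2*k+7) (s := k+1) (s' := k+2) hQ0 ht hrc1 b1 (by omega) (by omega) (by omega)).trans (g1 n00 n10 p00 p10 (by linarith) (by linarith))
  have e0_1_1_0 : |c.I ((ξ ^ (2*k+8)) * c.beta0.b (c.D w) (c.D w))| ≤ Er := (h.err c.beta0 (c.D w) (c.D w) (q := 2*k+8) (s := k+2) (s' := k+2) hQ0 ht hrc b0 (by omega) (by omega) (by omega)).trans (g1 n10 n10 p10 p10 (by linarith) (by linarith))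
  have e1_0_1_1 : |c.I ((c.D (ξ ^ (2*k+8))) * c.beta1.b w (c.D w))| ≤ Er := (h.err c.beta1 w (c.D w) (q := 2*k+7) (s := k+2) (s' := k+3) hQ0 ht hrc1 b1 (by omega) (by omega) (by omega)).trans (g1 n01 n11 p01 p11 (by linarith) (by linarith))
  have e0_1_1_1 : |c.I ((ξ ^ (2*k+8)) * c.beta1.b (c.D w) (c.D w))| ≤ Er := (h.err c.beta1 (c.D w) (c.D w) (q := 2*k+8) (s := k+3) (s' := k+3) hQ0 ht hrc b0 (by omega) (by omega) (by omega)).trans (g1 n11 n11 p11 p11 (by linarith) (by linarith))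
  have e1_0_1_2 : |c.I ((c.D (ξ ^ (2*k+8))) * c.beta2.b w (c.D w))| ≤ Er := (h.err c.beta2 w (c.D w) (q := 2*k+7) (s := k+3) (s' := k+4) hQ0 ht hrc1 b1 (by omega) (by omega) (by omega)).trans (g1 n02 n12 p02 p12 (by linarith) (by linarith))
  have e1_0_2_0 : |c.I ((c.D (ξ ^ (2*k+8))) * c.beta0.b w (c.D (c.D w)))| ≤ Er := (h.err c.beta0 w (c.D (c.D w)) (q := 2*k+7) (s := k+1) (s' := k+3) hQ0 ht hrc1 b1 (by omega) (by omega) (by omega)).trans (g1 n00 n20 p00 p20 (by linarith) (by linarith))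
  have e0_1_2_0 : |c.I ((ξ ^ (2*k+8)) * c.beta0.b (c.D w) (c.D (c.D w)))| ≤ Er := (h.err c.beta0 (c.D w) (c.D (c.D w)) (q := 2*k+8) (s := k+2) (s' := k+3) hQ0 ht hrc b0 (by omega) (by omega) (by omega)).trans (g1 n10 n20 p10 p20 (by linarith) (by linarith))
  have e1_0_2_1 : |c.I ((c.D (ξ ^ (2*k+8))) * c.beta1.b w (c.D (c.D w)))| ≤ Er := (h.err c.beta1 w (c.D (c.D w)) (q := 2*k+7) (s := k+2) (s' := k+4) hQ0 ht hrc1 b1 (by omega) (by omega) (by omega)).trans (g1 n01 n21 p01 p21 (by linarith) (by linarith))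
  have e0_1_2_1 : |c.I ((ξ ^ (2*k+8)) * c.beta1.b (c.D w) (c.D (c.D w)))| ≤ Er := (h.err c.beta1 (c.D w) (c.D (c.D w)) (q := 2*k+8) (s := k+3) (s' := k+4) hQ0 ht hrc b0 (by omega) (by omega) (by omega)).trans (g1 n11 n21 p11 p21 (by linarith) (by linarith))
  have e2_0_2_0 : |c.I ((c.D (c.D (ξ ^ (2*k+8)))) * c.beta0.b w (c.D (c.D w)))| ≤ Er := (h.err c.beta0 w (c.D (c.D w)) (q := 2*k+6) (s := k+1) (s' := k+3) hQ0 ht hrc2 b2 (by omega) (by omega) (by omega)).trans (g1 n00 n20 p00 p20 (by linarith) (by linarith))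
  have e1_1_2_0 : |c.I ((c.D (ξ ^ (2*k+8))) * c.beta0.b (c.D w) (c.D (c.D w)))| ≤ Er := (h.err c.beta0 (c.D w) (c.D (c.D w)) (q := 2*k+7) (s := k+2) (s' := k+3) hQ0 ht hrc1 b1 (by omega) (by omega) (by omega)).trans (g1 n10 n20 p10 p20 (by linarith) (by linarith))
  have e0_2_2_0 : |c.I ((ξ ^ (2*k+8)) * c.beta0.b (c.D (c.D w)) (c.D (c.D w)))| ≤ Er := (h.err c.beta0 (c.D (c.D w)) (c.D (c.D w)) (q := 2*k+8) (s := k+3) (s' := k+3) hQ0 ht hrc b0 (by omega) (by omega) (by omega)).trans (g1 n20 n20 p20 p20 (by linarith) (by linarith))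
  have e2_0_2_1 : |c.I ((c.D (c.D (ξ ^ (2*k+8)))) * c.beta1.b w (c.D (c.D w)))| ≤ Er := (h.err c.beta1 w (c.D (c.D w)) (q := 2*k+6) (s := k+2) (s' := k+4) hQ0 ht hrc2 b2 (by omega) (by omega) (by omega)).trans (g1 n01 n21 p01 p21 (by linarith) (by linarith))
  have e1_1_2_1 : |c.I ((c.D (ξ ^ (2*k+8))) * c.beta1.b (c.D w) (c.D (c.D w)))| ≤ Er := (h.err c.beta1 (c.D w) (c.D (c.D w)) (q := 2*k+7) (s := k+3) (s' := k+4) hQ0 ht hrc1 b1 (by omega) (by omega) (by omega)).trans (g1 n11 n21 p11 p21 (by linarith) (by linarith))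
  have e2_0_3_0 : |c.I ((c.D (c.D (ξ ^ (2*k+8)))) * c.beta0.b w (c.D (c.D (c.D w))))| ≤ Er := (h.err c.beta0 w (c.D (c.D (c.D w))) (q := 2*k+6) (s := k+1) (s' := k+4) hQ0 ht hrc2 b2 (by omega) (by omega) (by omega)).trans (g1 n00 n30 p00 p30 (by linarith) (by linarith))
  have e1_1_3_0 : |c.I ((c.D (ξ ^ (2*k+8))) * c.beta0.b (c.D w) (c.D (c.D (c.D w))))| ≤ Er := (h.err c.beta0 (c.D w) (c.D (c.D (c.D w))) (q := 2*k+7) (s := k+2) (s' := k+4) hQ0 ht hrc1 b1 (by omega) (by omega) (by omega)).trans (g1 n10 n30 p10 p30 (by linarith) (by linarith))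
  have e0_2_3_0 : |c.I ((ξ ^ (2*k+8)) * c.beta0.b (c.D (c.D w)) (c.D (c.D (c.D w))))| ≤ Er := (h.err c.beta0 (c.D (c.D w)) (c.D (c.D (c.D w))) (q := 2*k+8) (s := k+3) (s' := k+4) hQ0 ht hrc b0 (by omega) (by omega) (by omega)).trans (g1 n20 n30 p20 p30 (by linarith) (by linarith))
  have e3_0_3_0 : |c.I ((c.D (c.D (c.D (ξ ^ (2*k+8))))) * c.beta0.b w (c.D (c.D (c.D w))))| ≤ Er := (h.err c.beta0 w (c.D (c.D (c.D w))) (q := 2*k+5) (s := k+1) (s' := k+4) hQ0 ht hrc3 b3 (by omega) (by omega) (by omega)).trans (g1 n00 n30 p00 p30 (by linarith) (by linarith))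
  have e2_1_3_0 : |c.I ((c.D (c.D (ξ ^ (2*k+8)))) * c.beta0.b (c.D w) (c.D (c.D (c.D w))))| ≤ Er := (h.err c.beta0 (c.D w) (c.D (c.D (c.D w))) (q := 2*k+6) (s := k+2) (s' := k+4) hQ0 ht hrc2 b2 (by omega) (by omega) (by omega)).trans (g1 n10 n30 p10 p30 (by linarith) (by linarith))
  have e1_2_3_0 : |c.I ((c.D (ξ ^ (2*k+8))) * c.beta0.b (c.D (c.D w)) (c.D (c.D (c.D w))))| ≤ Er := (h.err c.beta0 (c.D (c.D w)) (c.D (c.D (c.D w))) (q := 2*k+7) (s := k+3) (s' := k+4) hQ0 ht hrc1 b1 (by omega) (by omega) (by omega)).trans (g1 n20 n30 p20 p30 (by linarith) (by linarith))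
  have mn0 : c.I ((ξ ^ (2*k+8)) * c.beta3.b w w) = n03 := by
    rw [hn03, Form.N, ← pow_mul]; congr 3; ring
  have mn1 : c.I ((ξ ^ (2*k+8)) * c.beta2.b (c.D w) (c.D w)) = n12 := by
    rw [hn12, Form.N, ← pow_mul]; congr 3; ring
  have mn2 : c.I ((ξ ^ (2*k+8)) * c.beta1.b (c.D (c.D w)) (c.D (c.D w))) = n21 := by
    rw [hn21, Form.N, ← pow_mul]; congr 3; ring
  have mn3 : c.I ((ξ ^ (2*k+8)) * c.beta0.b (c.D (c.D (c.D w))) (c.D (c.D (c.D w)))) = n30 := by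
    rw [hn30, Form.N, ← pow_mul]; congr 3; ring
  have T000 : |c.I (c.beta0.b (ξ ^ (2*k+8) * w) w)| ≤ 8 * Er := by
    rw [c.beta0.rad _ hr]
    have := abs_le.mp e0_0_0_0
    rw [abs_le]; constructor <;> linarith
  have T001 : |c.I (c.beta1.b (ξ ^ (2*k+8) * w) w)| ≤ 8 * Er := by
    rw [c.beta1.rad _ hr]
    have := abs_le.mp e0_0_0_1
    rw [abs_le]; constructor <;> linarith
  have T002 : |c.I (c.beta2.b (ξ ^ (2*k+8) * w) w)| ≤ 8 * Er := by
    rw [c.beta2.rad _ hr]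
    have := abs_le.mp e0_0_0_2
    rw [abs_le]; constructor <;> linarith
  have T003 : |c.I (c.beta3.b (ξ ^ (2*k+8) * w) w) - n03| ≤ 8 * Er := by
    rw [c.beta3.rad _ hr]
    rw [mn0]
    rw [abs_le]; constructor <;> linarith
  have T010 : |c.I (c.beta0.b (ξ ^ (2*k+8) * w) (c.D w))| ≤ 8 * Er := by
    rw [c.beta0.rad _ hr]
    have := abs_le.mp e0_0_1_0
    rw [abs_le]; constructor <;> linarith
  have T011 : |c.I (c.beta1.b (ξ ^ (2*k+8) * w) (c.D w))| ≤ 8 * Er := by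
    rw [c.beta1.rad _ hr]
    have := abs_le.mp e0_0_1_1
    rw [abs_le]; constructor <;> linarith
  have T012 : |c.I (c.beta2.b (ξ ^ (2*k+8) * w) (c.D w))| ≤ 8 * Er := by
    rw [c.beta2.rad _ hr]
    have := abs_le.mp e0_0_1_2
    rw [abs_le]; constructor <;> linarith
  have T110 : |c.I (c.beta0.b (c.D (ξ ^ (2*k+8) * w)) (c.D w))| ≤ 8 * Er := by
    rw [c.beta0.IT1 w hr]
    have := abs_le.mp e1_0_1_0
    have := abs_le.mp e0_1_1_0
    rw [abs_le]; constructor <;> linarith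
  have T111 : |c.I (c.beta1.b (c.D (ξ ^ (2*k+8) * w)) (c.D w))| ≤ 8 * Er := by
    rw [c.beta1.IT1 w hr]
    have := abs_le.mp e1_0_1_1
    have := abs_le.mp e0_1_1_1
    rw [abs_le]; constructor <;> linarith
  have T112 : |c.I (c.beta2.b (c.D (ξ ^ (2*k+8) * w)) (c.D w)) - n12| ≤ 8 * Er := by
    rw [c.beta2.IT1 w hr]
    rw [mn1]
    have := abs_le.mp e1_0_1_2
    rw [abs_le]; constructor <;> linarith
  have T120 : |c.I (c.beta0.b (c.D (ξ ^ (2*k+8) * w)) (c.D (c.D w)))| ≤ 8 * Er := by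
    rw [c.beta0.IT1 w hr]
    have := abs_le.mp e1_0_2_0
    have := abs_le.mp e0_1_2_0
    rw [abs_le]; constructor <;> linarith
  have T121 : |c.I (c.beta1.b (c.D (ξ ^ (2*k+8) * w)) (c.D (c.D w)))| ≤ 8 * Er := by
    rw [c.beta1.IT1 w hr]
    have := abs_le.mp e1_0_2_1
    have := abs_le.mp e0_1_2_1
    rw [abs_le]; constructor <;> linarith
  have T220 : |c.I (c.beta0.b (c.D (c.D (ξ ^ (2*k+8) * w))) (c.D (c.D w)))| ≤ 8 * Er := by
    rw [c.beta0.IT2 w hr]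
    have := abs_le.mp e2_0_2_0
    have := abs_le.mp e1_1_2_0
    have := abs_le.mp e0_2_2_0
    rw [abs_le]; constructor <;> linarith
  have T221 : |c.I (c.beta1.b (c.D (c.D (ξ ^ (2*k+8) * w))) (c.D (c.D w))) - n21| ≤ 8 * Er := by
    rw [c.beta1.IT2 w hr]
    rw [mn2]
    have := abs_le.mp e2_0_2_1
    have := abs_le.mp e1_1_2_1
    rw [abs_le]; constructor <;> linarith
  have T230 : |c.I (c.beta0.b (c.D (c.D (ξ ^ (2*k+8) * w))) (c.D (c.D (c.D w))))| ≤ 8 * Er := by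
    rw [c.beta0.IT2 w hr]
    have := abs_le.mp e2_0_3_0
    have := abs_le.mp e1_1_3_0
    have := abs_le.mp e0_2_3_0
    rw [abs_le]; constructor <;> linarith
  have T330 : |c.I (c.beta0.b (c.D (c.D (c.D (ξ ^ (2*k+8) * w)))) (c.D (c.D (c.D w)))) - n30| ≤ 8 * Er := by
    rw [c.beta0.IT3 w hr]
    rw [mn3]
    have := abs_le.mp e3_0_3_0
    have := abs_le.mp e2_1_3_0
    have := abs_le.mp e1_2_3_0
    rw [abs_le]; constructor <;> linarith
  have kk : ∀ a T E : ℝ, |T| ≤ E → |a * T| ≤ |a| * E := fun a T E h => by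
    rw [abs_mul]; gcongr
  rw [I_PP α m2 (c.CS.mul_mem_right _ hrc) w]
  have k000 := abs_le.mp (kk (α^6 - α^4*(8+3*m2) + α^2*(16+3*m2^2) - m2*(m2-4)^2) (c.I (c.beta0.b (ξ ^ (2*k+8) * w) w)) _ T000)
  have k001 := abs_le.mp (kk (-3*α^4 + 6*α^2*m2 - (m2-4)*(3*m2-4)) (c.I (c.beta1.b (ξ ^ (2*k+8) * w) w)) _ T001)
  have k002 := abs_le.mp (kk (3*α^2 - (3*m2-8)) (c.I (c.beta2.b (ξ ^ (2*k+8) * w) w)) _ T002)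
  have k003 := abs_le.mp T003
  have k010 := abs_le.mp (kk (6*α^5 - 4*α^3*(8+3*m2) + 2*α*(16+3*m2^2)) (c.I (c.beta0.b (ξ ^ (2*k+8) * w) (c.D w))) _ T010)
  have k011 := abs_le.mp (kk (-12*α^3 + 12*α*m2) (c.I (c.beta1.b (ξ ^ (2*k+8) * w) (c.D w))) _ T011)
  have k012 := abs_le.mp (kk (6*α) (c.I (c.beta2.b (ξ ^ (2*k+8) * w) (c.D w))) _ T012)
  have k110 := abs_le.mp (kk (15*α^4 - 6*α^2*(8+3*m2) + 16 + 3*m2^2) (c.I (c.beta0.b (c.D (ξ ^ (2*k+8) * w)) (c.D w))) _ T110)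
  have k111 := abs_le.mp (kk (-18*α^2 + 6*m2) (c.I (c.beta1.b (c.D (ξ ^ (2*k+8) * w)) (c.D w))) _ T111)
  have k112 := abs_le.mp T112
  have k120 := abs_le.mp (kk (20*α^3 - 4*α*(8+3*m2)) (c.I (c.beta0.b (c.D (ξ ^ (2*k+8) * w)) (c.D (c.D w)))) _ T120)
  have k121 := abs_le.mp (kk (-12*α) (c.I (c.beta1.b (c.D (ξ ^ (2*k+8) * w)) (c.D (c.D w)))) _ T121)
  have k220 := abs_le.mp (kk (15*α^2 - 8 - 3*m2) (c.I (c.beta0.b (c.D (c.D (ξ ^ (2*k+8) * w))) (c.D (c.D w)))) _ T220)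
  have k221 := abs_le.mp T221
  have k230 := abs_le.mp (kk (6*α) (c.I (c.beta0.b (c.D (c.D (ξ ^ (2*k+8) * w))) (c.D (c.D (c.D w))))) _ T230)
  have k330 := abs_le.mp T330
  have e : Q * (16 * (t⁻¹ * Lw) + 8 * (t * Tp)) = 8 * Er := by rw [hEr]; ring
  rw [e, hT]
  simp only [add_mul]
  rw [abs_le]; constructor <;> linarith

end Cyl

namespace Cyl

variable {A : Type} [CommRing A] [Algebra ℝ A] {P : Type} {c : Cyl A P}

lemma Form.NCS (b : c.Form) {Y : A} (hY : Y ∈ c.CS) (f : A) (a : ℝ) :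
    a • (Y ^ 2 * b.b f f) ∈ c.CS :=
  Submodule.smul_of_tower_mem _ _ (c.CS.mul_mem_right _ (sq_CS hY))

lemma Form.IU1 (b : c.Form) {η : A} (hη : η ∈ c.Rad) (hc : η ∈ c.CS) (w : A) {t : ℝ} (ht : 0 < t) :
    c.I (b.b (c.D (η * w)) (c.D (η * w))) ≤
      (1 + t) * b.N η (c.D w) + (1 + t⁻¹) * b.N (c.D η) w := by
  have hc1 := c.D_CS _ hc
  have := I_mono (c := c) (f := b.b (c.D (η * w)) (c.D (η * w)))
    (g := (1 + t) • (η ^ 2 * b.b (c.D w) (c.D w)) + (1 + t⁻¹) • ((c.D η) ^ 2 * b.b w w))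
    (b.cs _ (c.D_CS _ (c.CS.mul_mem_right _ hc)) _)
    (c.CS.add_mem (b.NCS hc _ _) (b.NCS hc1 _ _))
    (fun x => by
      have := b.U1 hη w x ht
      simpa only [map_add, map_smul, map_mul, map_pow, smul_eq_mul] using this)
  simpa only [Form.N, map_add, map_smul, smul_eq_mul] using this

lemma Form.IU2 (b : c.Form) {η : A} (hη : η ∈ c.Rad) (hc : η ∈ c.CS) (w : A) {t : ℝ} (ht : 0 < t) :
    c.I (b.b (c.D (c.D (η * w))) (c.D (c.D (η * w)))) ≤
      (1 + t) * b.N η (c.D (c.D w)) + (1 + t⁻¹) * (8 * b.N (c.D η) (c.D w)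
        + 2 * b.N (c.D (c.D η)) w) := by
  have hc1 := c.D_CS _ hc
  have hc2 := c.D_CS _ hc1
  have := I_mono (c := c) (f := b.b (c.D (c.D (η * w))) (c.D (c.D (η * w))))
    (g := (1 + t) • (η ^ 2 * b.b (c.D (c.D w)) (c.D (c.D w)))
      + (1 + t⁻¹) • ((8:ℝ) • ((c.D η) ^ 2 * b.b (c.D w) (c.D w))
        + (2:ℝ) • ((c.D (c.D η)) ^ 2 * b.b w w)))
    (b.cs _ (c.D_CS _ (c.D_CS _ (c.CS.mul_mem_right _ hc))) _)
    (c.CS.add_mem (b.NCS hc _ _) (Submodule.smul_of_tower_mem _ _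
      (c.CS.add_mem (b.NCS hc1 _ _) (b.NCS hc2 _ _))))
    (fun x => by
      have := b.U2 hη w x ht
      simpa only [map_add, map_smul, map_mul, map_pow, smul_eq_mul] using this)
  simpa only [Form.N, map_add, map_smul, smul_eq_mul] using this

lemma Form.IU3 (b : c.Form) {η : A} (hη : η ∈ c.Rad) (hc : η ∈ c.CS) (w : A) {t : ℝ} (ht : 0 < t) :
    c.I (b.b (c.D (c.D (c.D (η * w)))) (c.D (c.D (c.D (η * w))))) ≤
      (1 + t) * b.N η (c.D (c.D (c.D w))) + (1 + t⁻¹) * (36 * b.N (c.D η) (c.D (c.D w))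
        + 36 * b.N (c.D (c.D η)) (c.D w) + 2 * b.N (c.D (c.D (c.D η))) w) := by
  have hc1 := c.D_CS _ hc
  have hc2 := c.D_CS _ hc1
  have hc3 := c.D_CS _ hc2
  have := I_mono (c := c) (f := b.b (c.D (c.D (c.D (η * w)))) (c.D (c.D (c.D (η * w)))))
    (g := (1 + t) • (η ^ 2 * b.b (c.D (c.D (c.D w))) (c.D (c.D (c.D w))))
      + (1 + t⁻¹) • ((36:ℝ) • ((c.D η) ^ 2 * b.b (c.D (c.D w)) (c.D (c.D w)))
        + (36:ℝ) • ((c.D (c.D η)) ^ 2 * b.b (c.D w) (c.D w))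
        + (2:ℝ) • ((c.D (c.D (c.D η))) ^ 2 * b.b w w)))
    (b.cs _ (c.D_CS _ (c.D_CS _ (c.D_CS _ (c.CS.mul_mem_right _ hc)))) _)
    (c.CS.add_mem (b.NCS hc _ _) (Submodule.smul_of_tower_mem _ _
      (c.CS.add_mem (c.CS.add_mem (b.NCS hc1 _ _) (b.NCS hc2 _ _)) (b.NCS hc3 _ _))))
    (fun x => by
      have := b.U3 hη w x ht
      simpa only [map_add, map_smul, map_mul, map_pow, smul_eq_mul] using this)
  simpa only [Form.N, map_add, map_smul, smul_eq_mul] using this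

lemma Cut.Npow {ξ : A} {C0 : ℝ} (h : c.Cut ξ C0) (b : c.Form) {e : A} (f : A) {q s : ℕ}
    {Q : ℝ} (he : e ∈ c.CS)
    (hb : ∀ x, |c.ev x e| ≤ Q * (c.ev x ξ) ^ q) (hq : s ≤ q) (hs : 1 ≤ s) :
    b.N e f ≤ Q ^ 2 * b.N (ξ ^ s) f := by
  refine b.N_mono he (pow_CS h.cs hs) f fun x => ?_
  rw [map_pow, ← mul_pow, ← sq_abs (c.ev x e)]
  have hx0 := h.nn x
  have h1 := hb x
  have hq0 : (c.ev x ξ) ^ q ≤ (c.ev x ξ) ^ s := pow_le_pow_of_le_one hx0 (h.le1 x) hq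
  rcases le_or_gt 0 Q with hQ | hQ
  · have : |c.ev x e| ≤ Q * (c.ev x ξ) ^ s := h1.trans (by gcongr)
    gcongr
  · have : |c.ev x e| ≤ 0 := h1.trans (mul_nonpos_of_nonpos_of_nonneg hQ.le (by positivity))
    have h0 : |c.ev x e| = 0 := le_antisymm this (abs_nonneg _)
    rw [h0, zero_pow two_ne_zero]; positivity

set_option maxHeartbeats 1000000 in
lemma Cut.SSbound {ξ : A} {C0 : ℝ} (h : c.Cut ξ C0) (hC : 0 ≤ C0) (k : ℕ) (w : A) (m2 : ℝ)
    {t : ℝ} (ht : 0 < t) (ht1 : t ≤ 1) :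
    c.SS m2 (ξ ^ (k+4) * w) ≤ (1 + t) * c.Top ξ k w +
      (|m2*(m2-4)^2| + |(m2-4)*(3*m2-4)| + |3*m2-8| + |16+3*m2^2| + |6*m2| + |8+3*m2| + 7) *
      (80 * powC C0 (2*k+5) ^ 2 * ((1 + t⁻¹) * c.Low ξ k w)) := by
  set Q := powC C0 (2*k+5) with hQdef
  have hQ1 : 1 ≤ Q := powC_one hC _
  have hQm : powC C0 (k+1) ≤ Q := powC_mono hC (by omega)
  have hr : ξ ^ (k+4) ∈ c.Rad := c.Rad.pow_mem h.rad _
  have hrc : ξ ^ (k+4) ∈ c.CS := pow_CS h.cs (by omega)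
  have hrc1 := c.D_CS _ hrc
  have hrc2 := c.D_CS _ hrc1
  have hrc3 := c.D_CS _ hrc2
  have hpw : ∀ x s, 0 ≤ (c.ev x ξ) ^ s := fun x s => pow_nonneg (h.nn x) s
  have b0 : ∀ x, |c.ev x (ξ ^ (k+4))| ≤ Q * (c.ev x ξ) ^ (k+4) := fun x => by
    rw [map_pow, abs_of_nonneg (pow_nonneg (h.nn x) _)]
    exact le_mul_of_one_le_left (pow_nonneg (h.nn x) _) hQ1
  have b1 : ∀ x, |c.ev x (c.D (ξ ^ (k+4)))| ≤ Q * (c.ev x ξ) ^ (k+3) :=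
    fun x => (h.pow_bounds hC (k+1) x).1.trans (mul_le_mul_of_nonneg_right hQm (hpw _ _))
  have b2 : ∀ x, |c.ev x (c.D (c.D (ξ ^ (k+4))))| ≤ Q * (c.ev x ξ) ^ (k+2) :=
    fun x => (h.pow_bounds hC (k+1) x).2.1.trans (mul_le_mul_of_nonneg_right hQm (hpw _ _))
  have b3 : ∀ x, |c.ev x (c.D (c.D (c.D (ξ ^ (k+4)))))| ≤ Q * (c.ev x ξ) ^ (k+1) :=
    fun x => (h.pow_bounds hC (k+1) x).2.2.trans (mul_le_mul_of_nonneg_right hQm (hpw _ _))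
  have hti : 0 < t⁻¹ := inv_pos.mpr ht
  have p00 := h.N_nn c.beta0 k w
  have p10 := h.N_nn c.beta0 (k+1) (c.D w)
  have p20 := h.N_nn c.beta0 (k+2) (c.D (c.D w))
  have p01 := h.N_nn c.beta1 (k+1) w
  have p11 := h.N_nn c.beta1 (k+2) (c.D w)
  have p02 := h.N_nn c.beta2 (k+2) w
  have hL0 : 0 ≤ c.Low ξ k w := by
    unfold Low; linarith
  set S := Q ^ 2 * c.Low ξ k w with hS
  have hQQ : 1 ≤ Q ^ 2 := by nlinarith
  have hS0 : 0 ≤ S := by positivity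
  have kq : ∀ a : ℝ, 0 ≤ a → a ≤ c.Low ξ k w → Q ^ 2 * a ≤ S := fun a _ h => by
    rw [hS]; gcongr
  -- elementary pieces
  have a00 : c.beta0.N (ξ ^ (k+4)) w ≤ S :=
    (h.Npow c.beta0 w (s := k+1) hrc b0 (by omega) (by omega)).trans
      (kq _ p00 (by unfold Low; linarith))
  have a01 : c.beta1.N (ξ ^ (k+4)) w ≤ S :=
    (h.Npow c.beta1 w (s := k+2) hrc b0 (by omega) (by omega)).trans
      (kq _ p01 (by unfold Low; linarith))
  have a02 : c.beta2.N (ξ ^ (k+4)) w ≤ S :=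
    (h.Npow c.beta2 w (s := k+3) hrc b0 (by omega) (by omega)).trans
      (kq _ p02 (by unfold Low; linarith))
  have a10 : c.beta0.N (ξ ^ (k+4)) (c.D w) ≤ S :=
    (h.Npow c.beta0 _ (s := k+2) hrc b0 (by omega) (by omega)).trans
      (kq _ p10 (by unfold Low; linarith))
  have a11 : c.beta1.N (ξ ^ (k+4)) (c.D w) ≤ S :=
    (h.Npow c.beta1 _ (s := k+3) hrc b0 (by omega) (by omega)).trans
      (kq _ p11 (by unfold Low; linarith))
  have a20 : c.beta0.N (ξ ^ (k+4)) (c.D (c.D w)) ≤ S :=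
    (h.Npow c.beta0 _ (s := k+3) hrc b0 (by omega) (by omega)).trans
      (kq _ p20 (by unfold Low; linarith))
  have d00 : c.beta0.N (c.D (ξ ^ (k+4))) w ≤ S :=
    (h.Npow c.beta0 w (s := k+1) hrc1 b1 (by omega) (by omega)).trans
      (kq _ p00 (by unfold Low; linarith))
  have d01 : c.beta1.N (c.D (ξ ^ (k+4))) w ≤ S :=
    (h.Npow c.beta1 w (s := k+2) hrc1 b1 (by omega) (by omega)).trans
      (kq _ p01 (by unfold Low; linarith))
  have d02 : c.beta2.N (c.D (ξ ^ (k+4))) w ≤ S :=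
    (h.Npow c.beta2 w (s := k+3) hrc1 b1 (by omega) (by omega)).trans
      (kq _ p02 (by unfold Low; linarith))
  have d10 : c.beta0.N (c.D (ξ ^ (k+4))) (c.D w) ≤ S :=
    (h.Npow c.beta0 _ (s := k+2) hrc1 b1 (by omega) (by omega)).trans
      (kq _ p10 (by unfold Low; linarith))
  have d11 : c.beta1.N (c.D (ξ ^ (k+4))) (c.D w) ≤ S :=
    (h.Npow c.beta1 _ (s := k+3) hrc1 b1 (by omega) (by omega)).trans
      (kq _ p11 (by unfold Low; linarith))
  have d20 : c.beta0.N (c.D (ξ ^ (k+4))) (c.D (c.D w)) ≤ S :=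
    (h.Npow c.beta0 _ (s := k+3) hrc1 b1 (by omega) (by omega)).trans
      (kq _ p20 (by unfold Low; linarith))
  have f00 : c.beta0.N (c.D (c.D (ξ ^ (k+4)))) w ≤ S :=
    (h.Npow c.beta0 w (s := k+1) hrc2 b2 (by omega) (by omega)).trans
      (kq _ p00 (by unfold Low; linarith))
  have f01 : c.beta1.N (c.D (c.D (ξ ^ (k+4)))) w ≤ S :=
    (h.Npow c.beta1 w (s := k+2) hrc2 b2 (by omega) (by omega)).trans
      (kq _ p01 (by unfold Low; linarith))
  have f10 : c.beta0.N (c.D (c.D (ξ ^ (k+4)))) (c.D w) ≤ S :=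
    (h.Npow c.beta0 _ (s := k+2) hrc2 b2 (by omega) (by omega)).trans
      (kq _ p10 (by unfold Low; linarith))
  have g00 : c.beta0.N (c.D (c.D (c.D (ξ ^ (k+4))))) w ≤ S :=
    (h.Npow c.beta0 w (s := k+1) hrc3 b3 (by omega) (by omega)).trans
      (kq _ p00 (by unfold Low; linarith))
  -- the integrals in SS
  set W := (1 + t⁻¹) * S with hW
  have hWS : S ≤ W := by rw [hW]; nlinarith
  have hW0 : 0 ≤ W := hS0.trans hWS
  have i0 : ∀ b : c.Form, c.I (b.b (ξ ^ (k+4) * w) (ξ ^ (k+4) * w)) = b.N (ξ ^ (k+4)) w := by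
    intro b; rw [b.rad _ hr, b.rad' _ hr, ← mul_assoc, ← pow_two, Form.N]
  have up : ∀ a : ℝ, a ≤ S → (1 + t⁻¹) * a ≤ W := fun a ha => by rw [hW]; gcongr
  have up2 : ∀ a : ℝ, a ≤ S → (1 + t) * a ≤ 2 * W := fun a ha => by
    have : (1 + t) * a ≤ (1 + t) * S := by gcongr
    nlinarith
  have j10 : c.I (c.beta0.b (c.D (ξ ^ (k+4) * w)) (c.D (ξ ^ (k+4) * w))) ≤ 80 * W := by
    have := c.beta0.IU1 hr hrc w ht
    linarith [up2 _ a10, up _ d00]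
  have j11 : c.I (c.beta1.b (c.D (ξ ^ (k+4) * w)) (c.D (ξ ^ (k+4) * w))) ≤ 80 * W := by
    have := c.beta1.IU1 hr hrc w ht
    linarith [up2 _ a11, up _ d01]
  have j12 : c.I (c.beta2.b (c.D (ξ ^ (k+4) * w)) (c.D (ξ ^ (k+4) * w))) ≤
      (1 + t) * c.beta2.N (ξ ^ (k+4)) (c.D w) + 80 * W := by
    have := c.beta2.IU1 hr hrc w ht
    linarith [up _ d02]
  have j20 : c.I (c.beta0.b (c.D (c.D (ξ ^ (k+4) * w))) (c.D (c.D (ξ ^ (k+4) * w)))) ≤ 80 * W := by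
    have := c.beta0.IU2 hr hrc w ht
    linarith [up2 _ a20, up _ d10, up _ f00]
  have j21 : c.I (c.beta1.b (c.D (c.D (ξ ^ (k+4) * w))) (c.D (c.D (ξ ^ (k+4) * w)))) ≤
      (1 + t) * c.beta1.N (ξ ^ (k+4)) (c.D (c.D w)) + 80 * W := by
    have := c.beta1.IU2 hr hrc w ht
    linarith [up _ d11, up _ f01]
  have j30 : c.I (c.beta0.b (c.D (c.D (c.D (ξ ^ (k+4) * w))))
      (c.D (c.D (c.D (ξ ^ (k+4) * w))))) ≤
      (1 + t) * c.beta0.N (ξ ^ (k+4)) (c.D (c.D (c.D w))) + 80 * W := by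
    have := c.beta0.IU3 hr hrc w ht
    linarith [up _ d20, up _ f10, up _ g00]
  have j03 : c.beta3.N (ξ ^ (k+4)) w ≤ (1 + t) * c.beta3.N (ξ ^ (k+4)) w := by
    have := h.N_nn c.beta3 (k+3) w
    nlinarith
  have kk : ∀ a T E : ℝ, 0 ≤ T → T ≤ E → a * T ≤ |a| * E := fun a T E h0 h => by
    have := le_abs_self a
    calc a * T ≤ |a| * T := by gcongr
      _ ≤ |a| * E := by gcongr
  have nn : ∀ (b : c.Form) (f : A), f ∈ c.CS → 0 ≤ c.I (b.b f f) := fun b f hf =>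
    c.I_nonneg _ (b.cs f hf f) fun x => b.nonneg x f
  have cs0 := c.CS.mul_mem_right w hrc
  have cs1 := c.D_CS _ cs0
  have cs2 := c.D_CS _ cs1
  have z1 := kk (m2*(m2-4)^2) _ (80 * W) (c.beta0.N_nonneg hrc w) (by linarith)
  have z2 := kk ((m2-4)*(3*m2-4)) _ (80 * W) (c.beta1.N_nonneg hrc w) (by linarith)
  have z3 := kk (3*m2-8) _ (80 * W) (c.beta2.N_nonneg hrc w) (by linarith)
  have z4 := kk (16+3*m2^2) _ (80 * W) (nn c.beta0 _ cs1) j10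
  have z5 := kk (6*m2) _ (80 * W) (nn c.beta1 _ cs1) j11
  have z6 := kk (8+3*m2) _ (80 * W) (nn c.beta0 _ cs2) j20
  have eW : 80 * Q ^ 2 * ((1 + t⁻¹) * c.Low ξ k w) = 80 * W := by rw [hW, hS]; ring
  rw [eW, SS, i0, i0, i0, i0, Top]
  simp only [add_mul] at *
  linarith

end Cyl

namespace Cyl

variable {A : Type} [CommRing A] [Algebra ℝ A] {P : Type} {c : Cyl A P}

variable (c) in
lemma low_le (C0 : ℝ) (hC : 0 ≤ C0) (k : ℕ) {δ : ℝ} (hδ : 0 < δ) (hδ1 : δ ≤ 1) :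
    ∃ C : ℝ, 0 ≤ C ∧ ∀ ξ w : A, c.Cut ξ C0 →
      c.Low ξ k w ≤ δ * c.Top ξ k w + C * c.beta0.N (ξ ^ (k+1)) w := by
  set Q := powC C0 (2*k+5) with hQdef
  have hQ1 : 1 ≤ Q := powC_one hC _
  have hQa : powC C0 (2*k+1) ≤ Q := powC_mono hC (by omega)
  have hQb : powC C0 (2*(k+1)+1) ≤ Q := powC_mono hC (by omega)
  set G := 8 * Q ^ 2 with hG
  have hG1 : 1 ≤ G := by rw [hG]; nlinarith
  have hG0 : 0 < G := by linarith
  set e := δ ^ 2 / (128 * G) with he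
  have he0 : 0 < e := by positivity
  have he1 : e ≤ δ / 8 := by
    rw [he, div_le_div_iff₀ (by positivity) (by norm_num)]; nlinarith
  set K := 100 * G ^ 3 / e ^ 2 with hK
  have hK0 : 0 ≤ K := by positivity
  refine ⟨1 + 2 * K + G / (δ/8) * K, by positivity, fun ξ w h => ?_⟩
  have p00 := h.N_nn c.beta0 k w
  have p10 := h.N_nn c.beta0 (k+1) (c.D w)
  have p20 := h.N_nn c.beta0 (k+2) (c.D (c.D w))
  have p30 := h.N_nn c.beta0 (k+3) (c.D (c.D (c.D w)))
  have p01 := h.N_nn c.beta1 (k+1) w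
  have p11 := h.N_nn c.beta1 (k+2) (c.D w)
  have p21 := h.N_nn c.beta1 (k+3) (c.D (c.D w))
  have p12 := h.N_nn c.beta2 (k+3) (c.D w)
  have p02 := h.N_nn c.beta2 (k+2) w
  have p03 := h.N_nn c.beta3 (k+3) w
  have c1 := chain G hG1 he0 (by linarith) p10 p20 p30 p00
    (fun e h0 h1 => h.interpD hC c.beta0 w k hQ1 hQa h0 h1)
    (fun e h0 h1 => h.interpD hC c.beta0 (c.D w) (k+1) hQ1 hQb h0 h1)
  have c2 := chain G hG1 he0 (by linarith) p01 p02 p03 p00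
    (fun e h0 h1 => h.interpL1 w k hQ1 h0 h1)
    (fun e h0 h1 => h.interpL2 w (k+1) hQ1 h0 h1)
  have c3 := h.interpD hC c.beta1 w (k+1) (δ := δ/8) hQ1 hQb (by positivity) (by linarith)
  simp only [add_assoc, Nat.reduceAdd] at c1 c2 c3
  simp only [add_assoc, Nat.reduceAdd] at p00 p10 p20 p30 p01 p11 p21 p12 p02 p03
  rw [← hK] at c1 c2
  rw [← hG] at c3
  unfold Low Top
  set n00 := c.beta0.N (ξ ^ (k+1)) w
  set n10 := c.beta0.N (ξ ^ (k+2)) (c.D w)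
  set n20 := c.beta0.N (ξ ^ (k+3)) (c.D (c.D w))
  set n30 := c.beta0.N (ξ ^ (k+4)) (c.D (c.D (c.D w)))
  set n01 := c.beta1.N (ξ ^ (k+2)) w
  set n11 := c.beta1.N (ξ ^ (k+3)) (c.D w)
  set n21 := c.beta1.N (ξ ^ (k+4)) (c.D (c.D w))
  set n02 := c.beta2.N (ξ ^ (k+3)) w
  set n12 := c.beta2.N (ξ ^ (k+4)) (c.D w)
  set n03 := c.beta3.N (ξ ^ (k+4)) w
  have d3 : G / (δ/8) * n01 ≤ G / (δ/8) * (e * n03 + K * n00) := by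
    gcongr; linarith
  have e3 : G / (δ/8) * (e * n03 + K * n00) = δ / 16 * n03 + G/(δ/8) * K * n00 := by
    rw [he]; field_simp; ring
  have e4 : e * n30 ≤ δ / 8 * n30 := by gcongr
  have e5 : e * n03 ≤ δ / 8 * n03 := by gcongr
  -- need a little room: scale e3 term
  have hh : G / (δ/8) * n01 ≤ δ / 16 * n03 + G/(δ/8) * K * n00 := by rw [← e3]; exact d3
  have : 0 ≤ δ * n30 := by positivity
  have : 0 ≤ δ * n03 := by positivity
  have : 0 ≤ δ * n21 := by positivity
  have : 0 ≤ δ * n12 := by positivity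
  have e6 : (1 + 2 * K + G / (δ/8) * K) * n00 = n00 + 2 * (K * n00) + G/(δ/8) * K * n00 := by ring
  rw [e6]
  nlinarith

variable (c) in
/-- basic energy estimate from stability -/
lemma energy1 (C0 : ℝ) (hC : 0 ≤ C0) (k : ℕ) (α m2 : ℝ) {p : ℝ} (hp : 1 < p) :
    ∃ C : ℝ, 0 < C ∧ ∀ ξ w : A, c.Cut ξ C0 →
      p * (-c.I (ξ ^ (2*k+8) * w * c.PP α m2 w)) ≤ c.SS m2 (ξ ^ (k+4) * w) →
      c.Top ξ k w + c.Low ξ k w + (-c.I (ξ ^ (2*k+8) * w * c.PP α m2 w)) ≤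
        C * c.beta0.N (ξ ^ (k+1)) w := by
  obtain ⟨M1, hM1, hF⟩ : ∃ M : ℝ, 0 ≤ M ∧ ∀ ξ w : A, c.Cut ξ C0 → ∀ t : ℝ, 0 < t → t ≤ 1 →
      |-c.I (ξ ^ (2*k+8) * w * c.PP α m2 w) - c.Top ξ k w| ≤
        M * (16 * (t⁻¹ * c.Low ξ k w) + 8 * (t * c.Top ξ k w)) := by
    obtain ⟨M, hM, hF⟩ : ∃ M : ℝ, 0 ≤ M ∧ ∀ ξ w : A, c.Cut ξ C0 → ∀ t : ℝ, 0 < t → t ≤ 1 →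
      |-c.I (ξ ^ (2*k+8) * w * c.PP α m2 w) - c.Top ξ k w| ≤
        M * (powC C0 (2*k+5) * (16 * (t⁻¹ * c.Low ξ k w) + 8 * (t * c.Top ξ k w))) := by
      refine ⟨_, ?_, fun ξ w h t ht ht1 => h.Fbound hC k w α m2 ht ht1⟩
      positivity
    refine ⟨M * powC C0 (2*k+5), ?_, fun ξ w h t ht ht1 => ?_⟩
    · have := powC_one hC (2*k+5)
      positivity
    · rw [mul_assoc M]
      exact hF ξ w h t ht ht1
  obtain ⟨M2, hM2, hS⟩ : ∃ M : ℝ, 0 ≤ M ∧ ∀ ξ w : A, c.Cut ξ C0 → ∀ t : ℝ, 0 < t → t ≤ 1 →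
      c.SS m2 (ξ ^ (k+4) * w) ≤ (1 + t) * c.Top ξ k w + M * ((1 + t⁻¹) * c.Low ξ k w) := by
    obtain ⟨M, hM, hF⟩ : ∃ M : ℝ, 0 ≤ M ∧ ∀ ξ w : A, c.Cut ξ C0 → ∀ t : ℝ, 0 < t → t ≤ 1 →
      c.SS m2 (ξ ^ (k+4) * w) ≤ (1 + t) * c.Top ξ k w +
        M * (80 * powC C0 (2*k+5) ^ 2 * ((1 + t⁻¹) * c.Low ξ k w)) := by
      refine ⟨_, ?_, fun ξ w h t ht ht1 => h.SSbound hC k w m2 ht ht1⟩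
      positivity
    refine ⟨M * (80 * powC C0 (2*k+5) ^ 2), ?_, fun ξ w h t ht ht1 => ?_⟩
    · positivity
    · rw [mul_assoc M]
      exact hF ξ w h t ht ht1
  have hp0 : 0 < p - 1 := by linarith
  have hpp : 0 < p := by linarith
  set t := (p-1)/(2*(1+8*p*M1) + (p-1)) with htdef
  have hden : 0 < 2*(1+8*p*M1) + (p-1) := by positivity
  have ht : 0 < t := by positivity
  have ht1 : t ≤ 1 := by rw [htdef, div_le_one hden]; nlinarith [mul_nonneg hpp.le hM1]
  have htt : t * (1 + 8*p*M1) ≤ (p-1)/2 := by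
    rw [htdef, div_mul_eq_mul_div, div_le_div_iff₀ hden (by norm_num)]
    nlinarith [mul_nonneg hpp.le hM1]
  set C3 := p * M1 * 16 * t⁻¹ + M2 * (1 + t⁻¹) with hC3
  have hti : 0 < t⁻¹ := inv_pos.mpr ht
  have hC30 : 0 ≤ C3 := by positivity
  set δ := (p-1)/(4*C3+(p-1)) with hδdef
  have hden2 : 0 < 4*C3+(p-1) := by positivity
  have hδ : 0 < δ := by positivity
  have hδ1 : δ ≤ 1 := by rw [hδdef, div_le_one hden2]; linarith
  have hδ2 : C3 * δ ≤ (p-1)/4 := by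
    rw [hδdef, mul_div_assoc', div_le_div_iff₀ hden2 (by norm_num)]
    nlinarith
  obtain ⟨C4, hC4, hL⟩ := low_le c C0 hC k hδ hδ1
  have key : ∀ ξ w : A, c.Cut ξ C0 →
      p * (-c.I (ξ ^ (2*k+8) * w * c.PP α m2 w)) ≤ c.SS m2 (ξ ^ (k+4) * w) →
      c.Top ξ k w ≤ 4 * C3 * C4 / (p-1) * c.beta0.N (ξ ^ (k+1)) w := by
    intro ξ w h hst
    have f1 := (abs_le.mp (hF ξ w h t ht ht1)).1
    have s1 := hS ξ w h t ht ht1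
    have l1 := hL ξ w h
    have n0 := h.N_nn c.beta0 k w
    have hT : 0 ≤ c.Top ξ k w := by
      have p30 := h.N_nn c.beta0 (k+3) (c.D (c.D (c.D w)))
      have p21 := h.N_nn c.beta1 (k+3) (c.D (c.D w))
      have p12 := h.N_nn c.beta2 (k+3) (c.D w)
      have p03 := h.N_nn c.beta3 (k+3) w
      simp only [add_assoc, Nat.reduceAdd] at p30 p21 p12 p03
      unfold Top; linarith
    set F := -c.I (ξ ^ (2*k+8) * w * c.PP α m2 w)
    set T := c.Top ξ k w
    set L := c.Low ξ k w
    set N := c.beta0.N (ξ ^ (k+1)) w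
    have a1 : (p - 1) * T ≤ t * (1 + 8*p*M1) * T + C3 * L := by
      rw [hC3]
      have := mul_le_mul_of_nonneg_left f1 hpp.le
      nlinarith
    have a2 : t * (1 + 8*p*M1) * T ≤ (p-1)/2 * T := by gcongr
    have a3 : C3 * L ≤ C3 * δ * T + C3 * C4 * N := by
      have := mul_le_mul_of_nonneg_left l1 hC30
      nlinarith
    have a4 : C3 * δ * T ≤ (p-1)/4 * T := by gcongr
    rw [div_mul_eq_mul_div, le_div_iff₀ hp0]
    linarith
  refine ⟨(2 + 8 * M1 * t) * (4 * C3 * C4 / (p-1)) + (1 + M1 * 16 * t⁻¹) *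
    (4 * C3 * C4 / (p-1) + C4) + 1, by positivity, fun ξ w h hst => ?_⟩
  have T1 := key ξ w h hst
  have f1 := (abs_le.mp (hF ξ w h t ht ht1)).2
  have l1 := hL ξ w h
  have n0 := h.N_nn c.beta0 k w
  have hT : 0 ≤ c.Top ξ k w := by
    have p30 := h.N_nn c.beta0 (k+3) (c.D (c.D (c.D w)))
    have p21 := h.N_nn c.beta1 (k+3) (c.D (c.D w))
    have p12 := h.N_nn c.beta2 (k+3) (c.D w)
    have p03 := h.N_nn c.beta3 (k+3) w
    simp only [add_assoc, Nat.reduceAdd] at p30 p21 p12 p03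
    unfold Top; linarith
  set F := -c.I (ξ ^ (2*k+8) * w * c.PP α m2 w)
  set T := c.Top ξ k w
  set L := c.Low ξ k w
  set N := c.beta0.N (ξ ^ (k+1)) w
  set X := 4 * C3 * C4 / (p-1)
  have l2 : L ≤ (X + C4) * N := by
    have : δ * T ≤ 1 * T := by gcongr
    linarith
  have a1 : (2 + 8 * M1 * t) * T ≤ (2 + 8 * M1 * t) * (X * N) := by gcongr
  have a2 : (1 + M1 * 16 * t⁻¹) * L ≤ (1 + M1 * 16 * t⁻¹) * ((X + C4) * N) := by gcongr
  linarith
end Cyl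

namespace Cyl

variable {A : Type} [CommRing A] [Algebra ℝ A] {P : Type} {c : Cyl A P}

/-- `η` is a cutoff whose derivatives are controlled by `κ` -/
structure Win (c : Cyl A P) (η κ : A) (K : ℝ) : Prop where
  rad : η ∈ c.Rad
  cs : η ∈ c.CS
  kcs : κ ∈ c.CS
  knn : ∀ x, 0 ≤ c.ev x κ
  K0 : 0 ≤ K
  prod : ∀ i l : ℕ, i ≤ 3 → l ≤ 3 → 1 ≤ i + l → ∀ x,
    |c.ev x ((⇑c.D)^[i] η * (⇑c.D)^[l] η)| ≤ K * c.ev x κ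
  sq : ∀ i : ℕ, 1 ≤ i → i ≤ 6 → ∀ x, |c.ev x ((⇑c.D)^[i] (η ^ 2))| ≤ K * c.ev x κ

structure WD (c : Cyl A P) (K : ℝ) where
  η : A
  κ : A
  w : A
  f : A
  win : c.Win η κ K
  nn : ∀ x, 0 ≤ c.ev x (w * f)

variable {K : ℝ}

def WD.q (d : c.WD K) (b : c.Form) (g : A) : ℝ := c.I (d.κ * b.b g g)

lemma WD.q_nonneg (d : c.WD K) (b : c.Form) (g : A) : 0 ≤ d.q b g :=
  c.I_nonneg _ (c.CS.mul_mem_right _ d.win.kcs) fun x => by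
    rw [map_mul]; exact mul_nonneg (d.win.knn x) (b.nonneg x g)

/-- the full energy with an arbitrary weight -/
def En (c : Cyl A P) (κ w f : A) : ℝ :=
  c.I (κ * c.beta0.b w w) + c.I (κ * c.beta0.b (c.D w) (c.D w))
  + c.I (κ * c.beta0.b (c.D (c.D w)) (c.D (c.D w)))
  + c.I (κ * c.beta0.b (c.D (c.D (c.D w))) (c.D (c.D (c.D w))))
  + c.I (κ * c.beta1.b w w) + c.I (κ * c.beta1.b (c.D w) (c.D w))
  + c.I (κ * c.beta1.b (c.D (c.D w)) (c.D (c.D w)))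
  + c.I (κ * c.beta2.b w w) + c.I (κ * c.beta2.b (c.D w) (c.D w))
  + c.I (κ * c.beta3.b w w) + c.I (κ * (w * f))

def WD.E (d : c.WD K) : ℝ := c.En d.κ d.w d.f

lemma WD.wf_nonneg (d : c.WD K) : 0 ≤ c.I (d.κ * (d.w * d.f)) :=
  c.I_nonneg _ (c.CS.mul_mem_right _ d.win.kcs) fun x => by
    rw [map_mul]; exact mul_nonneg (d.win.knn x) (d.nn x)

def Adm (c : Cyl A P) (b : c.Form) (a : ℕ) : Prop :=
  ∀ K : ℝ, ∀ d : c.WD K, d.q b ((⇑c.D)^[a] d.w) ≤ d.E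

lemma adm_all : (c.Adm c.beta0 0 ∧ c.Adm c.beta0 1 ∧ c.Adm c.beta0 2 ∧ c.Adm c.beta0 3) ∧
    (c.Adm c.beta1 0 ∧ c.Adm c.beta1 1 ∧ c.Adm c.beta1 2) ∧
    (c.Adm c.beta2 0 ∧ c.Adm c.beta2 1) ∧ c.Adm c.beta3 0 := by
  have key : ∀ K : ℝ, ∀ d : c.WD K, _ := fun K d => And.intro (d.q_nonneg c.beta0 d.w) (And.intro
    (d.q_nonneg c.beta0 (c.D d.w)) (And.intro (d.q_nonneg c.beta0 (c.D (c.D d.w)))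
    (And.intro (d.q_nonneg c.beta0 (c.D (c.D (c.D d.w)))) (And.intro (d.q_nonneg c.beta1 d.w)
    (And.intro (d.q_nonneg c.beta1 (c.D d.w)) (And.intro (d.q_nonneg c.beta1 (c.D (c.D d.w)))
    (And.intro (d.q_nonneg c.beta2 d.w) (And.intro (d.q_nonneg c.beta2 (c.D d.w))
    (And.intro (d.q_nonneg c.beta3 d.w) d.wf_nonneg)))))))))
  simp only [WD.q] at key
  refine ⟨⟨?_, ?_, ?_, ?_⟩, ⟨?_, ?_, ?_⟩, ⟨?_, ?_⟩, ?_⟩ <;>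
  · intro K d
    obtain ⟨h1, h2, h3, h4, h5, h6, h7, h8, h9, h10, h11⟩ := key K d
    simp only [WD.E, En, WD.q, Function.iterate_succ, Function.comp, Function.iterate_zero, id]
    linarith

lemma WD.E_nonneg (d : c.WD K) : 0 ≤ d.E :=
  (d.q_nonneg _ _).trans (adm_all.1.1 K d)

/-- quantities bounded by a constant times the end energy -/
def OE (X : c.WD K → ℝ) : Prop := ∃ C, 0 ≤ C ∧ ∀ d, |X d| ≤ C * d.E

lemma OE.add {X Y : c.WD K → ℝ} (hX : OE X) (hY : OE Y) : OE fun d => X d + Y d := by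
  obtain ⟨C, hC, h⟩ := hX
  obtain ⟨C', hC', h'⟩ := hY
  refine ⟨C + C', by positivity, fun d => (abs_add_le _ _).trans ?_⟩
  rw [add_mul]; exact add_le_add (h d) (h' d)

lemma OE.smul {X : c.WD K → ℝ} (hX : OE X) (r : ℝ) : OE fun d => r * X d := by
  obtain ⟨C, hC, h⟩ := hX
  refine ⟨|r| * C, by positivity, fun d => ?_⟩
  rw [abs_mul, mul_assoc]
  exact mul_le_mul_of_nonneg_left (h d) (abs_nonneg _)

lemma OE.congr {X Y : c.WD K → ℝ} (hX : OE X) (h : ∀ d, Y d = X d) : OE Y := by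
  obtain rfl : Y = X := funext h
  exact hX

lemma OE.soft {b : c.Form} {a l : ℕ} (ha : c.Adm b a) (hl : c.Adm b l) (e : c.WD K → A)
    (he : ∀ d, e d ∈ c.CS) (h : ∀ d x, |c.ev x (e d)| ≤ K * c.ev x d.κ) :
    OE fun d => c.I (e d * b.b ((⇑c.D)^[a] d.w) ((⇑c.D)^[l] d.w)) := by
  refine ⟨2 * |K|, by positivity, fun d => ?_⟩
  have hK := d.win.K0
  set f := (⇑c.D)^[a] d.w with hf
  set g := (⇑c.D)^[l] d.w with hg
  have h1 := ha K d
  have h2 := hl K d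
  rw [← hf] at h1
  rw [← hg] at h2
  have := I_abs_le (c := c) (f := e d * b.b f g) (g := K • (d.κ * b.b f f) + K • (d.κ * b.b g g))
    (c.CS.mul_mem_right _ (he d))
    (c.CS.add_mem (c.CS.smul_of_tower_mem K (c.CS.mul_mem_right _ d.win.kcs))
      (c.CS.smul_of_tower_mem K (c.CS.mul_mem_right _ d.win.kcs))) (fun x => by
      have c1 := b.cauchy x f g (t := 1) one_pos
      simp only [map_mul, map_add, map_smul, smul_eq_mul, abs_mul]
      have p1 := b.nonneg x f
      have p2 := b.nonneg x g
      have := d.win.knn x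
      have : K * c.ev x d.κ * |c.ev x (b.b f g)| ≤ K * c.ev x d.κ * (c.ev x (b.b f f) + c.ev x (b.b g g)) := by
        gcongr
        simp only [one_mul, inv_one] at c1
        have := abs_nonneg (c.ev x (b.b f g))
        linarith
      calc _ ≤ K * c.ev x d.κ * |c.ev x (b.b f g)| := by gcongr; exact h d x
        _ ≤ _ := this
        _ = _ := by ring)
  refine this.trans ?_
  simp only [map_add, map_smul, smul_eq_mul]
  simp only [WD.q] at h1 h2
  rw [abs_of_nonneg hK]
  have a1 := mul_le_mul_of_nonneg_left h1 hK
  have a2 := mul_le_mul_of_nonneg_left h2 hK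
  linarith

lemma iter_CS {g : A} (hg : g ∈ c.CS) (i : ℕ) : (⇑c.D)^[i] g ∈ c.CS := by
  induction i with
  | zero => simpa using hg
  | succ i ih => rw [Function.iterate_succ_apply']; exact c.D_CS _ ih

lemma OE.sq {b : c.Form} {a : ℕ} (ha : c.Adm b a) (i : ℕ) (h1 : 1 ≤ i) (h6 : i ≤ 6) :
    OE fun d : c.WD K => c.I ((⇑c.D)^[i] (d.η ^ 2) * b.b ((⇑c.D)^[a] d.w) ((⇑c.D)^[a] d.w)) :=
  OE.soft ha ha _ (fun d => iter_CS (sq_CS d.win.cs) i) fun d x => d.win.sq i h1 h6 x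

lemma OE.prod {b : c.Form} {a l : ℕ} (ha : c.Adm b a) (hl : c.Adm b l) (i j : ℕ) (h1 : i ≤ 3)
    (h2 : j ≤ 3) (h3 : 1 ≤ i + j) :
    OE fun d : c.WD K => c.I ((⇑c.D)^[i] d.η * (⇑c.D)^[j] d.η * b.b ((⇑c.D)^[a] d.w) ((⇑c.D)^[l] d.w)) :=
  OE.soft ha hl _ (fun d => c.CS.mul_mem_right _ (iter_CS d.win.cs i))
    fun d x => d.win.prod i j h1 h2 h3 x

lemma Form.J1 (b : c.Form) {χ : A} (hχ : χ ∈ c.CS) (f : A) : c.I (χ * b.b f (c.D f)) = -(1/2) * c.I (c.D χ * b.b f f) := by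
  have h := c.I_D (χ * b.b f f) (c.CS.mul_mem_right _ hχ)
  rw [c.leibniz, b.leib, b.symm (c.D f) f, mul_add, map_add, map_add] at h
  linarith
lemma Form.Jn (b : c.Form) {χ : A} (hχ : χ ∈ c.CS) (f : A) (g : A) : c.I (χ * b.b f (c.D g)) =
    - c.I (c.D χ * b.b f g) - c.I (χ * b.b (c.D f) g) := by
  have h := c.I_D (χ * b.b f g) (c.CS.mul_mem_right _ hχ)
  rw [c.leibniz, b.leib, mul_add, map_add, map_add] at h
  linarith
lemma Form.J2 (b : c.Form) {χ : A} (hχ : χ ∈ c.CS) (f : A) : c.I (χ * b.b f (c.D (c.D f))) =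
    - c.I (χ * b.b (c.D f) (c.D f)) + (1/2) * c.I (c.D (c.D χ) * b.b f f) := by
  rw [b.Jn hχ, b.J1 (c.D_CS _ hχ)]; ring
lemma Form.J3 (b : c.Form) {χ : A} (hχ : χ ∈ c.CS) (f : A) : c.I (χ * b.b f (c.D (c.D (c.D f)))) =
    (3/2) * c.I (c.D χ * b.b (c.D f) (c.D f)) - (1/2) * c.I (c.D (c.D (c.D χ)) * b.b f f) := by
  rw [b.Jn hχ, b.J2 (c.D_CS _ hχ), b.J1 hχ]; ring
lemma Form.J4 (b : c.Form) {χ : A} (hχ : χ ∈ c.CS) (f : A) : c.I (χ * b.b f (c.D (c.D (c.D (c.D f))))) =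
    c.I (χ * b.b (c.D (c.D f)) (c.D (c.D f)))
    - 2 * c.I (c.D (c.D χ) * b.b (c.D f) (c.D f))
    + (1/2) * c.I (c.D (c.D (c.D (c.D χ))) * b.b f f) := by
  rw [b.Jn hχ, b.J3 (c.D_CS _ hχ), b.J2 hχ]; ring
lemma Form.J5 (b : c.Form) {χ : A} (hχ : χ ∈ c.CS) (f : A) : c.I (χ * b.b f (c.D (c.D (c.D (c.D (c.D f)))))) =
    -(5/2) * c.I (c.D χ * b.b (c.D (c.D f)) (c.D (c.D f)))
    + (5/2) * c.I (c.D (c.D (c.D χ)) * b.b (c.D f) (c.D f))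
    - (1/2) * c.I (c.D (c.D (c.D (c.D (c.D χ)))) * b.b f f) := by
  rw [b.Jn hχ, b.J4 (c.D_CS _ hχ), b.J3 hχ]; ring
lemma Form.J6 (b : c.Form) {χ : A} (hχ : χ ∈ c.CS) (f : A) : c.I (χ * b.b f (c.D (c.D (c.D (c.D (c.D (c.D f))))))) =
    - c.I (χ * b.b (c.D (c.D (c.D f))) (c.D (c.D (c.D f))))
    + (9/2) * c.I (c.D (c.D χ) * b.b (c.D (c.D f)) (c.D (c.D f)))
    - 3 * c.I (c.D (c.D (c.D (c.D χ))) * b.b (c.D f) (c.D f))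
    + (1/2) * c.I (c.D (c.D (c.D (c.D (c.D (c.D χ))))) * b.b f f) := by
  rw [b.Jn hχ, b.J5 (c.D_CS _ hχ), b.J4 hχ]; ring
end Cyl

namespace Cyl

variable {A : Type} [CommRing A] [Algebra ℝ A] {P : Type} {c : Cyl A P} {K : ℝ}

/-- Form of the operator before integrating by parts in `D`. -/
lemma I_PP' (α m2 : ℝ) {χ : A} (hr : χ ∈ c.Rad) (hc : χ ∈ c.CS) (v w : A) :
    c.I (χ * v * c.PP α m2 w) =
      (α^6 - α^4*(8+3*m2) + α^2*(16+3*m2^2) - m2*(m2-4)^2) * c.I (χ * c.beta0.b v w)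
      + (-3*α^4 + 6*α^2*m2 - (m2-4)*(3*m2-4)) * c.I (χ * c.beta1.b v w)
      + (3*α^2 - (3*m2-8)) * c.I (χ * c.beta2.b v w)
      - c.I (χ * c.beta3.b v w)
      + (6*α^5 - 4*α^3*(8+3*m2) + 2*α*(16+3*m2^2)) * c.I (χ * c.beta0.b v (c.D w))
      + (-12*α^3 + 12*α*m2) * c.I (χ * c.beta1.b v (c.D w))
      + (6*α) * c.I (χ * c.beta2.b v (c.D w))
      + (15*α^4 - 6*α^2*(8+3*m2) + 16 + 3*m2^2) * c.I (χ * c.beta0.b v (c.D (c.D w)))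
      + (-18*α^2 + 6*m2) * c.I (χ * c.beta1.b v (c.D (c.D w)))
      + 3 * c.I (χ * c.beta2.b v (c.D (c.D w)))
      + (20*α^3 - 4*α*(8+3*m2)) * c.I (χ * c.beta0.b v (c.D (c.D (c.D w))))
      + (-12*α) * c.I (χ * c.beta1.b v (c.D (c.D (c.D w))))
      + (15*α^2 - 8 - 3*m2) * c.I (χ * c.beta0.b v (c.D (c.D (c.D (c.D w)))))
      + (-3) * c.I (χ * c.beta1.b v (c.D (c.D (c.D (c.D w)))))
      + (6*α) * c.I (χ * c.beta0.b v (c.D (c.D (c.D (c.D (c.D w))))))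
      + c.I (χ * c.beta0.b v (c.D (c.D (c.D (c.D (c.D (c.D w))))))) := by
  have hg : χ * v ∈ c.CS := c.CS.mul_mem_right _ hc
  have e : ∀ h : A, c.I (χ * v * h) = c.I (χ * c.beta0.b v h) := fun h => by
    rw [beta0_apply, mul_assoc]
  simp only [PP, mul_add, mul_sub, map_add, map_sub, mul_smul_comm, map_smul, smul_eq_mul]
  rw [I_L1 hg, I_L2 hg, I_L3 hg, I_L1 hg, I_L2 hg, I_L1 hg, I_L2 hg, I_L1 hg, I_L1 hg]
  simp only [e, c.beta1.rad χ hr, c.beta2.rad χ hr, c.beta3.rad χ hr]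

/-- leading part of the nonlinear term -/
def WD.FM (d : c.WD K) (α m2 : ℝ) : ℝ :=
  (α^6 - α^4*(8+3*m2) + α^2*(16+3*m2^2) - m2*(m2-4)^2) * c.I (d.η ^ 2 * c.beta0.b d.w d.w)
  + (-3*α^4 + 6*α^2*m2 - (m2-4)*(3*m2-4)) * c.I (d.η ^ 2 * c.beta1.b d.w d.w)
  + (3*α^2 - (3*m2-8)) * c.I (d.η ^ 2 * c.beta2.b d.w d.w)
  - c.I (d.η ^ 2 * c.beta3.b d.w d.w)
  - (15*α^4 - 6*α^2*(8+3*m2) + 16 + 3*m2^2) * c.I (d.η ^ 2 * c.beta0.b (c.D d.w) (c.D d.w))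
  - (-18*α^2 + 6*m2) * c.I (d.η ^ 2 * c.beta1.b (c.D d.w) (c.D d.w))
  - 3 * c.I (d.η ^ 2 * c.beta2.b (c.D d.w) (c.D d.w))
  + (15*α^2 - 8 - 3*m2) * c.I (d.η ^ 2 * c.beta0.b (c.D (c.D d.w)) (c.D (c.D d.w)))
  + (-3) * c.I (d.η ^ 2 * c.beta1.b (c.D (c.D d.w)) (c.D (c.D d.w)))
  - c.I (d.η ^ 2 * c.beta0.b (c.D (c.D (c.D d.w))) (c.D (c.D (c.D d.w))))

/-- leading part of the radial Pohozaev identity -/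
def WD.BM (d : c.WD K) (α m2 : ℝ) : ℝ :=
  (6*α^5 - 4*α^3*(8+3*m2) + 2*α*(16+3*m2^2)) * c.I (d.η ^ 2 * c.beta0.b (c.D d.w) (c.D d.w))
  + (-12*α^3 + 12*α*m2) * c.I (d.η ^ 2 * c.beta1.b (c.D d.w) (c.D d.w))
  + (6*α) * c.I (d.η ^ 2 * c.beta2.b (c.D d.w) (c.D d.w))
  - (20*α^3 - 4*α*(8+3*m2)) * c.I (d.η ^ 2 * c.beta0.b (c.D (c.D d.w)) (c.D (c.D d.w)))
  - (-12*α) * c.I (d.η ^ 2 * c.beta1.b (c.D (c.D d.w)) (c.D (c.D d.w)))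
  + (6*α) * c.I (d.η ^ 2 * c.beta0.b (c.D (c.D (c.D d.w))) (c.D (c.D (c.D d.w))))

variable (c) in
lemma OE_list (K : ℝ) (b : c.Form) (a : ℕ) (ha : c.Adm b a) :
    OE (fun d : c.WD K => c.I (c.D (d.η ^ 2) * b.b ((⇑c.D)^[a] d.w) ((⇑c.D)^[a] d.w))) ∧
    OE (fun d : c.WD K => c.I (c.D (c.D (d.η ^ 2)) * b.b ((⇑c.D)^[a] d.w) ((⇑c.D)^[a] d.w))) ∧
    OE (fun d : c.WD K => c.I (c.D (c.D (c.D (d.η ^ 2))) * b.b ((⇑c.D)^[a] d.w) ((⇑c.D)^[a] d.w))) ∧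
    OE (fun d : c.WD K => c.I (c.D (c.D (c.D (c.D (d.η ^ 2)))) * b.b ((⇑c.D)^[a] d.w) ((⇑c.D)^[a] d.w))) ∧
    OE (fun d : c.WD K => c.I (c.D (c.D (c.D (c.D (c.D (d.η ^ 2))))) * b.b ((⇑c.D)^[a] d.w) ((⇑c.D)^[a] d.w))) ∧
    OE (fun d : c.WD K => c.I (c.D (c.D (c.D (c.D (c.D (c.D (d.η ^ 2)))))) * b.b ((⇑c.D)^[a] d.w) ((⇑c.D)^[a] d.w))) :=
  ⟨OE.sq ha 1 (by norm_num) (by norm_num), OE.sq ha 2 (by norm_num) (by norm_num),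
   OE.sq ha 3 (by norm_num) (by norm_num), OE.sq ha 4 (by norm_num) (by norm_num),
   OE.sq ha 5 (by norm_num) (by norm_num), OE.sq ha 6 (by norm_num) (by norm_num)⟩

lemma OE_F (α m2 : ℝ) : OE fun d : c.WD K =>
    c.I (d.η ^ 2 * d.w * c.PP α m2 d.w) - d.FM α m2 := by
  obtain ⟨⟨a00, a01, a02, a03⟩, ⟨a10, a11, a12⟩, ⟨a20, a21⟩, a30⟩ := adm_all (c := c)
  obtain ⟨p1, p2, p3, p4, p5, p6⟩ := OE_list c K c.beta0 0 a00
  obtain ⟨q1, q2, q3, q4, q5, q6⟩ := OE_list c K c.beta0 1 a01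
  obtain ⟨r1, r2, r3, r4, r5, r6⟩ := OE_list c K c.beta0 2 a02
  obtain ⟨s1, s2, s3, s4, s5, s6⟩ := OE_list c K c.beta1 0 a10
  obtain ⟨t1, t2, t3, t4, t5, t6⟩ := OE_list c K c.beta1 1 a11
  obtain ⟨u1, u2, u3, u4, u5, u6⟩ := OE_list c K c.beta2 0 a20
  simp only [Function.iterate_succ, Function.comp, Function.iterate_zero, id] at p1 p2 p3 p4 p5 p6 q1 q2 q3 q4 q5 q6 r1 r2 r3 s1 s2 s3 s4 t1 t2 u1 u2
  refine OE.congr ((p1.smul ((6*α^5 - 4*α^3*(8+3*m2) + 2*α*(16+3*m2^2))*(-(1/2)))).add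
   ((s1.smul ((-12*α^3 + 12*α*m2)*(-(1/2)))).add
   ((u1.smul ((6*α)*(-(1/2)))).add
   ((p2.smul ((15*α^4 - 6*α^2*(8+3*m2) + 16 + 3*m2^2)*(1/2))).add
   ((s2.smul ((-18*α^2 + 6*m2)*(1/2))).add
   ((u2.smul (3*(1/2))).add
   ((q1.smul ((20*α^3 - 4*α*(8+3*m2))*(3/2))).add
   ((p3.smul ((20*α^3 - 4*α*(8+3*m2))*(-1/2))).add
   ((t1.smul ((-12*α)*(3/2))).add
   ((s3.smul ((-12*α)*(-1/2))).add
   ((q2.smul ((15*α^2 - 8 - 3*m2)*(-2))).add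
   ((p4.smul ((15*α^2 - 8 - 3*m2)*(1/2))).add
   ((t2.smul ((-3)*(-2))).add
   ((s4.smul ((-3)*(1/2))).add
   ((r1.smul ((6*α)*(-(5/2)))).add
   ((q3.smul ((6*α)*(5/2))).add
   ((p5.smul ((6*α)*(-(1/2)))).add
   ((r2.smul (9/2)).add
   ((q4.smul (-3)).add
   (p6.smul (1/2))))))))))))))))))))) fun d => ?_
  have hc := sq_CS d.win.cs
  have hr : d.η ^ 2 ∈ c.Rad := c.Rad.pow_mem d.win.rad _
  rw [I_PP' α m2 hr hc, c.beta0.J1 hc, c.beta1.J1 hc, c.beta2.J1 hc, c.beta0.J2 hc, c.beta1.J2 hc,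
    c.beta2.J2 hc, c.beta0.J3 hc, c.beta1.J3 hc, c.beta0.J4 hc, c.beta1.J4 hc, c.beta0.J5 hc,
    c.beta0.J6 hc, WD.FM]
  ring

lemma OE_B (α m2 : ℝ) : OE fun d : c.WD K =>
    c.I (d.η ^ 2 * c.D d.w * c.PP α m2 d.w) - d.BM α m2 := by
  obtain ⟨⟨a00, a01, a02, a03⟩, ⟨a10, a11, a12⟩, ⟨a20, a21⟩, a30⟩ := adm_all (c := c)
  obtain ⟨p1, -⟩ := OE_list c K c.beta0 0 a00
  obtain ⟨ppa, -⟩ := OE_list c K c.beta1 0 a10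
  obtain ⟨ppb, -⟩ := OE_list c K c.beta2 0 a20
  obtain ⟨ppc, -⟩ := OE_list c K c.beta3 0 a30
  obtain ⟨q1, q2, q3, q4, q5, q6⟩ := OE_list c K c.beta0 1 a01
  obtain ⟨r1, r2, r3, r4, r5, r6⟩ := OE_list c K c.beta0 2 a02
  obtain ⟨z1, -⟩ := OE_list c K c.beta0 3 a03
  obtain ⟨t1, t2, t3, t4, t5, t6⟩ := OE_list c K c.beta1 1 a11
  obtain ⟨y1, -⟩ := OE_list c K c.beta1 2 a12
  obtain ⟨u1, u2, u3, u4, u5, u6⟩ := OE_list c K c.beta2 1 a21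
  simp only [Function.iterate_succ, Function.comp, Function.iterate_zero, id] at p1 ppa ppb ppc q1 q2 q3 q4 q5 r1 r2 r3 z1 t1 t2 t3 y1 u1
  refine OE.congr ((p1.smul ((α^6 - α^4*(8+3*m2) + α^2*(16+3*m2^2) - m2*(m2-4)^2)*(-(1/2)))).add
   ((ppa.smul ((-3*α^4 + 6*α^2*m2 - (m2-4)*(3*m2-4))*(-(1/2)))).add
   ((ppb.smul ((3*α^2 - (3*m2-8))*(-(1/2)))).add
   ((ppc.smul (-(-(1/2)))).add
   ((q1.smul ((15*α^4 - 6*α^2*(8+3*m2) + 16 + 3*m2^2)*(-(1/2)))).add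
   ((t1.smul ((-18*α^2 + 6*m2)*(-(1/2)))).add
   ((u1.smul (3*(-(1/2)))).add
   ((q2.smul ((20*α^3 - 4*α*(8+3*m2))*(1/2))).add
   ((t2.smul ((-12*α)*(1/2))).add
   ((r1.smul ((15*α^2 - 8 - 3*m2)*(3/2))).add
   ((q3.smul ((15*α^2 - 8 - 3*m2)*(-1/2))).add
   ((y1.smul ((-3)*(3/2))).add
   ((t3.smul ((-3)*(-1/2))).add
   ((r2.smul ((6*α)*(-2))).add
   ((q4.smul ((6*α)*(1/2))).add
   ((z1.smul (-(5/2))).add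
   ((r3.smul (5/2)).add
   (q5.smul (-1/2))))))))))))))))))) fun d => ?_
  have hc := sq_CS d.win.cs
  have hr : d.η ^ 2 ∈ c.Rad := c.Rad.pow_mem d.win.rad _
  rw [I_PP' α m2 hr hc, c.beta0.symm (c.D d.w) d.w, c.beta1.symm (c.D d.w) d.w,
    c.beta2.symm (c.D d.w) d.w, c.beta3.symm (c.D d.w) d.w,
    c.beta0.J1 hc, c.beta1.J1 hc, c.beta2.J1 hc, c.beta3.J1 hc,
    c.beta0.J1 hc, c.beta1.J1 hc, c.beta2.J1 hc, c.beta0.J2 hc, c.beta1.J2 hc,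
    c.beta0.J3 hc, c.beta1.J3 hc, c.beta0.J4 hc, c.beta0.J5 hc, WD.BM]
  ring
end Cyl

namespace Cyl

variable {A : Type} [CommRing A] [Algebra ℝ A] {P : Type} {c : Cyl A P} {K : ℝ}

lemma OE_S0 (b : c.Form) (d : c.WD K) :
    c.I (b.b (d.η * d.w) (d.η * d.w)) = c.I (d.η ^ 2 * b.b d.w d.w) := by
  rw [b.rad _ d.win.rad, b.rad' _ d.win.rad]; congr 1; ring

lemma OE_S1 {b : c.Form} (h0 : c.Adm b 0) (h1 : c.Adm b 1) : OE fun d : c.WD K =>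
    c.I (b.b (c.D (d.η * d.w)) (c.D (d.η * d.w))) - c.I (d.η ^ 2 * b.b (c.D d.w) (c.D d.w)) := by
  have p1 := OE.prod (K := K) h0 h1 0 1 (by norm_num) (by norm_num) (by norm_num)
  have p2 := OE.prod (K := K) h0 h0 1 1 (by norm_num) (by norm_num) (by norm_num)
  simp only [Function.iterate_succ, Function.comp, Function.iterate_zero, id] at p1 p2
  refine OE.congr ((p1.smul 2).add p2) fun d => ?_
  have r0 := d.win.rad
  have r1 := c.D_Rad _ r0
  have : b.b (c.D (d.η * d.w)) (c.D (d.η * d.w)) = d.η ^ 2 * b.b (c.D d.w) (c.D d.w)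
      + ((2:ℝ) • (d.η * c.D d.η * b.b d.w (c.D d.w)) + c.D d.η * c.D d.η * b.b d.w d.w) := by
    rw [D_radmul1]
    simp only [map_add, LinearMap.add_apply, b.rad _ r0, b.rad _ r1, b.rad' _ r0, b.rad' _ r1,
      b.symm (c.D d.w) d.w, two_smul]
    ring
  rw [this]
  simp only [map_add, map_smul, smul_eq_mul]
  ring

lemma OE_S2 {b : c.Form} (h0 : c.Adm b 0) (h1 : c.Adm b 1) (h2 : c.Adm b 2) :
    OE fun d : c.WD K =>
    c.I (b.b (c.D (c.D (d.η * d.w))) (c.D (c.D (d.η * d.w))))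
      - c.I (d.η ^ 2 * b.b (c.D (c.D d.w)) (c.D (c.D d.w))) := by
  have p1 := OE.prod (K := K) h0 h2 0 2 (by norm_num) (by norm_num) (by norm_num)
  have p2 := OE.prod (K := K) h1 h2 0 1 (by norm_num) (by norm_num) (by norm_num)
  have p3 := OE.prod (K := K) h0 h0 2 2 (by norm_num) (by norm_num) (by norm_num)
  have p4 := OE.prod (K := K) h1 h1 1 1 (by norm_num) (by norm_num) (by norm_num)
  have p5 := OE.prod (K := K) h0 h1 1 2 (by norm_num) (by norm_num) (by norm_num)
  simp only [Function.iterate_succ, Function.comp, Function.iterate_zero, id] at p1 p2 p3 p4 p5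
  refine OE.congr ((p1.smul 2).add ((p2.smul 4).add (p3.add ((p4.smul 4).add (p5.smul 4)))))
    fun d => ?_
  have r0 := d.win.rad
  have r1 := c.D_Rad _ r0
  have r2 := c.D_Rad _ r1
  have : b.b (c.D (c.D (d.η * d.w))) (c.D (c.D (d.η * d.w))) =
      d.η ^ 2 * b.b (c.D (c.D d.w)) (c.D (c.D d.w))
      + ((2:ℝ) • (d.η * c.D (c.D d.η) * b.b d.w (c.D (c.D d.w)))
       + ((4:ℝ) • (d.η * c.D d.η * b.b (c.D d.w) (c.D (c.D d.w)))
       + (c.D (c.D d.η) * c.D (c.D d.η) * b.b d.w d.w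
       + ((4:ℝ) • (c.D d.η * c.D d.η * b.b (c.D d.w) (c.D d.w))
       + (4:ℝ) • (c.D d.η * c.D (c.D d.η) * b.b d.w (c.D d.w)))))) := by
    rw [D_radmul2]
    simp only [map_add, LinearMap.add_apply, map_nsmul, LinearMap.smul_apply,
      b.rad _ r0, b.rad _ r1, b.rad _ r2,
      b.rad' _ r0, b.rad' _ r1, b.rad' _ r2,
      b.symm (c.D d.w) d.w, b.symm (c.D (c.D d.w)) d.w, b.symm (c.D (c.D d.w)) (c.D d.w)]
    simp only [nsmul_eq_mul, Algebra.smul_def, map_ofNat]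
    push_cast
    ring
  rw [this]
  simp only [map_add, map_smul, smul_eq_mul]
  ring

lemma OE_S3 {b : c.Form} (h0 : c.Adm b 0) (h1 : c.Adm b 1) (h2 : c.Adm b 2) (h3 : c.Adm b 3) :
    OE fun d : c.WD K =>
    c.I (b.b (c.D (c.D (c.D (d.η * d.w)))) (c.D (c.D (c.D (d.η * d.w)))))
      - c.I (d.η ^ 2 * b.b (c.D (c.D (c.D d.w))) (c.D (c.D (c.D d.w)))) := by
  have p03 := OE.prod (K := K) h0 h3 0 3 (by norm_num) (by norm_num) (by norm_num)
  have p13 := OE.prod (K := K) h1 h3 0 2 (by norm_num) (by norm_num) (by norm_num)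
  have p23 := OE.prod (K := K) h2 h3 0 1 (by norm_num) (by norm_num) (by norm_num)
  have p00 := OE.prod (K := K) h0 h0 3 3 (by norm_num) (by norm_num) (by norm_num)
  have p11 := OE.prod (K := K) h1 h1 2 2 (by norm_num) (by norm_num) (by norm_num)
  have p22 := OE.prod (K := K) h2 h2 1 1 (by norm_num) (by norm_num) (by norm_num)
  have p01 := OE.prod (K := K) h0 h1 2 3 (by norm_num) (by norm_num) (by norm_num)
  have p02 := OE.prod (K := K) h0 h2 1 3 (by norm_num) (by norm_num) (by norm_num)
  have p12 := OE.prod (K := K) h1 h2 1 2 (by norm_num) (by norm_num) (by norm_num)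
  simp only [Function.iterate_succ, Function.comp, Function.iterate_zero, id] at p03 p13 p23 p00 p11 p22 p01 p02 p12
  refine OE.congr ((p03.smul 2).add ((p13.smul 6).add ((p23.smul 6).add (p00.add
    ((p11.smul 9).add ((p22.smul 9).add ((p01.smul 6).add ((p02.smul 6).add (p12.smul 18)))))))))
    fun d => ?_
  have r0 := d.win.rad
  have r1 := c.D_Rad _ r0
  have r2 := c.D_Rad _ r1
  have r3 := c.D_Rad _ r2
  have : b.b (c.D (c.D (c.D (d.η * d.w)))) (c.D (c.D (c.D (d.η * d.w)))) =
      d.η ^ 2 * b.b (c.D (c.D (c.D d.w))) (c.D (c.D (c.D d.w)))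
      + ((2:ℝ) • (d.η * c.D (c.D (c.D d.η)) * b.b d.w (c.D (c.D (c.D d.w))))
       + ((6:ℝ) • (d.η * c.D (c.D d.η) * b.b (c.D d.w) (c.D (c.D (c.D d.w))))
       + ((6:ℝ) • (d.η * c.D d.η * b.b (c.D (c.D d.w)) (c.D (c.D (c.D d.w))))
       + (c.D (c.D (c.D d.η)) * c.D (c.D (c.D d.η)) * b.b d.w d.w
       + ((9:ℝ) • (c.D (c.D d.η) * c.D (c.D d.η) * b.b (c.D d.w) (c.D d.w))
       + ((9:ℝ) • (c.D d.η * c.D d.η * b.b (c.D (c.D d.w)) (c.D (c.D d.w)))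
       + ((6:ℝ) • (c.D (c.D d.η) * c.D (c.D (c.D d.η)) * b.b d.w (c.D d.w))
       + ((6:ℝ) • (c.D d.η * c.D (c.D (c.D d.η)) * b.b d.w (c.D (c.D d.w)))
       + (18:ℝ) • (c.D d.η * c.D (c.D d.η) * b.b (c.D d.w) (c.D (c.D d.w))))))))))) := by
    rw [D_radmul3]
    simp only [map_add, LinearMap.add_apply, map_nsmul, LinearMap.smul_apply,
      b.rad _ r0, b.rad _ r1, b.rad _ r2, b.rad _ r3,
      b.rad' _ r0, b.rad' _ r1, b.rad' _ r2, b.rad' _ r3,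
      b.symm (c.D d.w) d.w, b.symm (c.D (c.D d.w)) d.w, b.symm (c.D (c.D d.w)) (c.D d.w),
      b.symm (c.D (c.D (c.D d.w))) d.w, b.symm (c.D (c.D (c.D d.w))) (c.D d.w),
      b.symm (c.D (c.D (c.D d.w))) (c.D (c.D d.w))]
    simp only [nsmul_eq_mul, Algebra.smul_def, map_ofNat]
    push_cast
    ring
  rw [this]
  simp only [map_add, map_smul, smul_eq_mul]
  ring

lemma OE_SS (m2 : ℝ) : OE fun d : c.WD K => c.SS m2 (d.η * d.w) + d.FM 0 m2 := by
  obtain ⟨⟨a00, a01, a02, a03⟩, ⟨a10, a11, a12⟩, ⟨a20, a21⟩, a30⟩ := adm_all (c := c)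
  refine OE.congr (((OE_S1 a00 a01).smul (16+3*m2^2)).add (((OE_S1 a10 a11).smul (6*m2)).add
    (((OE_S1 a20 a21).smul 3).add (((OE_S2 a00 a01 a02).smul (8+3*m2)).add
    (((OE_S2 a10 a11 a12).smul 3).add (OE_S3 a00 a01 a02 a03)))))) fun d => ?_
  rw [SS, OE_S0, OE_S0, OE_S0, OE_S0, WD.FM]
  ring
end Cyl

namespace Cyl

variable {A : Type} [CommRing A] [Algebra ℝ A] {P : Type} {c : Cyl A P} {K : ℝ}

lemma lin_bound {a g M D : ℝ} (hg : 0 ≤ g) (hgD : g ≤ D) (ha : |a| ≤ M) : a * g ≤ M * D := by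
  have h1 : a * g ≤ |a| * g := mul_le_mul_of_nonneg_right (le_abs_self a) hg
  have h2 : |a| * g ≤ M * D := mul_le_mul ha hgD hg ((abs_nonneg a).trans ha)
  exact h1.trans h2

/-- positivity conditions in the supercritical range -/
structure Coef (α m2 p : ℝ) : Prop where
  b0 : 0 < 6*α^5 - 4*α^3*(8+3*m2) + 2*α*(16+3*m2^2)
  b1 : 0 < -12*α^3 + 12*α*m2
  b2 : 0 < 4*α*(8+3*m2) - 20*α^3
  b3 : 0 < α
  c0 : 0 < -p*(α^6 - α^4*(8+3*m2) + α^2*(16+3*m2^2) - m2*(m2-4)^2) - m2*(m2-4)^2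
  c1 : 0 < -p*(-3*α^4 + 6*α^2*m2 - (m2-4)*(3*m2-4)) - (m2-4)*(3*m2-4)
  c2 : 0 < -p*(3*α^2 - (3*m2-8)) - (3*m2-8)

lemma pohBound (α m2 p : ℝ) (hp : 1 < p) (d : c.WD K) (hd : d.f = - c.PP α m2 d.w)
    (hDx : ∀ x, c.ev x (c.D (d.w * d.f)) = (p+1) * c.ev x (d.f * c.D d.w)) :
    |c.I (d.η ^ 2 * c.D d.w * c.PP α m2 d.w)| ≤ |K| * d.E := by
  have hc := sq_CS d.win.cs
  have hr : d.η ^ 2 ∈ c.Rad := c.Rad.pow_mem d.win.rad _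
  have t1 : c.I (d.η ^ 2 * c.D (d.w * d.f)) = (p+1) * c.I (d.η ^ 2 * (d.f * c.D d.w)) := by
    rw [show (p+1) * c.I (d.η ^ 2 * (d.f * c.D d.w)) = c.I ((p+1) • (d.η ^ 2 * (d.f * c.D d.w))) by
      rw [map_smul, smul_eq_mul]]
    refine I_congr (c.CS.mul_mem_right _ hc)
      (c.CS.smul_of_tower_mem _ (c.CS.mul_mem_right _ hc)) fun x => ?_
    simp only [map_mul, map_smul, smul_eq_mul] at hDx ⊢
    rw [hDx x]; ring
  have t2 : c.I (d.η ^ 2 * c.D (d.w * d.f)) = - c.I (c.D (d.η ^ 2) * (d.w * d.f)) := by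
    have h := c.I_D (d.η ^ 2 * (d.w * d.f)) (c.CS.mul_mem_right _ hc)
    rw [c.leibniz, map_add] at h
    linarith
  have t3 : c.I (d.η ^ 2 * c.D d.w * c.PP α m2 d.w) = - c.I (d.η ^ 2 * (d.f * c.D d.w)) := by
    rw [hd, ← map_neg]; congr 1; ring
  have t4 : |c.I (c.D (d.η ^ 2) * (d.w * d.f))| ≤ |K| * d.E := by
    have := I_abs_le (c := c) (f := c.D (d.η ^ 2) * (d.w * d.f)) (g := K • (d.κ * (d.w * d.f)))
      (c.CS.mul_mem_right _ (c.D_CS _ hc))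
      (c.CS.smul_of_tower_mem K (c.CS.mul_mem_right _ d.win.kcs)) (fun x => by
        rw [map_mul (c.ev x) (c.D _) (d.w * d.f), abs_mul, abs_of_nonneg (d.nn x), map_smul,
          map_mul (c.ev x) d.κ (d.w * d.f), smul_eq_mul, ← mul_assoc]
        exact mul_le_mul_of_nonneg_right (d.win.sq 1 le_rfl (by norm_num) x) (d.nn x))
    refine this.trans ?_
    rw [map_smul, smul_eq_mul, abs_of_nonneg d.win.K0]
    refine mul_le_mul_of_nonneg_left ?_ d.win.K0
    have z := d.q_nonneg
    have z1 := z c.beta0 d.w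
    have z2 := z c.beta1 d.w
    have z3 := z c.beta2 d.w
    have z4 := z c.beta3 d.w
    have z5 := z c.beta0 (c.D d.w)
    have z6 := z c.beta1 (c.D d.w)
    have z7 := z c.beta2 (c.D d.w)
    have z8 := z c.beta0 (c.D (c.D d.w))
    have z9 := z c.beta1 (c.D (c.D d.w))
    have z10 := z c.beta0 (c.D (c.D (c.D d.w)))
    simp only [WD.q] at z1 z2 z3 z4 z5 z6 z7 z8 z9 z10
    simp only [WD.E, En]
    linarith
  rw [t3, abs_neg]
  have t5 : |c.I (c.D (d.η ^ 2) * (d.w * d.f))| = (p+1) * |c.I (d.η ^ 2 * (d.f * c.D d.w))| := by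
    rw [← abs_neg, ← t2, t1, abs_mul, abs_of_nonneg (by linarith)]
  have := abs_nonneg (c.I (d.η ^ 2 * (d.f * c.D d.w)))
  nlinarith

set_option maxHeartbeats 1000000 in
lemma starArith (α m2 p CF CS CB K : ℝ) (hp : 1 < p) (hα : Coef α m2 p) (hCF : 0 ≤ CF)
    (hCS : 0 ≤ CS) (hCB : 0 ≤ CB) (hK : 0 ≤ K) :
    ∃ C : ℝ, 0 ≤ C ∧ ∀ X S Bt E G00 G01 G02 G03 G10 G11 G12 G20 G21 G30 : ℝ, 0 ≤ E →
      0 ≤ G00 → 0 ≤ G01 → 0 ≤ G02 → 0 ≤ G03 → 0 ≤ G10 → 0 ≤ G11 → 0 ≤ G12 → 0 ≤ G20 → 0 ≤ G21 → 0 ≤ G30 →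
      -(CF * E) ≤ -X - ((α^6 - α^4*(8+3*m2) + α^2*(16+3*m2^2) - m2*(m2-4)^2) * G00
        + (-3*α^4 + 6*α^2*m2 - (m2-4)*(3*m2-4)) * G01 + (3*α^2 - (3*m2-8)) * G02 - G03
        - (15*α^4 - 6*α^2*(8+3*m2) + 16 + 3*m2^2) * G10 - (-18*α^2 + 6*m2) * G11 - 3 * G12
        + (15*α^2 - 8 - 3*m2) * G20 + (-3) * G21 - G30) → -X - ((α^6 - α^4*(8+3*m2) + α^2*(16+3*m2^2) - m2*(m2-4)^2) * G00
        + (-3*α^4 + 6*α^2*m2 - (m2-4)*(3*m2-4)) * G01 + (3*α^2 - (3*m2-8)) * G02 - G03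
        - (15*α^4 - 6*α^2*(8+3*m2) + 16 + 3*m2^2) * G10 - (-18*α^2 + 6*m2) * G11 - 3 * G12
        + (15*α^2 - 8 - 3*m2) * G20 + (-3) * G21 - G30) ≤ CF * E →
      S + (((0:ℝ)^6 - (0:ℝ)^4*(8+3*m2) + (0:ℝ)^2*(16+3*m2^2) - m2*(m2-4)^2) * G00
        + (-3*(0:ℝ)^4 + 6*(0:ℝ)^2*m2 - (m2-4)*(3*m2-4)) * G01 + (3*(0:ℝ)^2 - (3*m2-8)) * G02 - G03
        - (15*(0:ℝ)^4 - 6*(0:ℝ)^2*(8+3*m2) + 16 + 3*m2^2) * G10 - (-18*(0:ℝ)^2 + 6*m2) * G11 - 3 * G12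
        + (15*(0:ℝ)^2 - 8 - 3*m2) * G20 + (-3) * G21 - G30) ≤ CS * E →
      -(CB * E) ≤ Bt - ((6*α^5 - 4*α^3*(8+3*m2) + 2*α*(16+3*m2^2)) * G10 + (-12*α^3 + 12*α*m2) * G11
        + (6*α) * G12 - (20*α^3 - 4*α*(8+3*m2)) * G20 - (-12*α) * G21 + (6*α) * G30) → Bt - ((6*α^5 - 4*α^3*(8+3*m2) + 2*α*(16+3*m2^2)) * G10 + (-12*α^3 + 12*α*m2) * G11
        + (6*α) * G12 - (20*α^3 - 4*α*(8+3*m2)) * G20 - (-12*α) * G21 + (6*α) * G30) ≤ CB * E →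
      -(K * E) ≤ Bt → Bt ≤ K * E → p * X ≤ S → X ≤ C * E := by
  have hp0 : 0 < p - 1 := by linarith
  obtain ⟨q0, q1, q2, q3, e0, e1, e2⟩ := hα
  obtain ⟨m, hm, hm1, hm2, hm3, hm4, hm5, hm6, hm7, hm8⟩ : ∃ m : ℝ, 0 < m ∧
      m ≤ 6*α^5 - 4*α^3*(8+3*m2) + 2*α*(16+3*m2^2) ∧ m ≤ -12*α^3 + 12*α*m2 ∧
      m ≤ 4*α*(8+3*m2) - 20*α^3 ∧ m ≤ α ∧
      m ≤ -p*(α^6 - α^4*(8+3*m2) + α^2*(16+3*m2^2) - m2*(m2-4)^2) - m2*(m2-4)^2 ∧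
      m ≤ -p*(-3*α^4 + 6*α^2*m2 - (m2-4)*(3*m2-4)) - (m2-4)*(3*m2-4) ∧
      m ≤ -p*(3*α^2 - (3*m2-8)) - (3*m2-8) ∧ m ≤ p - 1 := by
    refine ⟨min (6*α^5 - 4*α^3*(8+3*m2) + 2*α*(16+3*m2^2)) (min (-12*α^3 + 12*α*m2)
      (min (4*α*(8+3*m2) - 20*α^3) (min α (min
      (-p*(α^6 - α^4*(8+3*m2) + α^2*(16+3*m2^2) - m2*(m2-4)^2) - m2*(m2-4)^2)
      (min (-p*(-3*α^4 + 6*α^2*m2 - (m2-4)*(3*m2-4)) - (m2-4)*(3*m2-4))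
      (min (-p*(3*α^2 - (3*m2-8)) - (3*m2-8)) (p-1))))))), ?_, ?_⟩
    · simp only [lt_min_iff]; exact ⟨q0, q1, q2, q3, e0, e1, e2, hp0⟩
    · refine ⟨min_le_left _ _, ?_, ?_, ?_, ?_, ?_, ?_, ?_⟩ <;> simp only [min_le_iff, le_refl, true_or, or_true]
  set M := |(15*α^4 - 6*α^2*(8+3*m2) + 16 + 3*m2^2)| + |(-18*α^2 + 6*m2)| + |15*α^2 - 8 - 3*m2| + 3
    + |(15*(0:ℝ)^4 - 6*0^2*(8+3*m2) + 16 + 3*m2^2)| + |(-18*(0:ℝ)^2 + 6*m2)| + |15*(0:ℝ)^2 - 8 - 3*m2| with hM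
  set M' := |(α^6 - α^4*(8+3*m2) + α^2*(16+3*m2^2) - m2*(m2-4)^2)| +
    |(-3*α^4 + 6*α^2*m2 - (m2-4)*(3*m2-4))| + |(3*α^2 - (3*m2-8))| + 1 with hM'
  have n1 := abs_nonneg (15*α^4 - 6*α^2*(8+3*m2) + 16 + 3*m2^2)
  have n2 := abs_nonneg (-18*α^2 + 6*m2)
  have n3 := abs_nonneg (15*α^2 - 8 - 3*m2)
  have n4 := abs_nonneg (15*(0:ℝ)^4 - 6*0^2*(8+3*m2) + 16 + 3*m2^2)
  have n5 := abs_nonneg (-18*(0:ℝ)^2 + 6*m2)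
  have n6 := abs_nonneg (15*(0:ℝ)^2 - 8 - 3*m2)
  have k1 := abs_nonneg (α^6 - α^4*(8+3*m2) + α^2*(16+3*m2^2) - m2*(m2-4)^2)
  have k2 := abs_nonneg (-3*α^4 + 6*α^2*m2 - (m2-4)*(3*m2-4))
  have k3 := abs_nonneg (3*α^2 - (3*m2-8))
  have hM0 : 0 ≤ M := by linarith
  have hM0' : 0 ≤ M' := by linarith
  set C1 := (CB + K) / m with hC1
  have hC10 : 0 ≤ C1 := by positivity
  set C2 := (p * CF + CS + (p + 1) * (6 * M * C1)) / m with hC2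
  have hC20 : 0 ≤ C2 := by positivity
  refine ⟨4 * M' * C2 + 6 * M * C1 + CF, by positivity, ?_⟩
  intro X S Bt E G00 G01 G02 G03 G10 G11 G12 G20 G21 G30 hE g00 g01 g02 g03 g10 g11 g12 g20 g21 g30 hf1 hf2 hs hb1 hb2 hq1 hq2 hst
  have hDis : G10 + G11 + G12 + G20 + G21 + G30 ≤ C1 * E := by
    rw [hC1, div_mul_eq_mul_div, le_div_iff₀ hm]
    have a1 := mul_le_mul_of_nonneg_right hm1 g10
    have a2 := mul_le_mul_of_nonneg_right hm2 g11
    have a3 := mul_le_mul_of_nonneg_right hm4 g12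
    have a4 := mul_le_mul_of_nonneg_right hm3 g20
    have a5 := mul_le_mul_of_nonneg_right hm4 g21
    have a6 := mul_le_mul_of_nonneg_right hm4 g30
    have b1 := mul_nonneg q3.le g12
    have b2 := mul_nonneg q3.le g21
    have b3 := mul_nonneg q3.le g30
    linarith
  set Dd := C1 * E with hDd
  have lb : ∀ a g : ℝ, |a| ≤ M → 0 ≤ g → g ≤ Dd → a * g ≤ M * Dd := fun a g h1 h2 h3 =>
    lin_bound h2 h3 h1
  have l10 : G10 ≤ Dd := by linarith
  have l11 : G11 ≤ Dd := by linarith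
  have l12 : G12 ≤ Dd := by linarith
  have l20 : G20 ≤ Dd := by linarith
  have l21 : G21 ≤ Dd := by linarith
  have l30 : G30 ≤ Dd := by linarith
  have hDn : 0 ≤ Dd := by positivity
  -- bounds for the dissipative terms with parameter `α` and `0`
  have up : ∀ a g : ℝ, |a| ≤ M → 0 ≤ g → g ≤ Dd → -(M * Dd) ≤ a * g := fun a g h1 h2 h3 => by
    have := lin_bound h2 h3 (by rwa [abs_neg] : |(-a)| ≤ M)
    linarith
  have u1 := lb _ G10 (show |15*α^4 - 6*α^2*(8+3*m2) + 16 + 3*m2^2| ≤ M by linarith) g10 l10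
  have u2 := lb _ G11 (show |-18*α^2 + 6*m2| ≤ M by linarith) g11 l11
  have u3 := up _ G20 (show |15*α^2 - 8 - 3*m2| ≤ M by linarith) g20 l20
  have v1' := up _ G10 (show |15*α^4 - 6*α^2*(8+3*m2) + 16 + 3*m2^2| ≤ M by linarith) g10 l10
  have v2' := up _ G11 (show |-18*α^2 + 6*m2| ≤ M by linarith) g11 l11
  have v3' := lb _ G20 (show |15*α^2 - 8 - 3*m2| ≤ M by linarith) g20 l20
  have v1 := lb _ G10 (show |15*(0:ℝ)^4 - 6*0^2*(8+3*m2) + 16 + 3*m2^2| ≤ M by linarith) g10 l10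
  have v2 := lb _ G11 (show |-18*(0:ℝ)^2 + 6*m2| ≤ M by linarith) g11 l11
  have v3 := up _ G20 (show |15*(0:ℝ)^2 - 8 - 3*m2| ≤ M by linarith) g20 l20
  have h3a : (3:ℝ) * G12 ≤ M * Dd := lb 3 G12 (by rw [abs_of_pos (by norm_num)]; linarith) g12 l12
  have h3b : (3:ℝ) * G21 ≤ M * Dd := lb 3 G21 (by rw [abs_of_pos (by norm_num)]; linarith) g21 l21
  have h3c : (1:ℝ) * G30 ≤ M * Dd := lb 1 G30 (by rw [abs_of_pos (by norm_num)]; linarith) g30 l30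
  have hMD : 0 ≤ M * Dd := by positivity
  set Fa := (α^6 - α^4*(8+3*m2) + α^2*(16+3*m2^2) - m2*(m2-4)^2) * G00
    + (-3*α^4 + 6*α^2*m2 - (m2-4)*(3*m2-4)) * G01 + (3*α^2 - (3*m2-8)) * G02 - G03 with hFa
  have X1 : -Fa - 6 * M * Dd - CF * E ≤ X := by
    linarith
  have X2 : X ≤ -Fa + 6 * M * Dd + CF * E := by
    linarith
  have Y1 : p * X ≤ m2*(m2-4)^2 * G00 + (m2-4)*(3*m2-4) * G01 + (3*m2-8) * G02 + G03
      + 6 * M * Dd + CS * E := by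
    refine hst.trans ?_
    linarith
  have hSum : G00 + G01 + G02 + G03 ≤ C2 * E := by
    rw [hC2, div_mul_eq_mul_div, le_div_iff₀ hm]
    have a1 := mul_le_mul_of_nonneg_right hm5 g00
    have a2 := mul_le_mul_of_nonneg_right hm6 g01
    have a3 := mul_le_mul_of_nonneg_right hm7 g02
    have a4 := mul_le_mul_of_nonneg_right hm8 g03
    have a5 := mul_le_mul_of_nonneg_left X1 (by linarith : (0:ℝ) ≤ p)
    have a6 := a5.trans Y1
    rw [hFa] at a6
    rw [hDd] at a6
    linarith
  have w1 := lin_bound g00 (by linarith : G00 ≤ C2 * E)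
    (show |-(α^6 - α^4*(8+3*m2) + α^2*(16+3*m2^2) - m2*(m2-4)^2)| ≤ M' by rw [abs_neg]; linarith)
  have w2 := lin_bound g01 (by linarith : G01 ≤ C2 * E)
    (show |-(-3*α^4 + 6*α^2*m2 - (m2-4)*(3*m2-4))| ≤ M' by rw [abs_neg]; linarith)
  have w3 := lin_bound g02 (by linarith : G02 ≤ C2 * E)
    (show |-(3*α^2 - (3*m2-8))| ≤ M' by rw [abs_neg]; linarith)
  have w4 := lin_bound g03 (by linarith : G03 ≤ C2 * E)
    (show |(1:ℝ)| ≤ M' by rw [abs_one]; linarith)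
  have fin : (4 * M' * C2 + 6 * M * C1 + CF) * E = 4 * (M' * (C2 * E)) + 6 * M * Dd + CF * E := by
    rw [hDd]; ring
  rw [fin]
  refine X2.trans ?_
  rw [hFa]
  linarith

variable (c) in
lemma star (K α m2 p : ℝ) (hp : 1 < p) (hα : α = 0 ∨ Coef α m2 p) :
    ∃ C : ℝ, 0 ≤ C ∧ ∀ d : c.WD K, d.f = - c.PP α m2 d.w →
      (∀ x, c.ev x (c.D (d.w * d.f)) = (p+1) * c.ev x (d.f * c.D d.w)) →
      p * c.I (d.η ^ 2 * (d.w * d.f)) ≤ c.SS m2 (d.η * d.w) →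
      c.I (d.η ^ 2 * (d.w * d.f)) ≤ C * d.E := by
  obtain ⟨CF, hCF, hF⟩ := OE_F (c := c) (K := K) α m2
  obtain ⟨CS, hCS, hS⟩ := OE_SS (c := c) (K := K) m2
  obtain ⟨CB, hCB, hB⟩ := OE_B (c := c) (K := K) α m2
  have hp0 : 0 < p - 1 := by linarith
  have hX : ∀ d : c.WD K, d.f = - c.PP α m2 d.w →
      c.I (d.η ^ 2 * (d.w * d.f)) = - c.I (d.η ^ 2 * d.w * c.PP α m2 d.w) := by
    intro d hd
    rw [hd, ← map_neg]; congr 1; ring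
  rcases hα with rfl | hα
  · refine ⟨(CS + CF) / (p - 1), by positivity, fun d hd _ hst => ?_⟩
    have h1 := abs_le.mp (hF d)
    have h2 := abs_le.mp (hS d)
    rw [div_mul_eq_mul_div, le_div_iff₀ hp0]
    have h3 := hX d hd
    nlinarith [d.E_nonneg]
  · obtain ⟨C, hC0, hC⟩ := starArith α m2 p CF CS CB |K| hp hα hCF hCS hCB (abs_nonneg K)
    refine ⟨C, hC0, fun d hd hDx hst => ?_⟩
    have nn : ∀ (b : c.Form) (g : A), 0 ≤ c.I (d.η ^ 2 * b.b g g) := fun b g => b.N_nonneg d.win.cs g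
    have hf := abs_le.mp (hF d)
    have hs := abs_le.mp (hS d)
    have hb := abs_le.mp (hB d)
    have hx := hX d hd
    have hq := abs_le.mp (pohBound α m2 p hp d hd hDx)
    have hx' : c.I (d.η ^ 2 * d.w * c.PP α m2 d.w) = - c.I (d.η ^ 2 * (d.w * d.f)) := by linarith
    simp only [WD.FM] at hf hs
    rw [hx'] at hf
    simp only [WD.BM] at hb
    exact hC _ _ _ _ _ _ _ _ _ _ _ _ _ _ d.E_nonneg
      (nn c.beta0 d.w) (nn c.beta1 d.w) (nn c.beta2 d.w) (nn c.beta3 d.w)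
      (nn c.beta0 (c.D d.w)) (nn c.beta1 (c.D d.w)) (nn c.beta2 (c.D d.w))
      (nn c.beta0 (c.D (c.D d.w))) (nn c.beta1 (c.D (c.D d.w))) (nn c.beta0 (c.D (c.D (c.D d.w))))
      hf.1 hf.2 hs.2 hb.1 hb.2 hq.1 hq.2 hst
end Cyl

/-- one-dimensional plateau function: `1` on `[a,b]`, `0` off `(a-1,b+1)` -/
def cutG (τ : ℝ → ℝ) (a b s : ℝ) : ℝ := τ (s - (a - 1)) * τ (b + 1 - s)

structure Step (τ : ℝ → ℝ) : Prop where
  sm : ContDiff ℝ (⊤ : ℕ∞) τ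
  z : ∀ x ≤ 0, τ x = 0
  o : ∀ x, 1 ≤ x → τ x = 1

lemma Step.bound {τ : ℝ → ℝ} (h : Step τ) (i : ℕ) (hi : 1 ≤ i) :
    ∃ K, 0 ≤ K ∧ ∀ x, |iteratedDeriv i τ x| ≤ K ∧ (x < 0 ∨ 1 < x → iteratedDeriv i τ x = 0) := by
  have hc : Continuous (iteratedDeriv i τ) := h.sm.continuous_iteratedDeriv i (by exact_mod_cast le_top)
  have hz : ∀ x, (x < 0 ∨ 1 < x) → iteratedDeriv i τ x = 0 := by
    rintro x (hx | hx)
    · have : τ =ᶠ[nhds x] fun _ => (0:ℝ) := by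
        filter_upwards [Iio_mem_nhds hx] with y hy using h.z y (le_of_lt hy)
      rw [this.iteratedDeriv_eq, iteratedDeriv_const]; simp
    · have : τ =ᶠ[nhds x] fun _ => (1:ℝ) := by
        filter_upwards [Ioi_mem_nhds hx] with y hy using h.o y (le_of_lt hy)
      rw [this.iteratedDeriv_eq, iteratedDeriv_const]
      rw [if_neg (by omega)]
  obtain ⟨K, hK⟩ := isCompact_Icc.exists_bound_of_continuousOn (s := Set.Icc (0:ℝ) 1) hc.continuousOn
  refine ⟨|K|, abs_nonneg _, fun x => ⟨?_, hz x⟩⟩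
  by_cases hx : x ∈ Set.Icc (0:ℝ) 1
  · exact (hK x hx).trans (le_abs_self K)
  · rw [hz x]
    · simp
    · by_contra hh
      push Not at hh
      exact hx hh

lemma Step.cut_smooth {τ : ℝ → ℝ} (h : Step τ) (a b : ℝ) : ContDiff ℝ (⊤ : ℕ∞) (cutG τ a b) := by
  unfold cutG
  exact (h.sm.comp (contDiff_id.sub contDiff_const)).mul (h.sm.comp (contDiff_const.sub contDiff_id))

lemma Step.cut_bound {τ : ℝ → ℝ} (h : Step τ) (i : ℕ) (hi : 1 ≤ i) :
    ∃ K, 0 ≤ K ∧ ∀ a b, a < b → ∀ s, |iteratedDeriv i (cutG τ a b) s| ≤ K ∧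
      (¬ (s ∈ Set.Icc (a-1) a ∨ s ∈ Set.Icc b (b+1)) → iteratedDeriv i (cutG τ a b) s = 0) := by
  obtain ⟨K, hK0, hK⟩ := h.bound i hi
  refine ⟨K, hK0, fun a b hab s => ?_⟩
  rcases lt_or_ge s b with hs | hs
  · have : cutG τ a b =ᶠ[nhds s] fun y => τ (y - (a - 1)) := by
      filter_upwards [Iio_mem_nhds hs] with y hy
      have : y < b := hy
      rw [cutG, h.o (b+1-y) (by linarith), mul_one]
    rw [this.iteratedDeriv_eq, iteratedDeriv_comp_sub_const]
    refine ⟨(hK _).1, fun hh => (hK _).2 ?_⟩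
    by_contra h2
    push Not at h2
    exact hh (Or.inl ⟨by linarith [h2.1], by linarith [h2.2]⟩)
  · have hs' : a < s := hab.trans_le hs
    have : cutG τ a b =ᶠ[nhds s] fun y => τ (b + 1 - y) := by
      filter_upwards [Ioi_mem_nhds hs'] with y hy
      have : a < y := hy
      rw [cutG, h.o (y-(a-1)) (by linarith), one_mul]
    rw [this.iteratedDeriv_eq, iteratedDeriv_comp_const_sub]
    simp only [smul_eq_mul, abs_mul, abs_pow, abs_neg, abs_one, one_pow, one_mul]
    refine ⟨(hK _).1, fun hh => ?_⟩
    rw [(hK _).2, mul_zero]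
    by_contra h2
    push Not at h2
    exact hh (Or.inr ⟨by linarith [h2.2], by linarith [h2.1]⟩)

lemma Step.cut_bound6 {τ : ℝ → ℝ} (h : Step τ) :
    ∃ K, 0 ≤ K ∧ ∀ i, 1 ≤ i → i ≤ 6 → ∀ a b, a < b → ∀ s, |iteratedDeriv i (cutG τ a b) s| ≤ K ∧
      (¬ (s ∈ Set.Icc (a-1) a ∨ s ∈ Set.Icc b (b+1)) → iteratedDeriv i (cutG τ a b) s = 0) := by
  have hb := fun i : ℕ => fun hi : 1 ≤ i => h.cut_bound i hi
  choose! F hF0 hF using hb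
  refine ⟨∑ i ∈ Finset.Icc 1 6, F i, Finset.sum_nonneg fun i hi => hF0 i (Finset.mem_Icc.mp hi).1,
    fun i hi hi6 a b hab s => ⟨((hF i hi a b hab s).1).trans ?_, (hF i hi a b hab s).2⟩⟩
  exact Finset.single_le_sum (f := F) (fun j hj => hF0 j (Finset.mem_Icc.mp hj).1)
    (Finset.mem_Icc.mpr ⟨hi, hi6⟩)

lemma step_one : Step Real.smoothTransition where
  sm := Real.smoothTransition.contDiff
  z _ hx := Real.smoothTransition.zero_of_nonpos hx
  o _ hx := Real.smoothTransition.one_of_one_le hx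

lemma step_two : Step (fun x => Real.smoothTransition x ^ 2) where
  sm := Real.smoothTransition.contDiff.pow 2
  z _ hx := by rw [Real.smoothTransition.zero_of_nonpos hx]; norm_num
  o _ hx := by rw [Real.smoothTransition.one_of_one_le hx]; norm_num

def cut (a b : ℝ) : ℝ → ℝ := cutG Real.smoothTransition a b

lemma cut_smooth (a b : ℝ) : ContDiff ℝ (⊤ : ℕ∞) (cut a b) := step_one.cut_smooth a b

lemma cut_nn (a b s : ℝ) : 0 ≤ cut a b s :=
  mul_nonneg (Real.smoothTransition.nonneg _) (Real.smoothTransition.nonneg _)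

lemma cut_le (a b s : ℝ) : cut a b s ≤ 1 :=
  mul_le_one₀ (Real.smoothTransition.le_one _) (Real.smoothTransition.nonneg _)
    (Real.smoothTransition.le_one _)

lemma cut_one {a b s : ℝ} (h1 : a ≤ s) (h2 : s ≤ b) : cut a b s = 1 := by
  rw [cut, cutG, step_one.o _ (by linarith), step_one.o _ (by linarith), one_mul]

lemma cut_zero {a b s : ℝ} (h : s ≤ a - 1 ∨ b + 1 ≤ s) : cut a b s = 0 := by
  rcases h with h | h
  · rw [cut, cutG, step_one.z (s-(a-1)) (by linarith), zero_mul]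
  · rw [cut, cutG, step_one.z (b+1-s) (by linarith), mul_zero]

/-- a plateau function with a plateau of larger support dominates -/
lemma cut_dom {a b a' b' s : ℝ} (h1 : a' ≤ a - 1) (h2 : b + 1 ≤ b') (N : ℕ) :
    cut a b s ≤ cut a' b' s ^ N := by
  by_cases h : s ≤ a - 1 ∨ b + 1 ≤ s
  · rw [cut_zero h]; exact pow_nonneg (cut_nn _ _ _) _
  · push Not at h
    rw [cut_one (a := a') (b := b') (by linarith) (by linarith), one_pow]
    exact cut_le _ _ _

lemma cut_sq (a b : ℝ) : (fun s => cut a b s ^ 2) = cutG (fun x => Real.smoothTransition x ^ 2) a b := by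
  ext s; simp only [cut, cutG]; ring

def kap (a b s : ℝ) : ℝ := cut (a-1) a s + cut b (b+1) s

lemma kap_smooth (a b : ℝ) : ContDiff ℝ (⊤ : ℕ∞) (kap a b) := (cut_smooth _ _).add (cut_smooth _ _)

lemma kap_nn (a b s : ℝ) : 0 ≤ kap a b s := add_nonneg (cut_nn _ _ _) (cut_nn _ _ _)

lemma kap_ge {a b s : ℝ} (h : s ∈ Set.Icc (a-1) a ∨ s ∈ Set.Icc b (b+1)) : 1 ≤ kap a b s := by
  rcases h with h | h
  · have := cut_one h.1 h.2
    have := cut_nn b (b+1) s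
    rw [kap]; linarith
  · have := cut_one h.1 h.2
    have := cut_nn (a-1) a s
    rw [kap]; linarith

lemma cut_win : ∃ K, 0 ≤ K ∧ ∀ a b, a < b →
    (∀ i l : ℕ, i ≤ 3 → l ≤ 3 → 1 ≤ i + l → ∀ s,
      |iteratedDeriv i (cut a b) s * iteratedDeriv l (cut a b) s| ≤ K * kap a b s) ∧
    (∀ i : ℕ, 1 ≤ i → i ≤ 6 → ∀ s, |iteratedDeriv i (fun s => cut a b s ^ 2) s| ≤ K * kap a b s) ∧
    (∀ i : ℕ, i ≤ 3 → ∀ s, |iteratedDeriv i (cut a b) s| ≤ K) := by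
  obtain ⟨K1, hK1, h1⟩ := step_one.cut_bound6
  obtain ⟨K2, hK2, h2⟩ := step_two.cut_bound6
  have key : ∀ a b, a < b → ∀ i ≤ 3, ∀ s, |iteratedDeriv i (cut a b) s| ≤ K1 + 1 := by
    intro a b hab i hi s
    rcases Nat.eq_zero_or_pos i with rfl | h0
    · rw [iteratedDeriv_zero, abs_of_nonneg (cut_nn _ _ _)]; linarith [cut_le a b s]
    · have : |iteratedDeriv i (cut a b) s| ≤ K1 := (h1 i h0 (by omega) a b hab s).1
      linarith
  have c1 : 0 ≤ (K1+1)^2 := by positivity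
  refine ⟨(K1+1)^2 + K2, by positivity, fun a b hab => ⟨?_, ?_, ?_⟩⟩
  · intro i l hi hl hil s
    by_cases hs : s ∈ Set.Icc (a-1) a ∨ s ∈ Set.Icc b (b+1)
    · have hk := kap_ge hs
      rw [abs_mul]
      have := mul_le_mul (key a b hab i hi s) (key a b hab l hl s) (abs_nonneg _) (by linarith)
      nlinarith
    · have : iteratedDeriv i (cut a b) s * iteratedDeriv l (cut a b) s = 0 := by
        rcases Nat.eq_zero_or_pos i with rfl | h0
        · rw [show iteratedDeriv l (cut a b) s = 0 from (h1 l (by omega) (by omega) a b hab s).2 hs, mul_zero]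
        · rw [show iteratedDeriv i (cut a b) s = 0 from (h1 i (by omega) (by omega) a b hab s).2 hs, zero_mul]
      rw [this, abs_zero]
      have := kap_nn a b s; positivity
  · intro i hi hi6 s
    rw [cut_sq]
    by_cases hs : s ∈ Set.Icc (a-1) a ∨ s ∈ Set.Icc b (b+1)
    · have hk := kap_ge hs
      have := (h2 i hi hi6 a b hab s).1
      nlinarith
    · rw [(h2 i hi hi6 a b hab s).2 hs, abs_zero]
      have := kap_nn a b s; positivity
  · intro i hi s
    have := key a b hab i hi s
    nlinarith

namespace Cyl

variable {A : Type} [CommRing A] [Algebra ℝ A] {P : Type} {c : Cyl A P}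

/-- radial functions on the cylinder -/
structure Tm (c : Cyl A P) where
  t : P → ℝ
  R : (ℝ → ℝ) → A
  sig : ℝ
  sig0 : 0 ≤ sig
  ev_R : ∀ χ, ContDiff ℝ (⊤ : ℕ∞) χ → ∀ x, c.ev x (R χ) = χ (t x)
  D_R : ∀ χ, ContDiff ℝ (⊤ : ℕ∞) χ → c.D (R χ) = R (deriv χ)
  R_rad : ∀ χ, ContDiff ℝ (⊤ : ℕ∞) χ → R χ ∈ c.Rad
  R_CS : ∀ χ, ContDiff ℝ (⊤ : ℕ∞) χ → ∀ a b, (∀ s, s ≤ a ∨ b ≤ s → χ s = 0) → R χ ∈ c.CS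
  R_mul : ∀ χ ψ, ContDiff ℝ (⊤ : ℕ∞) χ → ContDiff ℝ (⊤ : ℕ∞) ψ → R (fun s => χ s * ψ s) = R χ * R ψ
  I_R : ∀ χ, ContDiff ℝ (⊤ : ℕ∞) χ → ∀ a b, a ≤ b → (∀ s, s ≤ a ∨ b ≤ s → χ s = 0) →
    (∀ s, 0 ≤ χ s) → (∀ s, χ s ≤ 1) → c.I (R χ) ≤ sig * (b - a)

variable (T : c.Tm)

lemma iD_smooth {χ : ℝ → ℝ} (h : ContDiff ℝ (⊤ : ℕ∞) χ) (i : ℕ) :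
    ContDiff ℝ (⊤ : ℕ∞) (iteratedDeriv i χ) := by
  induction i with
  | zero => simpa using h
  | succ i ih =>
    rw [iteratedDeriv_succ]
    exact (contDiff_infty_iff_deriv.mp ih).2

lemma Tm.iter (χ : ℝ → ℝ) (h : ContDiff ℝ (⊤ : ℕ∞) χ) (i : ℕ) :
    (⇑c.D)^[i] (T.R χ) = T.R (iteratedDeriv i χ) := by
  induction i with
  | zero => simp
  | succ i ih =>
    rw [Function.iterate_succ_apply', ih, T.D_R _ (iD_smooth h i),
      iteratedDeriv_succ]

lemma Tm.R_pow (χ : ℝ → ℝ) (h : ContDiff ℝ (⊤ : ℕ∞) χ) (N : ℕ) :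
    T.R χ ^ (N+1) = T.R (fun s => χ s ^ (N+1)) := by
  induction N with
  | zero => simp
  | succ N ih =>
    rw [pow_succ, ih, ← T.R_mul _ _ (h.pow _) h]
    rfl

lemma Tm.cut_CS (a b : ℝ) : T.R (cut a b) ∈ c.CS :=
  T.R_CS _ (cut_smooth a b) (a-1) (b+1) fun _ hs => cut_zero hs

lemma Tm.cutD : ∃ K, 0 ≤ K ∧ ∀ a b, a < b →
    c.Cut (T.R (cut a b)) K ∧ c.Win (T.R (cut a b)) (T.R (cut (a-1) a) + T.R (cut b (b+1))) K := by
  obtain ⟨K, hK, h⟩ := cut_win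
  refine ⟨K, hK, fun a b hab => ?_⟩
  obtain ⟨h1, h2, h3⟩ := h a b hab
  have sm := cut_smooth a b
  have hd : ∀ i ≤ 3, ∀ x, |c.ev x ((⇑c.D)^[i] (T.R (cut a b)))| ≤ K := fun i hi x => by
    rw [T.iter _ sm, T.ev_R _ (iD_smooth sm i)]; exact h3 i hi _
  refine ⟨⟨T.R_rad _ sm, T.cut_CS a b, fun x => ?_, fun x => ?_, hd 1 (by norm_num), hd 2 (by norm_num),
    hd 3 le_rfl⟩, ⟨T.R_rad _ sm, T.cut_CS a b, c.CS.add_mem (T.cut_CS _ _) (T.cut_CS _ _), fun x => ?_, hK,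
    fun i l hi hl hil x => ?_, fun i hi hi6 x => ?_⟩⟩
  · rw [T.ev_R _ sm]; exact cut_nn _ _ _
  · rw [T.ev_R _ sm]; exact cut_le _ _ _
  · rw [map_add, T.ev_R _ (cut_smooth _ _), T.ev_R _ (cut_smooth _ _)]
    exact kap_nn _ _ _
  · rw [T.iter _ sm, T.iter _ sm, map_mul, map_add, T.ev_R _ (iD_smooth sm i), T.ev_R _ (iD_smooth sm l),
      T.ev_R _ (cut_smooth _ _), T.ev_R _ (cut_smooth _ _)]
    exact h1 i l hi hl hil _
  · rw [T.R_pow _ sm 1, T.iter _ (sm.pow 2), map_add, T.ev_R _ (iD_smooth (sm.pow 2) i),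
      T.ev_R _ (cut_smooth _ _), T.ev_R _ (cut_smooth _ _)]
    exact h2 i hi hi6 _

/-- solution data on the cylinder -/
structure Sol (c : Cyl A P) (α m2 p : ℝ) (w f : A) : Prop where
  eq : f = - c.PP α m2 w
  pow : ∀ x, c.ev x (w * f) = |c.ev x w| ^ (p + 1)
  Dx : ∀ x, c.ev x (c.D (w * f)) = (p+1) * c.ev x (f * c.D w)

lemma Sol.nn {α m2 p : ℝ} {w f : A} (h : c.Sol α m2 p w f) (x : P) : 0 ≤ c.ev x (w * f) := by
  rw [h.pow]; exact Real.rpow_nonneg (abs_nonneg _) _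

/-- stability for radial modulations supported in `[a,b]` -/
def Tm.Stab (m2 p : ℝ) (w f : A) (a b : ℝ) : Prop :=
  ∀ χ, ContDiff ℝ (⊤ : ℕ∞) χ → (∀ s, s ≤ a ∨ b ≤ s → χ s = 0) →
    p * c.I (T.R χ ^ 2 * (w * f)) ≤ c.SS m2 (T.R χ * w)

lemma Tm.Stab.mono {m2 p : ℝ} {w f : A} {a b a' b' : ℝ} (h : T.Stab m2 p w f a b) (ha : a ≤ a')
    (hb : b' ≤ b) : T.Stab m2 p w f a' b' := fun χ hχ hs => h χ hχ fun s hh =>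
  hs s (hh.imp (fun h => h.trans ha) (fun h => hb.trans h))

lemma En_add (κ κ' w f : A) : c.En (κ + κ') w f = c.En κ w f + c.En κ' w f := by
  simp only [En, add_mul, map_add]; ring

lemma En_mono {κ κ' w f : A} (hk : κ ∈ c.CS) (hk' : κ' ∈ c.CS) (h : ∀ x, c.ev x κ ≤ c.ev x κ')
    (hn : ∀ x, 0 ≤ c.ev x (w * f)) : c.En κ w f ≤ c.En κ' w f := by
  have key : ∀ g : A, (∀ x, 0 ≤ c.ev x g) → c.I (κ * g) ≤ c.I (κ' * g) := fun g hg =>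
    I_mono (c.CS.mul_mem_right _ hk) (c.CS.mul_mem_right _ hk') fun x => by
      rw [map_mul, map_mul]; exact mul_le_mul_of_nonneg_right (h x) (hg x)
  have kb : ∀ (b : c.Form) (g : A), c.I (κ * b.b g g) ≤ c.I (κ' * b.b g g) := fun b g =>
    key _ fun x => b.nonneg x g
  unfold En
  have a1 := kb c.beta0 w
  have a2 := kb c.beta0 (c.D w)
  have a3 := kb c.beta0 (c.D (c.D w))
  have a4 := kb c.beta0 (c.D (c.D (c.D w)))
  have a5 := kb c.beta1 w
  have a6 := kb c.beta1 (c.D w)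
  have a7 := kb c.beta1 (c.D (c.D w))
  have a8 := kb c.beta2 w
  have a9 := kb c.beta2 (c.D w)
  have a10 := kb c.beta3 w
  have a11 := key _ hn
  linarith

lemma pow_ev_mono {ξ : A} {C0 : ℝ} (h : c.Cut ξ C0) (x : P) {N M : ℕ} (hNM : N ≤ M) :
    c.ev x (ξ ^ M) ≤ c.ev x (ξ ^ N) := by
  rw [map_pow, map_pow]
  exact pow_le_pow_of_le_one (h.nn x) (h.le1 x) hNM

lemma En_le {ξ : A} {C0 : ℝ} (h : c.Cut ξ C0) (k : ℕ) (w f : A) :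
    c.En (ξ ^ (2*k+8)) w f ≤ c.Top ξ k w + c.Low ξ k w + c.I (ξ ^ (2*k+8) * (w * f)) := by
  have kb : ∀ (b : c.Form) (g : A) (j : ℕ), j ≤ 3 → c.I (ξ ^ (2*k+8) * b.b g g) ≤ b.N (ξ ^ (k+1+j)) g := by
    intro b g j hj
    rw [Form.N, ← pow_mul]
    refine I_mono (c.CS.mul_mem_right _ (pow_CS h.cs (by omega)))
      (c.CS.mul_mem_right _ (pow_CS h.cs (by omega))) fun x => ?_
    rw [map_mul, map_mul]
    exact mul_le_mul_of_nonneg_right (pow_ev_mono h x (by omega)) (b.nonneg x g)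
  have a1 := kb c.beta0 w 0 (by norm_num)
  have a2 := kb c.beta0 (c.D w) 1 (by norm_num)
  have a3 := kb c.beta0 (c.D (c.D w)) 2 (by norm_num)
  have a4 := kb c.beta0 (c.D (c.D (c.D w))) 3 (by norm_num)
  have a5 := kb c.beta1 w 1 (by norm_num)
  have a6 := kb c.beta1 (c.D w) 2 (by norm_num)
  have a7 := kb c.beta1 (c.D (c.D w)) 3 (by norm_num)
  have a8 := kb c.beta2 w 2 (by norm_num)
  have a9 := kb c.beta2 (c.D w) 3 (by norm_num)
  have a10 := kb c.beta3 w 3 (by norm_num)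
  have n1 := h.N_nn c.beta1 (k+3) (c.D (c.D w))
  have n2 := h.N_nn c.beta2 (k+3) (c.D w)
  unfold En Top Low
  simp only [add_assoc, Nat.reduceAdd] at *
  linarith

lemma young1 {p : ℝ} (hp : 1 < p) (K : ℕ) (hK1 : 1 ≤ K) (hK : 6 / (p - 1) ≤ K) {δ : ℝ} (hδ : 0 < δ) :
    ∃ L : ℝ, 0 ≤ L ∧ ∀ s y : ℝ, 0 ≤ s → s ≤ 1 → 0 ≤ y →
      s ^ (2*K) * y ^ 2 ≤ δ * (s ^ (2*K+6) * y ^ (p+1)) + L := by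
  have hp0 : 0 < p - 1 := by linarith
  set l := (δ⁻¹) ^ (1/(p-1)) with hl
  have hl0 : 0 < l := Real.rpow_pos_of_pos (by positivity) _
  refine ⟨l ^ 2, by positivity, fun s y hs hs1 hy => ?_⟩
  have e1 : s ^ (2*K) * y ^ 2 = (s ^ K * y) ^ 2 := by ring
  have hy1 : 0 ≤ y ^ (p+1) := Real.rpow_nonneg hy _
  rcases le_or_gt (s ^ K * y) l with h | h
  · have : (s ^ K * y) ^ 2 ≤ l ^ 2 := by gcongr
    have : 0 ≤ δ * (s ^ (2*K+6) * y ^ (p+1)) := by positivity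
    linarith
  · have hsK : 0 ≤ s ^ K := by positivity
    have hy0 : 0 < y := by
      rcases hy.lt_or_eq with h' | h'
      · exact h'
      · rw [← h', mul_zero] at h; linarith
    have hs0 : 0 < s := by
      rcases hs.lt_or_eq with h' | h'
      · exact h'
      · rw [← h', zero_pow (by omega), zero_mul] at h; linarith
    have h2 : δ⁻¹ ≤ (s ^ K * y) ^ (p-1) := by
      have : l ^ (p-1) = δ⁻¹ := by
        rw [hl, ← Real.rpow_mul (by positivity), one_div, inv_mul_cancel₀ hp0.ne', Real.rpow_one]
      rw [← this]
      exact Real.rpow_le_rpow hl0.le h.le hp0.le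
    rw [Real.mul_rpow hsK hy, ← Real.rpow_natCast, ← Real.rpow_mul hs] at h2
    have h3 : s ^ ((K:ℝ) * (p-1)) ≤ s ^ (6:ℝ) := by
      refine Real.rpow_le_rpow_of_exponent_ge hs0 hs1 ?_
      rw [div_le_iff₀ hp0] at hK; linarith
    have h4 : s ^ (6:ℝ) = s ^ 6 := by
      rw [show (6:ℝ) = ((6:ℕ):ℝ) by norm_num, Real.rpow_natCast]
    rw [h4] at h3
    have h5 : 1 ≤ δ * (s ^ 6 * y ^ (p-1)) := by
      have hyp : 0 ≤ y ^ (p-1) := Real.rpow_nonneg hy _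
      have : δ⁻¹ ≤ s ^ 6 * y ^ (p-1) := h2.trans (mul_le_mul_of_nonneg_right h3 hyp)
      have := mul_le_mul_of_nonneg_left this hδ.le
      rwa [mul_inv_cancel₀ hδ.ne'] at this
    have h6 : y ^ (p+1) = y ^ 2 * y ^ (p-1) := by
      rw [show p + 1 = 2 + (p-1) by ring, Real.rpow_add hy0, Real.rpow_two]
    have h7 : 0 ≤ s ^ (2*K) * y ^ 2 := by positivity
    calc s ^ (2*K) * y ^ 2 ≤ s ^ (2*K) * y ^ 2 * (δ * (s ^ 6 * y ^ (p-1))) := le_mul_of_one_le_right h7 h5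
      _ = δ * (s ^ (2*K+6) * y ^ (p+1)) := by rw [h6]; ring
      _ ≤ _ := by linarith [sq_nonneg l]

lemma young2 {p : ℝ} (hp : 1 < p) {δ : ℝ} (hδ : 0 < δ) :
    ∃ L : ℝ, 0 ≤ L ∧ ∀ y : ℝ, 0 ≤ y → y ^ 2 ≤ δ + L * y ^ (p+1) := by
  refine ⟨(Real.sqrt δ ^ (p-1))⁻¹, by positivity, fun y hy => ?_⟩
  have hsd := Real.sqrt_pos.mpr hδ
  have hy1 : 0 ≤ y ^ (p+1) := Real.rpow_nonneg hy _
  have hq : 0 < Real.sqrt δ ^ (p-1) := Real.rpow_pos_of_pos hsd _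
  rcases le_or_gt y (Real.sqrt δ) with h | h
  · have : y ^ 2 ≤ Real.sqrt δ ^ 2 := by gcongr
    rw [Real.sq_sqrt hδ.le] at this
    have : 0 ≤ (Real.sqrt δ ^ (p-1))⁻¹ * y ^ (p+1) := by positivity
    linarith
  · have hy0 : 0 < y := hsd.trans h
    have h6 : y ^ (p+1) = y ^ 2 * y ^ (p-1) := by
      rw [show p + 1 = 2 + (p-1) by ring, Real.rpow_add hy0, Real.rpow_two]
    have h2 : Real.sqrt δ ^ (p-1) ≤ y ^ (p-1) := Real.rpow_le_rpow hsd.le h.le (by linarith)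
    have h3 : 1 ≤ (Real.sqrt δ ^ (p-1))⁻¹ * y ^ (p-1) := by
      have := mul_le_mul_of_nonneg_left h2 (inv_nonneg.mpr hq.le)
      rwa [inv_mul_cancel₀ hq.ne'] at this
    have : y ^ 2 ≤ y ^ 2 * ((Real.sqrt δ ^ (p-1))⁻¹ * y ^ (p-1)) :=
      le_mul_of_one_le_right (by positivity) h3
    rw [h6]
    nlinarith

end Cyl

namespace Cyl

variable {A : Type} [CommRing A] [Algebra ℝ A] {P : Type} {c : Cyl A P} (T : c.Tm)

lemma Tm.stepA0 (α m2 p : ℝ) (hp : 1 < p) (k : ℕ) :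
    ∃ C : ℝ, 0 < C ∧ ∀ a b, a < b → ∀ w f, c.Sol α m2 p w f → T.Stab m2 p w f (a-1) (b+1) →
      c.En (T.R (cut a b) ^ (2*k+8)) w f ≤ C * c.I (T.R (cut a b) ^ (2*k+2) * (w * w)) := by
  obtain ⟨K, hK, hcut⟩ := T.cutD
  obtain ⟨C, hC, h⟩ := c.energy1 K hK k α m2 hp
  refine ⟨C, hC, fun a b hab w f hs hst => ?_⟩
  have hc := (hcut a b hab).1
  set ξ := T.R (cut a b) with hξ
  have e0 : -c.I (ξ ^ (2*k+8) * w * c.PP α m2 w) = c.I (ξ ^ (2*k+8) * (w * f)) := by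
    rw [hs.eq, ← map_neg]; congr 1; ring
  have hst' := hst (fun s => cut a b s ^ (k+3+1)) ((cut_smooth a b).pow _) (fun s hh => by
    rw [cut_zero hh, zero_pow (by omega)])
  rw [← T.R_pow _ (cut_smooth a b) (k+3), ← pow_mul, ← hξ] at hst'
  have h1 := h ξ w hc (by
    rw [e0]
    convert hst' using 2
    ring_nf)
  rw [e0] at h1
  refine (En_le hc k w f).trans (h1.trans (le_of_eq ?_))
  rw [Form.N, ← pow_mul, beta0_apply]
  congr 4
  ring

lemma Tm.cut_le_th (a b : ℝ) (N : ℕ) (x : P) :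
    c.ev x (T.R (cut a b) ^ (N+1)) ≤ c.ev x (T.R (cut (a-1) (b+1))) := by
  rw [map_pow, T.ev_R _ (cut_smooth _ _), T.ev_R _ (cut_smooth _ _)]
  have h1 : cut a b (T.t x) ^ (N+1) ≤ cut a b (T.t x) ^ 1 :=
    pow_le_pow_of_le_one (cut_nn _ _ _) (cut_le _ _ _) (by omega)
  have h2 := cut_dom (a := a) (b := b) (a' := a-1) (b' := b+1) (s := T.t x) le_rfl le_rfl 1
  rw [pow_one] at h1 h2
  exact h1.trans h2

lemma Tm.I_th (a b : ℝ) (hab : a < b) : c.I (T.R (cut (a-1) (b+1))) ≤ T.sig * (b - a + 4) := by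
  have := T.I_R _ (cut_smooth (a-1) (b+1)) (a-1-1) (b+1+1) (by linarith) (fun s => cut_zero)
    (cut_nn _ _) (cut_le _ _)
  refine this.trans (le_of_eq ?_)
  ring

lemma exists_k {p : ℝ} : ∃ k : ℕ, 6 / (p-1) ≤ ((k+1:ℕ):ℝ) := by
  obtain ⟨k, hk⟩ := exists_nat_ge (6/(p-1))
  exact ⟨k, hk.trans (by push_cast; linarith)⟩

/-- uniform energy bounds -/
lemma Tm.stepA (α m2 p : ℝ) (hp : 1 < p) (k : ℕ) (hk : 6 / (p-1) ≤ ((k+1:ℕ):ℝ)) :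
    ∃ C : ℝ, 0 ≤ C ∧ ∀ a b, a < b → ∀ w f, c.Sol α m2 p w f → T.Stab m2 p w f (a-1) (b+1) →
      c.En (T.R (cut a b) ^ (2*k+8)) w f ≤ C * (b - a + 4) := by
  obtain ⟨C, hC, h⟩ := T.stepA0 α m2 p hp k
  obtain ⟨K, hK, hcut⟩ := T.cutD
  obtain ⟨L, hL, hy⟩ := young1 hp (k+1) (by omega) hk (δ := (2*C)⁻¹) (by positivity)
  have := T.sig0
  refine ⟨2 * C * L * T.sig, by positivity, fun a b hab w f hs hst => ?_⟩
  have h1 := h a b hab w f hs hst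
  have hc := (hcut a b hab).1
  have hth := T.I_th a b hab
  set ξ := T.R (cut a b) with hξ
  set θ := T.R (cut (a-1) (b+1)) with hθ
  have hθc : θ ∈ c.CS := T.cut_CS _ _
  have hξc : ∀ N, ξ ^ (N+1) ∈ c.CS := fun N => pow_CS hc.cs (by omega)
  have hθx : ∀ x, 0 ≤ c.ev x θ := fun x => by rw [hθ, T.ev_R _ (cut_smooth _ _)]; exact cut_nn _ _ _
  have h2 : c.I (ξ ^ (2*k+2) * (w * w)) ≤ c.I ((2*C)⁻¹ • (ξ ^ (2*k+8) * (w * f)) + L • θ) := by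
    refine I_mono (c.CS.mul_mem_right _ (hξc _)) (c.CS.add_mem (c.CS.smul_of_tower_mem _
      (c.CS.mul_mem_right _ (hξc _))) (c.CS.smul_of_tower_mem _ hθc)) fun x => ?_
    have hsq : c.ev x (w * w) = |c.ev x w| ^ 2 := by rw [map_mul, sq_abs, sq]
    rw [map_add, map_smul, map_smul, map_mul (c.ev x) (ξ ^ _) (w * w), map_mul (c.ev x) (ξ ^ _) (w * f),
      hs.pow, hsq, smul_eq_mul, smul_eq_mul, map_pow, map_pow]
    by_cases hx : c.ev x ξ = 0
    · rw [hx, zero_pow (by omega), zero_pow (by omega)]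
      have := mul_nonneg hL (hθx x)
      simpa using this
    · have hθ1 : c.ev x θ = 1 := by
        rw [hξ, T.ev_R _ (cut_smooth _ _)] at hx
        rw [hθ, T.ev_R _ (cut_smooth _ _)]
        have : ¬ (T.t x ≤ a - 1 ∨ b + 1 ≤ T.t x) := fun hh => hx (cut_zero hh)
        push Not at this
        exact cut_one this.1.le this.2.le
      have := hy (c.ev x ξ) |c.ev x w| (hc.nn x) (hc.le1 x) (abs_nonneg _)
      rw [hθ1, mul_one]
      exact this
  rw [map_add, map_smul, map_smul, smul_eq_mul, smul_eq_mul] at h2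
  have h3 : c.I (ξ ^ (2*k+8) * (w * f)) ≤ c.En (ξ ^ (2*k+8)) w f := by
    have nn : ∀ (b : c.Form) (g : A), 0 ≤ c.I (ξ ^ (2*k+8) * b.b g g) := fun b g =>
      c.I_nonneg _ (c.CS.mul_mem_right _ (hξc _)) fun x => by
        rw [map_mul, map_pow]; exact mul_nonneg (pow_nonneg (hc.nn x) _) (b.nonneg x g)
    have a1 := nn c.beta0 w
    have a2 := nn c.beta0 (c.D w)
    have a3 := nn c.beta0 (c.D (c.D w))
    have a4 := nn c.beta0 (c.D (c.D (c.D w)))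
    have a5 := nn c.beta1 w
    have a6 := nn c.beta1 (c.D w)
    have a7 := nn c.beta1 (c.D (c.D w))
    have a8 := nn c.beta2 w
    have a9 := nn c.beta2 (c.D w)
    have a10 := nn c.beta3 w
    unfold En
    linarith
  have h4 : C * ((2*C)⁻¹ * c.I (ξ ^ (2*k+8) * (w * f))) = c.I (ξ ^ (2*k+8) * (w * f)) / 2 := by
    field_simp
  have h5 := mul_le_mul_of_nonneg_left h2 hC.le
  rw [mul_add, h4] at h5
  have h6 : C * (L * c.I θ) ≤ C * (L * (T.sig * (b - a + 4))) := by gcongr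
  nlinarith

/-- energy on a unit window is bounded -/
lemma Tm.winA (α m2 p : ℝ) (hp : 1 < p) :
    ∃ C : ℝ, 0 ≤ C ∧ ∀ a w f, c.Sol α m2 p w f → T.Stab m2 p w f (a-3) (a+2) →
      c.En (T.R (cut (a-1) a)) w f ≤ C := by
  obtain ⟨k, hk⟩ := exists_k (p := p)
  obtain ⟨C, hC, h⟩ := T.stepA α m2 p hp k hk
  refine ⟨C * 7, by positivity, fun a w f hs hst => ?_⟩
  have h1 := h (a-2) (a+1) (by linarith) w f hs (Tm.Stab.mono T hst (by linarith) (by linarith))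
  refine le_trans (En_mono (T.cut_CS _ _) (pow_CS (T.cut_CS _ _) (by omega)) (fun x => ?_) hs.nn)
    (h1.trans (le_of_eq (by ring)))
  rw [map_pow, T.ev_R _ (cut_smooth _ _), T.ev_R _ (cut_smooth _ _)]
  exact cut_dom (by linarith) (by linarith) _

/-- small energy on a unit window -/
lemma Tm.winS (α m2 p : ℝ) (hp : 1 < p) {δ : ℝ} (hδ : 0 < δ) :
    ∃ L : ℝ, 0 ≤ L ∧ ∀ a w f, c.Sol α m2 p w f → T.Stab m2 p w f (a-3) (a+2) →
      c.En (T.R (cut (a-1) a)) w f ≤ δ + L * c.I (T.R (cut (a-3) (a+2)) * (w * f)) := by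
  obtain ⟨k, hk⟩ := exists_k (p := p)
  obtain ⟨C, hC, h⟩ := T.stepA0 α m2 p hp k
  have hs0 := T.sig0
  obtain ⟨L, hL, hy⟩ := young2 hp (δ := δ / (C * 7 * T.sig + 1)) (by positivity)
  refine ⟨C * L, by positivity, fun a w f hs hst => ?_⟩
  have h1 := h (a-2) (a+1) (by linarith) w f hs (Tm.Stab.mono T hst (by linarith) (by linarith))
  have h0 : c.En (T.R (cut (a-1) a)) w f ≤ c.En (T.R (cut (a-2) (a+1)) ^ (2*k+8)) w f := by
    refine En_mono (T.cut_CS _ _) (pow_CS (T.cut_CS _ _) (by omega)) (fun x => ?_) hs.nn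
    rw [map_pow, T.ev_R _ (cut_smooth _ _), T.ev_R _ (cut_smooth _ _)]
    exact cut_dom (by linarith) (by linarith) _
  have hth := T.I_th (a-2) (a+1) (by linarith)
  have hle := T.cut_le_th (a-2) (a+1) (2*k+1)
  rw [show a - 2 - 1 = a - 3 by ring, show a + 1 + 1 = a + 2 by ring] at hth hle
  set θ := T.R (cut (a-3) (a+2)) with hθ
  have hθc : θ ∈ c.CS := T.cut_CS _ _
  have hθx : ∀ x, 0 ≤ c.ev x θ := fun x => by rw [hθ, T.ev_R _ (cut_smooth _ _)]; exact cut_nn _ _ _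
  have h2 : c.I (T.R (cut (a-2) (a+1)) ^ (2*k+2) * (w * w)) ≤
      c.I ((δ / (C * 7 * T.sig + 1)) • θ + L • (θ * (w * f))) := by
    refine I_mono (c.CS.mul_mem_right _ (pow_CS (T.cut_CS _ _) (by omega))) (c.CS.add_mem
      (c.CS.smul_of_tower_mem _ hθc) (c.CS.smul_of_tower_mem _ (c.CS.mul_mem_right _ hθc))) fun x => ?_
    have hsq : c.ev x (w * w) = |c.ev x w| ^ 2 := by rw [map_mul, sq_abs, sq]
    have hyx := hy |c.ev x w| (abs_nonneg _)
    rw [map_mul (c.ev x) _ (w * w), hsq, map_add, map_smul, map_smul, map_mul (c.ev x) θ (w * f), hs.pow]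
    simp only [smul_eq_mul]
    have q1 := mul_le_mul_of_nonneg_right (hle x) (sq_nonneg |c.ev x w|)
    have q2 := mul_le_mul_of_nonneg_left hyx (hθx x)
    nlinarith
  rw [map_add, map_smul, map_smul, smul_eq_mul, smul_eq_mul] at h2
  have h5 := mul_le_mul_of_nonneg_left h2 hC.le
  have h6 : C * (δ / (C * 7 * T.sig + 1) * c.I θ) ≤ δ := by
    have hpos : 0 < C * 7 * T.sig + 1 := by positivity
    calc C * (δ / (C * 7 * T.sig + 1) * c.I θ) ≤ C * (δ / (C * 7 * T.sig + 1) * (T.sig * (a + 1 - (a - 2) + 4))) := by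
          gcongr
      _ = δ * (C * 7 * T.sig) / (C * 7 * T.sig + 1) := by ring
      _ ≤ δ := by
        rw [div_le_iff₀ hpos]; nlinarith
  nlinarith

/-- the subcritical-side bound -/
theorem Tm.absA (α m2 p : ℝ) (hp : 1 < p) :
    ∃ C : ℝ, 0 ≤ C ∧ ∀ t0 w f, c.Sol α m2 p w f → T.Stab m2 p w f (t0-10) (t0+10) →
      c.I (T.R (cut (t0-2) (t0+2)) * (w * f)) ≤ C := by
  obtain ⟨k, hk⟩ := exists_k (p := p)
  obtain ⟨C, hC, h⟩ := T.stepA α m2 p hp k hk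
  obtain ⟨K, hK, hcut⟩ := T.cutD
  refine ⟨C * 10, by positivity, fun a w f hs hst => ?_⟩
  have h1 := h (a-3) (a+3) (by linarith) w f hs (Tm.Stab.mono T hst (by linarith) (by linarith))
  have hc := (hcut (a-3) (a+3) (by linarith)).1
  set ξ := T.R (cut (a-3) (a+3)) with hξ
  have h2 : c.I (T.R (cut (a-2) (a+2)) * (w * f)) ≤ c.I (ξ ^ (2*k+8) * (w * f)) := by
    refine I_mono (c.CS.mul_mem_right _ (T.cut_CS _ _)) (c.CS.mul_mem_right _ (pow_CS (T.cut_CS _ _) (by omega)))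
      fun x => ?_
    rw [map_mul, map_mul (c.ev x) (ξ ^ _)]
    refine mul_le_mul_of_nonneg_right ?_ (hs.nn x)
    rw [hξ, map_pow, T.ev_R _ (cut_smooth _ _), T.ev_R _ (cut_smooth _ _)]
    exact cut_dom (by linarith) (by linarith) _
  have h3 : c.I (ξ ^ (2*k+8) * (w * f)) ≤ c.En (ξ ^ (2*k+8)) w f := by
    have nn : ∀ (b : c.Form) (g : A), 0 ≤ c.I (ξ ^ (2*k+8) * b.b g g) := fun b g =>
      c.I_nonneg _ (c.CS.mul_mem_right _ (pow_CS (T.cut_CS _ _) (by omega))) fun x => by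
        rw [map_mul, map_pow]; exact mul_nonneg (pow_nonneg (hc.nn x) _) (b.nonneg x g)
    have a1 := nn c.beta0 w
    have a2 := nn c.beta0 (c.D w)
    have a3 := nn c.beta0 (c.D (c.D w))
    have a4 := nn c.beta0 (c.D (c.D (c.D w)))
    have a5 := nn c.beta1 w
    have a6 := nn c.beta1 (c.D w)
    have a7 := nn c.beta1 (c.D (c.D w))
    have a8 := nn c.beta2 w
    have a9 := nn c.beta2 (c.D w)
    have a10 := nn c.beta3 w
    unfold En
    linarith
  refine h2.trans (h3.trans (h1.trans (le_of_eq (by ring))))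

/-- the supercritical-side bound: smallness -/
theorem Tm.absD (α m2 p : ℝ) (hp : 1 < p) (hα : α = 0 ∨ Coef α m2 p) {ε : ℝ} (hε : 0 < ε) :
    ∃ H : ℝ, 0 ≤ H ∧ ∀ t0 w f, c.Sol α m2 p w f → T.Stab m2 p w f (t0-H) (t0+H) →
      c.I (T.R (cut (t0-2) (t0+2)) * (w * f)) ≤ ε := by
  obtain ⟨K, hK, hcut⟩ := T.cutD
  obtain ⟨C, hC, hstar⟩ := c.star K α m2 p hp hα
  obtain ⟨C1, hC1, hA⟩ := T.winA α m2 p hp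
  have hδ : 0 < ε / (4 * (C + 1)) := by positivity
  obtain ⟨L, hL, hS⟩ := T.winS α m2 p hp hδ
  -- basic consequences of `star`
  have hst1 : ∀ a b, a < b → ∀ w f, c.Sol α m2 p w f → T.Stab m2 p w f (a-3) (b+3) →
      c.I (T.R (cut a b) ^ 2 * (w * f)) ≤ C * (c.En (T.R (cut (a-1) a)) w f + c.En (T.R (cut b (b+1))) w f) := by
    intro a b hab w f hs hst
    have := hstar ⟨T.R (cut a b), _, w, f, (hcut a b hab).2, hs.nn⟩ hs.eq hs.Dx
      (hst (cut a b) (cut_smooth a b) fun s hh => cut_zero (hh.imp (fun h => by linarith) (fun h => by linarith)))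
    rw [WD.E, En_add] at this
    exact this
  obtain ⟨N, hN⟩ := exists_nat_gt (8 * C * L * (2 * C * C1) / ε)
  have hN0 : (0:ℝ) < N := lt_of_le_of_lt (by positivity) hN
  refine ⟨10 * (N + 1) + 10 + 3, by positivity, fun t0 w f hs hst => ?_⟩
  set g : ℕ → ℝ := fun j => c.I (T.R (cut (t0 - 10 - 10 * j) (t0 + 10 + 10 * j)) ^ 2 * (w * f)) with hg
  have jle : ∀ j : ℕ, j ≤ N + 1 → (j:ℝ) ≤ N + 1 := fun j hj => by exact_mod_cast hj
  have j0 : ∀ j : ℕ, (0:ℝ) ≤ j := fun j => Nat.cast_nonneg j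
  have gC : ∀ j ≤ N + 1, g j ≤ 2 * C * C1 := by
    intro j hj
    have := jle j hj
    have := j0 j
    refine (hst1 _ _ (by linarith) w f hs (Tm.Stab.mono T hst (by linarith) (by linarith))).trans ?_
    have e1 := hA (t0 - 10 - 10 * j) w f hs (Tm.Stab.mono T hst (by linarith) (by linarith))
    have e2 := hA (t0 + 10 + 10 * j + 1) w f hs (Tm.Stab.mono T hst (by linarith) (by linarith))
    rw [add_sub_cancel_right] at e2
    nlinarith
  have cs2 : ∀ a b, T.R (cut a b) ^ 2 * (w * f) ∈ c.CS := fun a b =>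
    c.CS.mul_mem_right _ (pow_CS (T.cut_CS _ _) (by omega))
  have gmono : ∀ j, g 0 ≤ g j := by
    intro j
    rcases Nat.eq_zero_or_pos j with rfl | hj
    · exact le_rfl
    have hj1 : (1:ℝ) ≤ j := by exact_mod_cast hj
    refine I_mono (cs2 _ _) (cs2 _ _) fun x => ?_
    rw [map_mul (c.ev x) _ (w * f), map_mul (c.ev x) _ (w * f)]
    refine mul_le_mul_of_nonneg_right ?_ (hs.nn x)
    rw [map_pow, map_pow, T.ev_R _ (cut_smooth _ _), T.ev_R _ (cut_smooth _ _)]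
    refine pow_le_pow_left₀ (cut_nn _ _ _) ?_ _
    have := cut_dom (a := t0 - 10 - 10 * ((0:ℕ):ℝ)) (b := t0 + 10 + 10 * ((0:ℕ):ℝ))
      (a' := t0 - 10 - 10 * (j:ℝ)) (b' := t0 + 10 + 10 * (j:ℝ)) (s := T.t x)
      (by push_cast; linarith) (by push_cast; linarith) 1
    rwa [pow_one] at this
  have g0 : ∀ j, 0 ≤ g j := fun j => c.I_nonneg _ (cs2 _ _) fun x => by
    rw [map_mul, map_pow]; exact mul_nonneg (sq_nonneg _) (hs.nn x)
  have grec : ∀ j, j + 1 ≤ N → g (j+1) ≤ ε / 2 + C * L * (g (j+2) - g j) := by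
    intro j hj
    have j1 := jle (j+1) (by omega)
    have j2 := jle (j+2) (by omega)
    have j3 := j0 j
    push_cast at j1 j2
    have q := hst1 (t0 - 10 - 10 * ((j+1:ℕ):ℝ)) (t0 + 10 + 10 * ((j+1:ℕ):ℝ)) (by push_cast; linarith) w f hs
      (Tm.Stab.mono T hst (by push_cast; linarith) (by push_cast; linarith))
    have e1 := hS (t0 - 10 - 10 * ((j+1:ℕ):ℝ)) w f hs
      (Tm.Stab.mono T hst (by push_cast; linarith) (by push_cast; linarith))
    have e2 := hS (t0 + 10 + 10 * ((j+1:ℕ):ℝ) + 1) w f hs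
      (Tm.Stab.mono T hst (by push_cast; linarith) (by push_cast; linarith))
    rw [add_sub_cancel_right] at e2
    have e3 : c.I (T.R (cut (t0 - 10 - 10 * ((j+1:ℕ):ℝ) - 3) (t0 - 10 - 10 * ((j+1:ℕ):ℝ) + 2)) * (w * f))
        + c.I (T.R (cut (t0 + 10 + 10 * ((j+1:ℕ):ℝ) + 1 - 3) (t0 + 10 + 10 * ((j+1:ℕ):ℝ) + 1 + 2)) * (w * f))
        + g j ≤ g (j+2) := by
      rw [← map_add, hg, ← map_add]
      refine I_mono (c.CS.add_mem (c.CS.add_mem (c.CS.mul_mem_right _ (T.cut_CS _ _))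
        (c.CS.mul_mem_right _ (T.cut_CS _ _))) (cs2 _ _)) (cs2 _ _) fun x => ?_
      rw [map_add, map_add, map_mul, map_mul (c.ev x) _ (w * f), map_mul (c.ev x) _ (w * f),
        map_mul (c.ev x) _ (w * f), ← add_mul, ← add_mul]
      refine mul_le_mul_of_nonneg_right ?_ (hs.nn x)
      rw [map_pow, map_pow, T.ev_R _ (cut_smooth _ _), T.ev_R _ (cut_smooth _ _),
        T.ev_R _ (cut_smooth _ _), T.ev_R _ (cut_smooth _ _)]
      set s := T.t x
      push_cast
      by_cases o1 : s ≤ t0 - 10 - 10 * (j+1) + 3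
      · rw [cut_zero (a := t0 + 10 + 10 * ((j:ℝ)+1) + 1 - 3) (Or.inl (by linarith)),
          cut_zero (a := t0 - 10 - 10 * (j:ℝ)) (Or.inl (by linarith))]
        have := cut_dom (a := t0 - 10 - 10 * ((j:ℝ)+1) - 3) (b := t0 - 10 - 10 * ((j:ℝ)+1) + 2)
          (a' := t0 - 10 - 10 * ((j:ℝ)+2)) (b' := t0 + 10 + 10 * ((j:ℝ)+2)) (s := s)
          (by linarith) (by linarith) 2
        linarith
      · by_cases o2 : t0 + 10 + 10 * (j+1) - 3 ≤ s
        · rw [cut_zero (a := t0 - 10 - 10 * ((j:ℝ)+1) - 3) (Or.inr (by linarith)),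
            cut_zero (a := t0 - 10 - 10 * (j:ℝ)) (Or.inr (by linarith))]
          have := cut_dom (a := t0 + 10 + 10 * ((j:ℝ)+1) + 1 - 3) (b := t0 + 10 + 10 * ((j:ℝ)+1) + 1 + 2)
            (a' := t0 - 10 - 10 * ((j:ℝ)+2)) (b' := t0 + 10 + 10 * ((j:ℝ)+2)) (s := s)
            (by linarith) (by linarith) 2
          linarith
        · push Not at o1 o2
          rw [cut_zero (a := t0 - 10 - 10 * ((j:ℝ)+1) - 3) (Or.inr (by linarith)),
            cut_zero (a := t0 + 10 + 10 * ((j:ℝ)+1) + 1 - 3) (Or.inl (by linarith)),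
            cut_one (a := t0 - 10 - 10 * ((j:ℝ)+2)) (by linarith) (by linarith)]
          have h1 := cut_nn (t0 - 10 - 10 * (j:ℝ)) (t0 + 10 + 10 * (j:ℝ)) s
          have h2 := cut_le (t0 - 10 - 10 * (j:ℝ)) (t0 + 10 + 10 * (j:ℝ)) s
          nlinarith
    have e4 : C * (2 * (ε / (4 * (C + 1)))) ≤ ε / 2 := by
      have : C * (2 * (ε / (4 * (C + 1)))) = (ε / 2) * (C / (C + 1)) := by field_simp; ring
      rw [this]
      refine mul_le_of_le_one_right (by positivity) ?_
      rw [div_le_one (by positivity)]; linarith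
    have e5 : g (j+1) ≤ C * (2 * (ε / (4 * (C + 1))) + L * (g (j+2) - g j)) := by
      refine q.trans (mul_le_mul_of_nonneg_left ?_ hC)
      have := mul_le_mul_of_nonneg_left e3 hL
      nlinarith
    nlinarith
  have gsum : ∀ j : ℕ, j ≤ N → j * g 0 ≤ j * (ε/2) + C * L * (g (j+1) + g j) := by
    intro j
    induction j with
    | zero => intro _; have := g0 0; have := g0 1; simp only [Nat.cast_zero, zero_mul, zero_add]; positivity
    | succ j ih =>
      intro hj
      have h1 := ih (by omega)
      have h2 := grec j hj
      have h3 := gmono (j+1)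
      push_cast
      nlinarith
  have fin := gsum N le_rfl
  have hCL : 0 ≤ C * L := by positivity
  have f1 := mul_le_mul_of_nonneg_left (add_le_add (gC (N+1) le_rfl) (gC N (by omega))) hCL
  rw [div_lt_iff₀ hε] at hN
  have f2 : g 0 ≤ ε := by
    have : N * g 0 ≤ N * ε := by nlinarith
    exact le_of_mul_le_mul_left this hN0
  refine le_trans ?_ f2
  refine I_mono (c.CS.mul_mem_right _ (T.cut_CS _ _)) (cs2 _ _) fun x => ?_
  rw [map_mul (c.ev x) _ (w * f), map_mul (c.ev x) _ (w * f)]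
  refine mul_le_mul_of_nonneg_right ?_ (hs.nn x)
  rw [map_pow, T.ev_R _ (cut_smooth _ _), T.ev_R _ (cut_smooth _ _)]
  exact cut_dom (by push_cast; linarith) (by push_cast; linarith) 2

end Cyl

/-- the Joseph–Lundgren polynomial -/
def GG (n Y : ℝ) : ℝ :=
  ((n-4)^2/4 - Y) * (n^2/4 - Y) * ((n+4)^2/4 - Y) - ((n-2)*(n+2)*(n-6)/8)^2

lemma dd_id (n : ℝ) : dd1 n ^ 2 - 1296 * dd2 n = (1024 + 768 * n^2)^3 := by
  unfold dd1 dd2; ring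

lemma dd1_neg {n : ℝ} (hn : 15 ≤ n) : dd1 n < 0 := by
  obtain ⟨t, ht, rfl⟩ : ∃ t : ℝ, 0 ≤ t ∧ n = 15 + t := ⟨n - 15, by linarith, by ring⟩
  have : -dd1 (15 + t) > 0 := by
    unfold dd1; ring_nf; positivity
  linarith

lemma dd2_pos {n : ℝ} (hn : 15 ≤ n) : 0 < dd2 n := by
  obtain ⟨t, ht, rfl⟩ : ∃ t : ℝ, 0 ≤ t ∧ n = 15 + t := ⟨n - 15, by linarith, by ring⟩
  unfold dd2; ring_nf; positivity

lemma GG_pos_of_lt {n e : ℝ} (hn : 15 ≤ n) (he : 0 ≤ e) (hed : e < dfn n) : 0 < GG n (e^2) := by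
  set q := -(dd1 n + 36 * Real.sqrt (dd2 n)) with hq
  set q' := -dd1 n + 36 * Real.sqrt (dd2 n) with hq'
  have hs := Real.sq_sqrt (dd2_pos hn).le
  have hs0 := Real.sqrt_nonneg (dd2 n)
  have hqq : q * q' = (1024 + 768 * n^2)^3 := by
    rw [← dd_id, hq, hq']; linear_combination (-1296) * hs
  have h1 := dd1_neg hn
  have hq'0 : 0 < q' := by linarith
  have hqq0 : 0 < q * q' := by rw [hqq]; positivity
  have hq0 : 0 < q := (pos_iff_pos_of_mul_pos hqq0).mpr hq'0
  set d0 := dd0 n with hd0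
  have hd03 : d0 ^ 3 = q := by
    rw [hd0, dd0, ← Real.rpow_natCast, ← Real.rpow_mul hq0.le]; norm_num
  have hd0p : 0 < d0 := by rw [hd0, dd0]; exact Real.rpow_pos_of_pos hq0 _
  have hd : e^2 < (1/36) * (9*n^2 + 96 - (1536 + 1152*n^2) / d0 - (3/2) * d0) := by
    rw [dfn] at hed
    have hpos : 0 < Real.sqrt (9*n^2 + 96 - (1536 + 1152*n^2) / d0 - (3/2) * d0) := by linarith
    have := Real.sqrt_pos.mp hpos
    have h2 := Real.sq_sqrt this.le
    rw [← h2]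
    nlinarith
  set A := d0 / 24 with hA
  set B := (128 + 96 * n^2) / (3 * d0) with hB
  have hA0 : 0 < A := by positivity
  have hB0 : 0 < B := by positivity
  have hAB : A * B = (16 + 12 * n^2)/9 := by rw [hA, hB]; field_simp; ring
  have hA3 : A ^ 3 = q / 13824 := by rw [hA, div_pow, hd03]; norm_num
  have hB3 : B ^ 3 = q' / 13824 := by
    have : A ^ 3 * B ^ 3 = A^3 * (q' / 13824) := by
      rw [← mul_pow, hAB, hA3]
      rw [show q / 13824 * (q' / 13824) = q * q' / 13824^2 by ring, hqq]
      ring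
    exact mul_left_cancel₀ (by positivity) this
  have hdAB : (1/36) * (9*n^2 + 96 - (1536 + 1152*n^2) / d0 - (3/2) * d0) = n^2/4 + 8/3 - A - B := by
    rw [hA, hB]; field_simp; ring
  rw [hdAB] at hd
  set x := e^2 - (n^2/4 + 8/3) with hx
  have hsum : A^3 + B^3 = -dd1 n / 6912 := by rw [hA3, hB3, hq, hq']; ring
  have key : GG n (e^2) = -(x + A + B) * (((x-A)^2 + (x-B)^2 + (A-B)^2)/2) := by
    have e1 : -(x + A + B) * (((x-A)^2 + (x-B)^2 + (A-B)^2)/2) = -(x^3 + (A^3+B^3) - 3*(A*B)*x) := by ring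
    rw [e1, hsum, hAB, show e^2 = x + (n^2/4+8/3) by rw [hx]; ring]
    unfold GG dd1; ring
  rw [key]
  refine mul_pos (by linarith) ?_
  have : 0 < (x - A)^2 := by
    have : x - A < 0 := by linarith
    nlinarith
  have := sq_nonneg (x - B)
  have := sq_nonneg (A - B)
  linarith

lemma GG_anti {n Y Y1 : ℝ} (hn : 6 < n) (h : Y ≤ Y1) (h1 : Y1 ≤ (n-4)^2/4) : GG n Y1 ≤ GG n Y := by
  unfold GG
  have a2 : Y1 ≤ n^2/4 := by nlinarith
  have a3 : Y1 ≤ (n+4)^2/4 := by nlinarith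
  refine sub_le_sub_right ?_ _
  exact mul_le_mul (mul_le_mul (by linarith) (by linarith) (by linarith) (by linarith)) (by linarith)
    (by linarith) (mul_nonneg (by linarith) (by linarith))

lemma GG_one {n : ℝ} (hn : 6 < n) : 0 < GG n 1 := by
  have : GG n 1 = 12 * ((n-2)^2*(n+2)^2*(n-6)) / 64 := by unfold GG; ring
  rw [this]
  have : 0 < n - 6 := by linarith
  have : 0 < n - 2 := by linarith
  positivity

lemma GG_pos (n : ℕ) (p : ℝ) (hp : 1 < p) (hpc : 15 ≤ n → p < pc n) (e : ℝ)
    (he : e = ((n:ℝ) - 8)/2 - 6/(p-1)) (he1 : -1 < e) : 0 < GG n (e^2) := by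
  have hp0 : 0 < p - 1 := by linarith
  have hk : 0 < 6/(p-1) := by positivity
  have hn6 : (6:ℝ) < n := by linarith
  by_cases h1 : e ≤ 1
  · refine (GG_one hn6).trans_le (GG_anti hn6 (by nlinarith) ?_)
    nlinarith
  push Not at h1
  by_cases hn : 15 ≤ n
  · have hn' : (15:ℝ) ≤ n := by exact_mod_cast hn
    refine GG_pos_of_lt hn' (by linarith) ?_
    have h2 := hpc hn
    rw [pc] at h2
    have hx : 0 < (n:ℝ) - 8 - 2 * dfn n := by
      by_contra hx
      push Not at hx
      have : ((n:ℝ) + 4 - 2 * dfn n) / (n - 8 - 2 * dfn n) ≤ 1 := by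
        rcases hx.lt_or_eq with h | h
        · rw [div_le_one_of_neg h]; linarith
        · rw [h, div_zero]; norm_num
      linarith
    rw [lt_div_iff₀ hx] at h2
    have h3 : (p - 1) * (n - 8 - 2 * dfn n) < 12 := by linarith
    have h4 : (p - 1) * (n - 8 - 2 * e) = 12 := by
      rw [he]; field_simp; ring
    by_contra hh
    push Not at hh
    nlinarith
  · have hn14 : n ≤ 14 := by omega
    have h2 : e < ((n:ℝ) - 8)/2 := by linarith
    have h3 : e^2 ≤ (((n:ℝ)-8)/2)^2 := by nlinarith
    refine lt_of_lt_of_le ?_ (GG_anti hn6 h3 (by nlinarith))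
    have hn7 : 7 ≤ n := by
      have : 6 < n := by exact_mod_cast hn6
      omega
    clear hpc h1 h2 h3 he he1
    interval_cases n <;> norm_num [GG]

lemma JL2 {m α : ℝ} (hm : 13/2 ≤ m) (h0 : 0 < α) (h1 : α < m - 2) (h : 8 + 3*m^2 - 5*α^2 ≤ 0) :
    ((m+3)^2 - (α-1)^2) * ((m-1)^2 - (α-1)^2) * ((m+1)^2 - (α-1)^2) ≤ m^2*(m^2-4)^2 := by
  have ha : 77/100 * m ≤ α := by nlinarith
  have hY : (77/100*m - 1)^2 ≤ (α-1)^2 := by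
    apply pow_le_pow_left₀ <;> linarith
  have hY2 : (α-1)^2 ≤ (m-3)^2 := by nlinarith
  have f2 : 0 ≤ (m-1)^2 - (α-1)^2 := by nlinarith
  have f3 : 0 ≤ (m+1)^2 - (α-1)^2 := by nlinarith
  have f1 : 0 ≤ (m+3)^2 - (α-1)^2 := by nlinarith
  have g1 : (m+3)^2 - (α-1)^2 ≤ (m+3)^2 - (77/100*m - 1)^2 := by linarith
  have g2 : (m-1)^2 - (α-1)^2 ≤ (m-1)^2 - (77/100*m - 1)^2 := by linarith
  have g3 : (m+1)^2 - (α-1)^2 ≤ (m+1)^2 - (77/100*m - 1)^2 := by linarith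
  refine (mul_le_mul (mul_le_mul g1 g2 f2 (f1.trans g1)) g3 f3 (mul_nonneg (f1.trans g1) (f2.trans g2))).trans ?_
  obtain ⟨t, ht, rfl⟩ : ∃ t : ℝ, 0 ≤ t ∧ m = 13/2 + t := ⟨m - 13/2, by linarith, by ring⟩
  have : 0 ≤ (13/2+t)^2*((13/2+t)^2-4)^2 - ((13/2+t+3)^2 - (77/100*(13/2+t) - 1)^2) *
    ((13/2+t-1)^2 - (77/100*(13/2+t) - 1)^2) * ((13/2+t+1)^2 - (77/100*(13/2+t) - 1)^2) := by
    ring_nf; positivity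
  linarith

lemma coef_arith {M α p a b c B : ℝ} (hp : 0 < p) (ha : a = M - α^2) (hB : B = M - 4)
    (hbc : b * c = (a-4)^2 - 16*α^2) (hbc2 : b + c = 2*(a-4)) (ha4 : 4 < a) (hbcp : 0 < b * c)
    (hM : 4 < M) (hJ : M*B^2 < p * (a*(b*c))) :
    (M-4)*(3*M-4) < p*(a*(b+c)+b*c) ∧ 3*M-8 < p*(a+(b+c)) := by
  have hα := sq_nonneg α
  have haM : a ≤ M := by linarith
  have hB0 : 0 < B := by linarith
  have haB : a - 4 ≤ B := by linarith
  have hbcB : b*c ≤ B*(a-4) := by nlinarith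
  have hbcB2 : b*c ≤ B^2 := by nlinarith
  have habc : 0 < a*(b*c) := by positivity
  have hs : 0 < b + c := by linarith
  constructor
  · have s1 : a*(b*c)*((M-4)*(3*M-4)) ≤ M*B^2*(a*(b+c)+b*c) := by
      rw [hbc2, ← hB, show 3*M-4 = B + 2*M by rw [hB]; ring]
      have u1 : a*(b*c)*B^2 ≤ M*(b*c)*B^2 := by gcongr
      have u2 : (2*a*M*B)*(b*c) ≤ (2*a*M*B)*(B*(a-4)) := by gcongr
      nlinarith
    have s2 : M*B^2*(a*(b+c)+b*c) < p*(a*(b*c))*(a*(b+c)+b*c) := by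
      apply mul_lt_mul_of_pos_right hJ; positivity
    have s3 : a*(b*c)*((M-4)*(3*M-4)) < a*(b*c)*(p*(a*(b+c)+b*c)) := by nlinarith
    exact lt_of_mul_lt_mul_left s3 habc.le
  · have s1 : a*(b*c)*(3*M-8) ≤ M*B^2*(a+(b+c)) := by
      rw [hbc2, show 3*M-8 = M + 2*B by rw [hB]; ring]
      have u1 : (a*M)*(b*c) ≤ (a*M)*B^2 := by gcongr
      have u2 : (2*B)*(a*(b*c)) ≤ (2*B)*(M*(B*(a-4))) := by gcongr
      nlinarith
    have s2 : M*B^2*(a+(b+c)) < p*(a*(b*c))*(a+(b+c)) := by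
      apply mul_lt_mul_of_pos_right hJ; positivity
    have s3 : a*(b*c)*(3*M-8) < a*(b*c)*(p*(a+(b+c))) := by nlinarith
    exact lt_of_mul_lt_mul_left s3 habc.le

lemma coef_J (m α k p : ℝ) (hmk : m = α + k + 2) (hpk : p * k = k + 6) :
    p * ((m^2-α^2)*((m^2-(α+2)^2)*(m^2-(α-2)^2))) =
      ((m-1)^2 - (α-1)^2) * ((m+1)^2 - (α-1)^2) * ((m+3)^2 - (α-1)^2) := by
  have h1 : m^2-(α+2)^2 = k * (m+α+2) := by rw [hmk]; ring
  rw [h1]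
  have h2 : p * ((m^2-α^2)*(k * (m+α+2)*(m^2-(α-2)^2))) = (p*k) * ((m^2-α^2)*((m+α+2)*(m^2-(α-2)^2))) := by ring
  rw [h2, hpk, hmk]; ring

lemma coef_fin (m α k p : ℝ) (hp1 : 0 < p) (h0 : 0 < α) (hk0 : 0 < k) (hmk : m = α + k + 2)
    (hJ : m^2*(m^2-4)^2 < p * ((m^2-α^2)*((m^2-(α+2)^2)*(m^2-(α-2)^2))))
    (hJ2 : 0 < 8 + 3*m^2 - 5*α^2) : Cyl.Coef α (m^2) p := by
  have hb0 : 4*α + 4 < m^2 - α^2 := by rw [hmk]; nlinarith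
  have hbc : 0 < (m^2-(α+2)^2)*(m^2-(α-2)^2) := by
    refine mul_pos ?_ ?_ <;> linarith
  have ha4 : 4 < m^2 - α^2 := by linarith
  have hM4 : 4 < m^2 := by nlinarith
  obtain ⟨c1, c2⟩ := coef_arith (M := m^2) (α := α) (p := p) (a := m^2-α^2) (b := m^2-(α+2)^2)
    (c := m^2-(α-2)^2) (B := m^2-4) hp1 rfl rfl (by ring) (by ring) ha4 hbc hM4 hJ
  refine ⟨?_, ?_, ?_, h0, ?_, ?_, ?_⟩
  · have h3 : (4*α+4)^2 < (m^2-α^2)^2 := by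
      apply pow_lt_pow_left₀ hb0 (by linarith); norm_num
    have : 0 < 2*α*(3*(m^2-α^2)^2 + 16 - 16*α^2) := by
      apply mul_pos (by linarith); nlinarith
    linarith
  · have : 0 < 12*α*(m^2-α^2) := by apply mul_pos <;> linarith
    linarith
  · have : 0 < 4*α*(8+3*m^2-5*α^2) := by apply mul_pos <;> linarith
    linarith
  · linarith
  · linarith
  · linarith

lemma coef_of (n : ℕ) (p : ℝ) (hp : 1 < p) (hpc : 15 ≤ n → p < pc n) (α m2 : ℝ)
    (hα : α = ((n:ℝ) - 6)/2 - 6/(p-1)) (hm2 : m2 = (((n:ℝ)-2)/2)^2) (h0 : 0 < α) :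
    Cyl.Coef α m2 p := by
  have hp0 : 0 < p - 1 := by linarith
  have hG := GG_pos n p hp hpc (α - 1) (by rw [hα]; ring) (by linarith)
  obtain ⟨k, hk⟩ : ∃ k, k = 6/(p-1) := ⟨_, rfl⟩
  have hk0 : 0 < k := by rw [hk]; positivity
  have hpk : p * k = k + 6 := by rw [hk]; field_simp; ring
  obtain ⟨m, hm⟩ : ∃ m, m = ((n:ℝ)-2)/2 := ⟨_, rfl⟩
  have hmk : m = α + k + 2 := by rw [hm, hα, hk]; ring
  have hGm : GG n ((α-1)^2) = ((m-1)^2 - (α-1)^2) * ((m+1)^2 - (α-1)^2) * ((m+3)^2 - (α-1)^2) - (m*(m^2-4))^2 := by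
    unfold GG; rw [show (n:ℝ) = 2*m+2 by rw [hm]; ring]; ring
  rw [hGm] at hG
  have hJ2 : 0 < 8 + 3*m^2 - 5*α^2 := by
    by_cases hn : 15 ≤ n
    · by_contra hh
      push Not at hh
      have hn' : (15:ℝ) ≤ n := by exact_mod_cast hn
      have := JL2 (m := m) (α := α) (by rw [hm]; linarith) h0 (by linarith) hh
      rw [mul_pow] at hG
      linarith
    · have hn' : (n:ℝ) ≤ 14 := by exact_mod_cast (by omega : n ≤ 14)
      have : m ≤ 6 := by rw [hm]; linarith
      nlinarith
  rw [hm2, ← hm]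
  refine coef_fin m α k p (by linarith) h0 hk0 hmk ?_ hJ2
  rw [coef_J m α k p hmk hpk]
  rw [mul_pow] at hG
  linarith

/-- Raw data for the cylinder calculus: a dilation field and rotation fields. -/
structure PreCyl (A : Type) [CommRing A] [Algebra ℝ A] (P ι : Type) [Fintype ι] where
  ev : P → A →ₐ[ℝ] ℝ
  D : A →ₗ[ℝ] A
  leibniz : ∀ f g, D (f * g) = D f * g + f * D g
  Om : ι → A →ₗ[ℝ] A
  leibO : ∀ i f g, Om i (f * g) = Om i f * g + f * Om i g
  comm : ∀ i f, Om i (D f) = D (Om i f)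
  CS : Ideal A
  I : A →ₗ[ℝ] ℝ
  D_CS : ∀ f ∈ CS, D f ∈ CS
  O_CS : ∀ i, ∀ f ∈ CS, Om i f ∈ CS
  I_nonneg : ∀ f ∈ CS, (∀ x, 0 ≤ ev x f) → 0 ≤ I f
  I_D : ∀ f ∈ CS, I (D f) = 0
  I_O : ∀ i, ∀ f ∈ CS, I (Om i f) = 0

namespace PreCyl

variable {A : Type} [CommRing A] [Algebra ℝ A] {P ι : Type} [Fintype ι] (s : PreCyl A P ι)

def lam : A →ₗ[ℝ] A := (-(1/2:ℝ)) • ∑ i, (s.Om i).comp (s.Om i)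

def gam : A →ₗ[ℝ] A →ₗ[ℝ] A :=
  (1/2:ℝ) • ∑ i, (LinearMap.mul ℝ A).compl₁₂ (s.Om i) (s.Om i)

lemma lam_apply (f : A) : s.lam f = (-(1/2:ℝ)) • ∑ i, s.Om i (s.Om i f) := by
  simp [lam]

lemma gam_apply (f g : A) : s.gam f g = (1/2:ℝ) • ∑ i, s.Om i f * s.Om i g := by
  simp [gam]

lemma O_one (i : ι) : s.Om i 1 = 0 := by
  have := s.leibO i 1 1
  simpa using this

lemma O_alg (i : ι) (r : ℝ) : s.Om i (algebraMap ℝ A r) = 0 := by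
  rw [Algebra.algebraMap_eq_smul_one, map_smul, O_one, smul_zero]

def rad : Subalgebra ℝ A where
  carrier := {f | ∀ i, s.Om i f = 0}
  mul_mem' {a b} ha hb i := by rw [s.leibO, ha i, hb i]; simp
  add_mem' {a b} ha hb i := by rw [map_add, ha i, hb i]; simp
  algebraMap_mem' r i := s.O_alg i r

lemma O_rad (i : ι) {r : A} (hr : r ∈ s.rad) (f : A) : s.Om i (r * f) = r * s.Om i f := by
  rw [s.leibO, hr i]; simp

lemma ibpO (i : ι) {f g : A} (h : f ∈ s.CS ∨ g ∈ s.CS) :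
    s.I (f * s.Om i g) = - s.I (s.Om i f * g) := by
  have hm : f * g ∈ s.CS := by
    rcases h with h | h
    · exact s.CS.mul_mem_right g h
    · exact s.CS.mul_mem_left f h
  have := s.I_O i _ hm
  rw [s.leibO, map_add] at this
  linarith

def toCyl : Cyl A P where
  ev := s.ev
  D := s.D
  leibniz := s.leibniz
  Lam := s.lam
  Gam := s.gam
  CS := s.CS
  Rad := s.rad
  I := s.I
  D_CS := s.D_CS
  D_Rad f hf i := by rw [s.comm, hf i, map_zero]
  Lam_D f := by simp [lam_apply, s.comm]
  Lam_CS f hf := by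
    rw [lam_apply]
    exact Submodule.smul_of_tower_mem _ _ (s.CS.sum_mem fun i _ => s.O_CS i _ (s.O_CS i f hf))
  Gam_symm f g := by simp [gam_apply, mul_comm]
  Gam_D f g := by
    simp [gam_apply, s.comm, s.leibniz, Finset.sum_add_distrib]
  Gam_rad r hr f g := by
    simp [gam_apply, s.O_rad _ hr, mul_assoc, Finset.mul_sum]
  Lam_rad r hr f := by
    simp [lam_apply, s.O_rad _ hr, Finset.mul_sum]
  Gam_nonneg x f := by
    simp only [gam_apply, map_smul, map_sum, map_mul, smul_eq_mul]
    exact mul_nonneg (by norm_num) (Finset.sum_nonneg fun i _ => mul_self_nonneg _)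
  Gam_CS f hf g := by
    rw [gam_apply]
    exact Submodule.smul_of_tower_mem _ _ (s.CS.sum_mem fun i _ => s.CS.mul_mem_right _ (s.O_CS i f hf))
  I_nonneg := s.I_nonneg
  I_D := s.I_D
  I_Lam f hf g := by
    simp only [lam_apply, gam_apply, mul_smul_comm, map_smul, Finset.mul_sum, map_sum]
    simp only [s.ibpO _ (Or.inl hf), Finset.sum_neg_distrib]
    simp
  I_Lam' f hf g := by
    simp only [lam_apply, gam_apply, smul_mul_assoc, map_smul, Finset.sum_mul, map_sum]
    simp only [s.ibpO _ (Or.inl (s.O_CS _ f hf)), neg_smul, ← smul_neg, ← Finset.sum_neg_distrib]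

end PreCyl

namespace Cyl
variable {A : Type} [CommRing A] [Algebra ℝ A] {P : Type} {c : Cyl A P}

/-- one factor of the operator, shifted by `s` -/
def QQ (c : Cyl A P) (m2 s : ℝ) (w : A) : A :=
  c.D (c.D w) + (2*s) • c.D w + (s^2 - m2) • w - c.Lam w

lemma PP_eq (α m2 : ℝ) (w : A) :
    c.PP α m2 w = c.QQ m2 (α-2) (c.QQ m2 α (c.QQ m2 (α+2) w)) := by
  simp only [PP, QQ, map_add, map_sub, map_smul, c.Lam_D]
  module

end Cyl

abbrev EE (n : ℕ) := EuclideanSpace ℝ (Fin n)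

/-- functions smooth away from the origin -/
def AA (n : ℕ) : Subalgebra ℝ (EE n → ℝ) where
  carrier := {f | ∀ x, x ≠ 0 → ContDiffAt ℝ (⊤ : ℕ∞) f x}
  mul_mem' ha hb x hx := (ha x hx).mul (hb x hx)
  add_mem' ha hb x hx := (ha x hx).add (hb x hx)
  algebraMap_mem' _ _ _ := contDiffAt_const

namespace AA
variable {n : ℕ}

instance : CoeFun (AA n) (fun _ => EE n → ℝ) := ⟨fun f => f.1⟩

lemma sm (f : AA n) {x : EE n} (hx : x ≠ 0) : ContDiffAt ℝ (⊤ : ℕ∞) (f : EE n → ℝ) x := f.2 x hx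

lemma df (f : AA n) {x : EE n} (hx : x ≠ 0) : DifferentiableAt ℝ (f : EE n → ℝ) x :=
  (sm f hx).differentiableAt (by simp)

lemma smd (f : AA n) {x : EE n} (hx : x ≠ 0) :
    ContDiffAt ℝ (⊤ : ℕ∞) (fderiv ℝ (f : EE n → ℝ)) x :=
  (sm f hx).fderiv_right (by simp)

lemma ext' {f g : AA n} (h : ∀ x, f x = g x) : f = g := Subtype.ext (funext h)

@[simp] lemma mul_ap (f g : AA n) (x : EE n) : (f * g : AA n) x = f x * g x := rfl
@[simp] lemma add_ap (f g : AA n) (x : EE n) : (f + g : AA n) x = f x + g x := rfl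
@[simp] lemma sub_ap (f g : AA n) (x : EE n) : (f - g : AA n) x = f x - g x := rfl
@[simp] lemma neg_ap (f : AA n) (x : EE n) : (-f : AA n) x = -f x := rfl
@[simp] lemma smul_ap (r : ℝ) (f : AA n) (x : EE n) : (r • f : AA n) x = r * f x := rfl
@[simp] lemma pow_ap (f : AA n) (k : ℕ) (x : EE n) : (f ^ k : AA n) x = f x ^ k := rfl
@[simp] lemma zero_ap (x : EE n) : (0 : AA n) x = 0 := rfl
lemma sum_ap {ι : Type} [Fintype ι] (f : ι → AA n) (x : EE n) : (∑ i, f i : AA n) x = ∑ i, f i x := by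
  simp

/-- linear vector field as a derivation -/
def X (L : EE n →L[ℝ] EE n) : AA n →ₗ[ℝ] AA n where
  toFun f := ⟨fun x => fderiv ℝ f x (L x), fun x hx =>
    (smd f hx).clm_apply L.contDiff.contDiffAt⟩
  map_add' f g := ext' fun x => by
    by_cases hx : x = 0
    · simp [hx]
    · have := fderiv_add (df f hx) (df g hx)
      show fderiv ℝ ((f : EE n → ℝ) + (g : EE n → ℝ)) x (L x) = _
      rw [this]; rfl
  map_smul' r f := ext' fun x => by
    by_cases hx : x = 0
    · simp [hx]
    · have := fderiv_const_smul (df f hx) r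
      show fderiv ℝ (r • (f : EE n → ℝ)) x (L x) = _
      rw [this]; rfl

lemma X_ap (L : EE n →L[ℝ] EE n) (f : AA n) (x : EE n) : X L f x = fderiv ℝ (f : EE n → ℝ) x (L x) := rfl

lemma X_mul (L : EE n →L[ℝ] EE n) (f g : AA n) : X L (f * g) = X L f * g + f * X L g := ext' fun x => by
  by_cases hx : x = 0
  · simp [hx, X_ap]
  · have := fderiv_mul (df f hx) (df g hx)
    show fderiv ℝ ((f : EE n → ℝ) * (g : EE n → ℝ)) x (L x) = _
    rw [this]
    simp [X_ap]; ring

lemma X_X (L M : EE n →L[ℝ] EE n) (f : AA n) {x : EE n} (hx : x ≠ 0) :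
    X L (X M f) x = fderiv ℝ (fderiv ℝ (f : EE n → ℝ)) x (L x) (M x) + fderiv ℝ (f : EE n → ℝ) x (M (L x)) := by
  have h1 : DifferentiableAt ℝ (fderiv ℝ (f : EE n → ℝ)) x := (smd f hx).differentiableAt (by simp)
  have := fderiv_clm_apply h1 (M.differentiableAt (x := x))
  show fderiv ℝ (fun y => fderiv ℝ (f : EE n → ℝ) y (M y)) x (L x) = _
  rw [this]
  simp [add_comm]

lemma symm2 (f : AA n) {x : EE n} (hx : x ≠ 0) (v w : EE n) :
    fderiv ℝ (fderiv ℝ (f : EE n → ℝ)) x v w = fderiv ℝ (fderiv ℝ (f : EE n → ℝ)) x w v :=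
  ((sm f hx).isSymmSndFDerivAt (by simp; exact WithTop.coe_le_coe.mpr (le_top : (2:ℕ∞) ≤ ⊤))) v w

lemma X_comm (L : EE n →L[ℝ] EE n) (f : AA n) :
    X L (X (.id ℝ _) f) = X (.id ℝ _) (X L f) := ext' fun x => by
  by_cases hx : x = 0
  · simp [hx, X_ap]
  · rw [X_X _ _ _ hx, X_X _ _ _ hx, symm2 f hx]; simp

/-- compactly supported in the punctured space -/
def CS (n : ℕ) : Ideal (AA n) where
  carrier := {f | ∃ a b : ℝ, 0 < a ∧ ∀ x : EE n, x ≠ 0 → (‖x‖ < a ∨ b < ‖x‖) → f x = 0}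
  add_mem' := by
    rintro f g ⟨a, b, ha, h⟩ ⟨a', b', ha', h'⟩
    refine ⟨min a a', max b b', lt_min ha ha', fun x hx hh => ?_⟩
    rw [add_ap, h x hx, h' x hx, add_zero]
    · exact hh.imp (fun h => h.trans_le (min_le_right _ _)) (fun h => (le_max_right _ _).trans_lt h)
    · exact hh.imp (fun h => h.trans_le (min_le_left _ _)) (fun h => (le_max_left _ _).trans_lt h)
  zero_mem' := ⟨1, 1, one_pos, fun x _ _ => rfl⟩
  smul_mem' := by
    rintro c f ⟨a, b, ha, h⟩
    refine ⟨a, b, ha, fun x hx hh => ?_⟩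
    show c x * f x = 0
    rw [h x hx hh, mul_zero]

lemma mem_CS {f : AA n} : f ∈ CS n ↔ ∃ a b : ℝ, 0 < a ∧ ∀ x : EE n, x ≠ 0 → (‖x‖ < a ∨ b < ‖x‖) → f x = 0 := Iff.rfl

lemma X_CS (L : EE n →L[ℝ] EE n) (f : AA n) (hf : f ∈ CS n) : X L f ∈ CS n := by
  obtain ⟨a, b, ha, h⟩ := hf
  refine ⟨a, b, ha, fun x hx hh => ?_⟩
  have ho : IsOpen {y : EE n | y ≠ 0 ∧ (‖y‖ < a ∨ b < ‖y‖)} := by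
    apply IsOpen.inter isOpen_ne
    exact (isOpen_lt continuous_norm continuous_const).union (isOpen_lt continuous_const continuous_norm)
  have : (f : EE n → ℝ) =ᶠ[nhds x] fun _ => 0 := by
    filter_upwards [ho.mem_nhds ⟨hx, hh⟩] with y hy using h y hy.1 hy.2
  rw [X_ap, this.fderiv_eq]; simp

/-- the density -/
lemma gd {f : AA n} (hf : f ∈ CS n) (s : ℝ) (hs : s ≠ 0 ∨ f 0 = 0) :
    ContDiff ℝ (⊤ : ℕ∞) (fun x => f x * ‖x‖ ^ s) ∧ HasCompactSupport (fun x => f x * ‖x‖ ^ s) := by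
  obtain ⟨a, b, ha, h⟩ := hf
  constructor
  · rw [contDiff_iff_contDiffAt]
    intro x
    by_cases hx : x = 0
    · have : (fun x => f x * ‖x‖ ^ s) =ᶠ[nhds x] fun _ => 0 := by
        have : Metric.ball (0 : EE n) a ∈ nhds x := by rw [hx]; exact Metric.ball_mem_nhds _ ha
        filter_upwards [this] with y hy
        by_cases hy0 : y = 0
        · rcases hs with hs | hs
          · simp [hy0, Real.zero_rpow hs]
          · simp [hy0, hs]
        · rw [h y hy0 (Or.inl (by simpa using hy)), zero_mul]
      exact contDiffAt_const.congr_of_eventuallyEq this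
    · exact (sm f hx).mul ((contDiffAt_norm ℝ hx).rpow_const_of_ne (norm_ne_zero_iff.mpr hx))
  · refine HasCompactSupport.of_support_subset_isCompact (isCompact_closedBall (0 : EE n) b) ?_
    intro x hx
    by_contra hb
    simp only [Metric.mem_closedBall, dist_zero_right, not_le] at hb
    apply hx
    by_cases hx0 : x = 0
    · rcases hs with hs | hs
      · simp [hx0, Real.zero_rpow hs]
      · simp [hx0, hs]
    · simp only; rw [h x hx0 (Or.inr hb), zero_mul]

end AA

namespace AA
variable {n : ℕ}

lemma vec_sum (x : EE n) : x = ∑ i, x i • EuclideanSpace.single i (1:ℝ) := by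
  ext j
  simp [Finset.sum_apply, Pi.single_apply]

lemma lin_sum {F : Type*} [NormedAddCommGroup F] [NormedSpace ℝ F] (l : EE n →L[ℝ] F) (x : EE n) :
    l x = ∑ i, x i • l (EuclideanSpace.single i 1) := by
  conv_lhs => rw [vec_sum x]
  rw [map_sum]
  exact Finset.sum_congr rfl fun i _ => map_smul _ _ _

/-- divergence theorem for linear vector fields -/
lemma int_L (L : EE n →L[ℝ] EE n) {g : EE n → ℝ} (hg : ContDiff ℝ (⊤ : ℕ∞) g) (hc : HasCompactSupport g) :
    ∫ x, fderiv ℝ g x (L x) = -(∑ i, L (EuclideanSpace.single i 1) i) * ∫ x, g x := by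
  have hg' : Continuous (fderiv ℝ g) := hg.continuous_fderiv (by simp)
  have hc' : HasCompactSupport (fderiv ℝ g) := hc.fderiv ℝ
  have hi : ∀ i, Integrable (fun x => (L x) i * fderiv ℝ g x (EuclideanSpace.single i 1)) := by
    intro i
    refine Continuous.integrable_of_hasCompactSupport (by fun_prop) ?_
    refine HasCompactSupport.mul_left ?_
    exact hc'.comp_left (g := fun l : EE n →L[ℝ] ℝ => l (EuclideanSpace.single i 1)) (by simp)
  have hgi : Integrable g := hg.continuous.integrable_of_hasCompactSupport hc
  have h1 : ∀ x, fderiv ℝ g x (L x) = ∑ i, (L x) i * fderiv ℝ g x (EuclideanSpace.single i 1) := by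
    intro x; simpa using lin_sum (fderiv ℝ g x) (L x)
  simp_rw [h1]
  rw [integral_finsetSum _ fun i _ => hi i, neg_mul, Finset.sum_mul, ← Finset.sum_neg_distrib]
  refine Finset.sum_congr rfl fun i _ => ?_
  have hd : ∀ x, fderiv ℝ (fun x => (L x) i) x = (EuclideanSpace.proj i).comp L := fun x =>
    ((EuclideanSpace.proj i : EE n →L[ℝ] ℝ).comp L).fderiv
  have := integral_mul_fderiv_eq_neg_fderiv_mul_of_integrable (μ := volume) (f := fun x => (L x) i) (g := g)
    (v := EuclideanSpace.single i 1) ?_ (hi i) ?_ ?_ ?_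
  · rw [this]
    simp only [hd]
    simp [integral_const_mul]
  · simp only [hd]
    exact hgi.const_mul _
  · refine Continuous.integrable_of_hasCompactSupport (by have := hg.continuous; fun_prop) hc.mul_left
  · intro x _
    exact ((EuclideanSpace.proj i : EE n →L[ℝ] ℝ).comp L).differentiableAt
  · intro x _
    exact hg.differentiable (by simp) x

/-- radial functions -/
lemma R_sm {χ : ℝ → ℝ} (h : ContDiff ℝ (⊤ : ℕ∞) χ) :
    (fun x : EE n => if x = 0 then 0 else χ (Real.log ‖x‖)) ∈ AA n := by
  intro x hx
  have h1 : ContDiffAt ℝ (⊤ : ℕ∞) (fun x : EE n => χ (Real.log ‖x‖)) x :=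
    h.contDiffAt.comp x ((contDiffAt_norm ℝ hx).log (norm_ne_zero_iff.mpr hx))
  refine h1.congr_of_eventuallyEq ?_
  filter_upwards [isOpen_ne.mem_nhds hx] with y hy
  simp only [if_neg hy]

open Classical in
def R (χ : ℝ → ℝ) : AA n := if h : ContDiff ℝ (⊤ : ℕ∞) χ then ⟨_, R_sm h⟩ else 0

lemma R_ap {χ : ℝ → ℝ} (h : ContDiff ℝ (⊤ : ℕ∞) χ) {x : EE n} (hx : x ≠ 0) : R χ x = χ (Real.log ‖x‖) := by
  simp [R, h, hx]

lemma R_zero (χ : ℝ → ℝ) : R χ (0 : EE n) = 0 := by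
  unfold R; split_ifs <;> simp

lemma R_mul {χ ψ : ℝ → ℝ} (h : ContDiff ℝ (⊤ : ℕ∞) χ) (h' : ContDiff ℝ (⊤ : ℕ∞) ψ) :
    (R (fun s => χ s * ψ s) : AA n) = R χ * R ψ := ext' fun x => by
  by_cases hx : x = 0
  · simp [hx, R_zero]
  · rw [mul_ap, R_ap (h.mul h') hx, R_ap h hx, R_ap h' hx]

lemma hasF_log {x : EE n} (hx : x ≠ 0) :
    HasFDerivAt (fun x : EE n => Real.log ‖x‖) ((‖x‖^2)⁻¹ • innerSL ℝ x) x := by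
  have h1 := (hasStrictFDerivAt_norm_sq x).hasFDerivAt
  have h2 := (h1.log (by positivity)).const_mul (1/2)
  have e : (fun x : EE n => Real.log ‖x‖) = fun x => 1/2 * Real.log (‖x‖^2) := by
    funext y; rw [Real.log_pow]; push_cast; ring
  rw [e]
  refine h2.congr_fderiv ?_
  ext v
  simp
  ring

lemma X_R (L : EE n →L[ℝ] EE n) {c : ℝ} (hL : ∀ x, inner ℝ x (L x) = c * ‖x‖^2) {χ : ℝ → ℝ}
    (h : ContDiff ℝ (⊤ : ℕ∞) χ) : X L (R χ) = c • R (deriv χ) := ext' fun x => by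
  have h' : ContDiff ℝ (⊤ : ℕ∞) (deriv χ) := (contDiff_infty_iff_deriv.mp h).2
  by_cases hx : x = 0
  · simp [hx, R_zero, X_ap]
  · rw [smul_ap, R_ap h' hx, X_ap]
    have h1 := ((h.differentiable (by simp) (Real.log ‖x‖)).hasDerivAt).comp_hasFDerivAt x (hasF_log hx)
    have h2 : ((R χ : AA n) : EE n → ℝ) =ᶠ[nhds x] (χ ∘ fun x : EE n => Real.log ‖x‖) := by
      filter_upwards [isOpen_ne.mem_nhds hx] with y hy
      exact R_ap h hy
    rw [h2.fderiv_eq, h1.fderiv]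
    have : ‖x‖ ≠ 0 := norm_ne_zero_iff.mpr hx
    simp [hL]
    field_simp

/-- powers of the norm -/
def Nr (s : ℝ) : AA n := R (fun t => Real.exp (s * t))

lemma Nr_smooth (s : ℝ) : ContDiff ℝ (⊤ : ℕ∞) (fun t : ℝ => Real.exp (s * t)) := by fun_prop

lemma Nr_ap (s : ℝ) {x : EE n} (hx : x ≠ 0) : (Nr s : AA n) x = ‖x‖ ^ s := by
  rw [Nr, R_ap (Nr_smooth s) hx, Real.rpow_def_of_pos (norm_pos_iff.mpr hx), mul_comm]

lemma Nr_zero (s : ℝ) : (Nr s : AA n) 0 = 0 := R_zero _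

lemma X_Nr (L : EE n →L[ℝ] EE n) {c : ℝ} (hL : ∀ x, inner ℝ x (L x) = c * ‖x‖^2) (s : ℝ) :
    X L (Nr s) = (c * s) • Nr s := by
  rw [Nr, X_R L hL (Nr_smooth s), mul_smul]
  congr 1
  have : deriv (fun t : ℝ => Real.exp (s * t)) = fun t => s * Real.exp (s * t) := by
    funext t
    have := ((hasDerivAt_id t).const_mul s).exp.deriv
    simp only [id, mul_one] at this
    rw [this, mul_comm]
  rw [this]
  refine ext' fun x => ?_
  by_cases hx : x = 0
  · simp [hx, R_zero]
  · rw [smul_ap, R_ap (contDiff_const.mul (Nr_smooth s)) hx, R_ap (Nr_smooth s) hx]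

lemma Nr_mul (s t : ℝ) : (Nr s * Nr t : AA n) = Nr (s + t) := by
  rw [Nr, Nr, ← R_mul (Nr_smooth s) (Nr_smooth t), Nr]
  congr 1; funext x; rw [← Real.exp_add]; ring_nf

lemma X_congr (L : EE n →L[ℝ] EE n) {f g : AA n} (h : ∀ x, x ≠ 0 → f x = g x) : X L f = X L g :=
  ext' fun x => by
    by_cases hx : x = 0
    · simp [hx, X_ap]
    · have : (f : EE n → ℝ) =ᶠ[nhds x] g := by
        filter_upwards [isOpen_ne.mem_nhds hx] with y hy using h y hy
      rw [X_ap, X_ap, this.fderiv_eq]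

/-- the weighted integral, on compactly supported functions -/
lemma I0_ex (n : ℕ) (hn : 1 ≤ n) : ∃ I : AA n →ₗ[ℝ] ℝ, ∀ f ∈ CS n, I f = ∫ x, f x * ‖x‖ ^ (-(n:ℝ)) := by
  have hn0 : -(n:ℝ) ≠ 0 := by
    have : (n:ℝ) ≠ 0 := by exact_mod_cast (by omega : n ≠ 0)
    simpa using this
  have hI : ∀ f ∈ CS n, Integrable (fun x => f x * ‖x‖ ^ (-(n:ℝ))) := fun f hf =>
    (gd hf _ (Or.inl hn0)).1.continuous.integrable_of_hasCompactSupport (gd hf _ (Or.inl hn0)).2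
  let I0 : (CS n).restrictScalars ℝ →ₗ[ℝ] ℝ :=
    { toFun := fun f => ∫ x, f.1 x * ‖x‖ ^ (-(n:ℝ))
      map_add' := fun f g => by
        rw [← integral_add (hI _ f.2) (hI _ g.2)]
        congr 1; funext x
        show (f.1 x + g.1 x) * _ = _
        ring
      map_smul' := fun r f => by
        rw [RingHom.id_apply, smul_eq_mul, ← integral_const_mul]
        congr 1; funext x
        show (r * f.1 x) * _ = _
        ring }
  obtain ⟨I, hI⟩ := LinearMap.exists_extend I0
  refine ⟨I, fun f hf => ?_⟩
  have := LinearMap.congr_fun hI ⟨f, hf⟩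
  exact this

def II (n : ℕ) (hn : 1 ≤ n) : AA n →ₗ[ℝ] ℝ := (I0_ex n hn).choose
lemma II_eq (hn : 1 ≤ n) {f : AA n} (hf : f ∈ CS n) : II n hn f = ∫ x, f x * ‖x‖ ^ (-(n:ℝ)) :=
  (I0_ex n hn).choose_spec f hf

lemma II_X (hn : 1 ≤ n) (L : EE n →L[ℝ] EE n) {c : ℝ} (hL : ∀ x, inner ℝ x (L x) = c * ‖x‖^2)
    (htr : ∑ i, L (EuclideanSpace.single i 1) i = c * n) {f : AA n} (hf : f ∈ CS n) :
    II n hn (X L f) = 0 := by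
  have hn0 : -(n:ℝ) ≠ 0 := by
    have : (n:ℝ) ≠ 0 := by exact_mod_cast (by omega : n ≠ 0)
    simpa using this
  obtain ⟨h1, h2⟩ := gd hf _ (Or.inl hn0)
  have h3 := int_L L h1 h2
  have hN : ∀ g : AA n, ∀ x, (g * Nr (-(n:ℝ)) : AA n) x = g x * ‖x‖ ^ (-(n:ℝ)) := by
    intro g x
    by_cases hx : x = 0
    · simp [hx, Nr_zero, Real.zero_rpow hn0]
    · rw [mul_ap, Nr_ap _ hx]
  rw [II_eq hn (X_CS L f hf)]
  have e : ∀ x, X L f x * ‖x‖ ^ (-(n:ℝ)) = fderiv ℝ (fun x => f x * ‖x‖ ^ (-(n:ℝ))) x (L x)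
      + (c * n) * (f x * ‖x‖ ^ (-(n:ℝ))) := by
    intro x
    have h4 : (fun x => f x * ‖x‖ ^ (-(n:ℝ))) = ((f * Nr (-(n:ℝ)) : AA n) : EE n → ℝ) := by
      funext x; rw [hN]
    rw [h4, ← X_ap, X_mul, X_Nr L hL, add_ap, hN, mul_smul_comm, smul_ap, hN]
    ring
  simp_rw [e]
  rw [integral_add, h3, integral_const_mul, htr]
  · ring
  · refine Continuous.integrable_of_hasCompactSupport ?_ ?_
    · exact (h1.continuous_fderiv (by simp)).clm_apply L.continuous
    · exact (h2.fderiv ℝ).mono (fun x hx => by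
        intro h0; apply hx
        simp only at h0 ⊢
        rw [h0]; rfl)
  · exact (h1.continuous.integrable_of_hasCompactSupport h2).const_mul _

/-- rotation fields -/
def rot (i j : Fin n) : EE n →L[ℝ] EE n :=
  (EuclideanSpace.proj i : EE n →L[ℝ] ℝ).smulRight (EuclideanSpace.single j 1)
    - (EuclideanSpace.proj j : EE n →L[ℝ] ℝ).smulRight (EuclideanSpace.single i 1)

lemma rot_ap (i j : Fin n) (x : EE n) :
    rot i j x = x i • EuclideanSpace.single j 1 - x j • EuclideanSpace.single i 1 := rfl

lemma rot_skew (i j : Fin n) (x : EE n) : inner ℝ x (rot i j x) = 0 * ‖x‖^2 := by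
  rw [rot_ap, inner_sub_right, inner_smul_right, inner_smul_right]
  simp [EuclideanSpace.inner_single_right]
  ring

lemma rot_tr (i j : Fin n) : ∑ l, rot i j (EuclideanSpace.single l 1) l = 0 * (n:ℝ) := by
  simp only [rot_ap, PiLp.sub_apply, PiLp.smul_apply, smul_eq_mul, PiLp.single_apply]
  by_cases h : i = j
  · simp [h]
  · simp [h, eq_comm]

lemma id_inner (x : EE n) : inner ℝ x (ContinuousLinearMap.id ℝ (EE n) x) = 1 * ‖x‖^2 := by
  simp

lemma id_tr : ∑ l, (ContinuousLinearMap.id ℝ (EE n) (EuclideanSpace.single l 1)) l = 1 * (n:ℝ) := by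
  simp

def pre (n : ℕ) (hn : 1 ≤ n) : PreCyl (AA n) {x : EE n // x ≠ 0} (Fin n × Fin n) where
  ev x := (Pi.evalAlgHom ℝ (fun _ : EE n => ℝ) x.1).comp (AA n).val
  D := X (.id ℝ _)
  leibniz := X_mul _
  Om q := X (rot q.1 q.2)
  leibO q := X_mul _
  comm q := X_comm _
  CS := CS n
  I := II n hn
  D_CS := X_CS _
  O_CS q := X_CS _
  I_nonneg f hf h := by
    rw [II_eq hn hf]
    refine integral_nonneg fun x => ?_
    by_cases hx : x = 0
    · have hn0 : -(n:ℝ) ≠ 0 := by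
        have : (n:ℝ) ≠ 0 := by exact_mod_cast (by omega : n ≠ 0)
        simpa using this
      simp [hx, Real.zero_rpow hn0]
    · exact mul_nonneg (h ⟨x, hx⟩) (by positivity)
  I_D f hf := II_X hn _ id_inner id_tr hf
  I_O q f hf := II_X hn _ (rot_skew _ _) (rot_tr _ _) hf

def cy (n : ℕ) (hn : 1 ≤ n) : Cyl (AA n) {x : EE n // x ≠ 0} := (pre n hn).toCyl

lemma ev_ap (hn : 1 ≤ n) (x : {x : EE n // x ≠ 0}) (f : AA n) : (cy n hn).ev x f = f x.1 := rfl

end AA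

namespace AA
variable {n : ℕ}

lemma I_R (hn : 1 ≤ n) {χ : ℝ → ℝ} (h : ContDiff ℝ (⊤ : ℕ∞) χ) {a b : ℝ} (hab : a ≤ b)
    (hs : ∀ s, s ≤ a ∨ b ≤ s → χ s = 0) (h1 : ∀ s, χ s ≤ 1) (hcs : (R χ : AA n) ∈ CS n) :
    II n hn (R χ) ≤ (n * volume.real (Metric.ball (0 : EE n) 1)) * (b - a) := by
  have hn0 : -(n:ℝ) ≠ 0 := by
    have : (n:ℝ) ≠ 0 := by exact_mod_cast (by omega : n ≠ 0)
    simpa using this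
  have : Nonempty (Fin n) := ⟨⟨0, by omega⟩⟩
  have : Nontrivial (EE n) := inferInstance
  rw [II_eq hn hcs]
  have e1 : ∀ x : EE n, (R χ : AA n) x * ‖x‖ ^ (-(n:ℝ)) = (fun r : ℝ => χ (Real.log r) * r ^ (-(n:ℝ))) ‖x‖ := by
    intro x
    by_cases hx : x = 0
    · simp [hx, Real.zero_rpow hn0]
    · simp only [R_ap h hx]
  simp_rw [e1]
  rw [integral_fun_norm_addHaar volume (fun r : ℝ => χ (Real.log r) * r ^ (-(n:ℝ)))]
  rw [finrank_euclideanSpace_fin]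
  have e2 : ∫ y in Set.Ioi (0:ℝ), y ^ (n-1) • (χ (Real.log y) * y ^ (-(n:ℝ)))
      = ∫ y in Set.Ioi (0:ℝ), χ (Real.log y) * y⁻¹ := by
    refine setIntegral_congr_fun measurableSet_Ioi fun y hy => ?_
    have hy : 0 < y := hy
    simp only [smul_eq_mul]
    rw [Real.rpow_neg hy.le, Real.rpow_natCast]
    obtain ⟨m, rfl⟩ : ∃ m, n = m + 1 := ⟨n - 1, by omega⟩
    simp only [Nat.add_sub_cancel]
    field_simp
    ring
  rw [e2]
  have e3 : ∫ y in Set.Ioi (0:ℝ), χ (Real.log y) * y⁻¹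
      = ∫ y in Set.Ioc (Real.exp a) (Real.exp b), χ (Real.log y) * y⁻¹ := by
    refine setIntegral_eq_of_subset_of_forall_sdiff_eq_zero measurableSet_Ioi ?_ ?_
    · intro y hy; exact (Real.exp_pos a).trans hy.1
    · rintro y ⟨hy, hy2⟩
      have hy : 0 < y := hy
      rw [hs, zero_mul]
      by_contra hc
      push Not at hc
      exact hy2 ⟨(Real.lt_log_iff_exp_lt hy).mp hc.1, ((Real.log_lt_iff_lt_exp hy).mp hc.2).le⟩
  have e4 : ∫ y in Set.Ioc (Real.exp a) (Real.exp b), χ (Real.log y) * y⁻¹ ≤ b - a := by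
    have hle : Real.exp a ≤ Real.exp b := Real.exp_le_exp.mpr hab
    have hpos : ∀ y ∈ Set.Icc (Real.exp a) (Real.exp b), y ≠ 0 := fun y hy =>
      ((Real.exp_pos a).trans_le hy.1).ne'
    have c1 : ContinuousOn (fun y : ℝ => y⁻¹) (Set.Icc (Real.exp a) (Real.exp b)) :=
      continuousOn_inv₀.mono fun y hy => hpos y hy
    have c2 : ContinuousOn (fun y : ℝ => χ (Real.log y) * y⁻¹) (Set.Icc (Real.exp a) (Real.exp b)) :=
      (h.continuous.comp_continuousOn (Real.continuousOn_log.mono fun y hy => hpos y hy)).mul c1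
    have e5 : ∫ y in Set.Ioc (Real.exp a) (Real.exp b), y⁻¹ = b - a := by
      rw [← intervalIntegral.integral_of_le hle, integral_inv_of_pos (Real.exp_pos _) (Real.exp_pos _),
        ← Real.exp_sub, Real.log_exp]
    rw [← e5]
    refine setIntegral_mono_on (c2.integrableOn_Icc.mono_set Set.Ioc_subset_Icc_self)
      (c1.integrableOn_Icc.mono_set Set.Ioc_subset_Icc_self) measurableSet_Ioc fun y hy => ?_
    have hy0 : 0 < y := (Real.exp_pos a).trans hy.1
    have := inv_pos.mpr hy0
    nlinarith [h1 (Real.log y)]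
  rw [e3]
  simp only [nsmul_eq_mul, smul_eq_mul]
  rw [← mul_assoc]
  gcongr

lemma R_CS {χ : ℝ → ℝ} (h : ContDiff ℝ (⊤ : ℕ∞) χ) (a b : ℝ)
    (hs : ∀ s, s ≤ a ∨ b ≤ s → χ s = 0) : (R χ : AA n) ∈ CS n := by
  refine ⟨Real.exp a, Real.exp b, Real.exp_pos _, fun x hx hh => ?_⟩
  rw [R_ap h hx, hs]
  have := norm_pos_iff.mpr hx
  rcases hh with hh | hh
  · exact Or.inl ((Real.log_lt_iff_lt_exp this).mpr hh).le
  · exact Or.inr ((Real.lt_log_iff_exp_lt this).mpr hh).le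

def tm (n : ℕ) (hn : 1 ≤ n) : (cy n hn).Tm where
  t x := Real.log ‖x.1‖
  R := R
  sig := n * volume.real (Metric.ball (0 : EE n) 1)
  sig0 := by positivity
  ev_R χ h x := R_ap h x.2
  D_R χ h := by
    have := X_R (ContinuousLinearMap.id ℝ (EE n)) id_inner h
    rw [one_smul] at this
    exact this
  R_rad χ h q := by
    have := X_R (rot q.1 q.2) (rot_skew _ _) h
    rw [zero_smul] at this
    exact this
  R_CS χ h a b hs := R_CS h a b hs
  R_mul χ ψ h h' := R_mul h h'
  I_R χ h a b hab hs _ h1 := I_R hn h hab hs h1 (R_CS h a b hs)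

/-- the Laplacian in terms of second derivatives -/
lemma lap_eq (u : EE n → ℝ) (x : EE n) :
    laplacian u x = ∑ i, fderiv ℝ (fderiv ℝ u) x (EuclideanSpace.single i 1) (EuclideanSpace.single i 1) := by
  unfold laplacian
  refine Finset.sum_congr rfl fun i _ => ?_
  rw [iteratedFDeriv_two_apply]; simp

lemma lap_smooth {u : EE n → ℝ} {x : EE n} (h : ContDiffAt ℝ (⊤ : ℕ∞) u x) :
    ContDiffAt ℝ (⊤ : ℕ∞) (laplacian u) x := by
  have e : laplacian u = fun x => ∑ i, fderiv ℝ (fderiv ℝ u) x (EuclideanSpace.single i 1) (EuclideanSpace.single i 1) :=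
    funext (lap_eq u)
  rw [e]
  have h1 : ContDiffAt ℝ (⊤ : ℕ∞) (fderiv ℝ u) x := h.fderiv_right (by simp)
  have h2 : ContDiffAt ℝ (⊤ : ℕ∞) (fderiv ℝ (fderiv ℝ u)) x := h1.fderiv_right (by simp)
  refine ContDiffAt.sum fun i _ => ?_
  exact (h2.clm_apply contDiffAt_const).clm_apply contDiffAt_const

def lapA (f : AA n) : AA n := ⟨laplacian (f : EE n → ℝ), fun _ hx => lap_smooth (sm f hx)⟩

/-- polar decomposition of the Laplacian -/
lemma lap_polar (hn : 1 ≤ n) (f : AA n) {x : EE n} (hx : x ≠ 0) :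
    ‖x‖^2 * laplacian (f : EE n → ℝ) x =
      ((cy n hn).D ((cy n hn).D f) + ((n:ℝ)-2) • (cy n hn).D f - (cy n hn).Lam f : AA n) x := by
  have hD : ∀ g : AA n, (cy n hn).D g = X (.id ℝ _) g := fun _ => rfl
  have hΛ : (cy n hn).Lam f = (-(1/2:ℝ)) • ∑ q : Fin n × Fin n, X (rot q.1 q.2) (X (rot q.1 q.2) f) :=
    (pre n hn).lam_apply f
  rw [hΛ, hD, hD, sub_ap, add_ap, smul_ap, smul_ap, sum_ap, X_X _ _ _ hx, X_ap, lap_eq]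
  simp only [X_X _ _ _ hx]
  set H := fderiv ℝ (fderiv ℝ (f : EE n → ℝ)) x with hH
  set l := fderiv ℝ (f : EE n → ℝ) x with hl
  have hsym : ∀ v w, H v w = H w v := symm2 f hx
  set e : Fin n → EE n := fun i => EuclideanSpace.single i 1 with he
  have hrot : ∀ i j (y : EE n), rot i j y = y i • e j - y j • e i := fun i j y => rfl
  have hHx : H x x = ∑ i, ∑ j, x i * x j * H (e i) (e j) := by
    rw [lin_sum H x, sum_apply]
    refine Finset.sum_congr rfl fun i _ => ?_
    rw [smul_apply, lin_sum (H (e i)) x, Finset.smul_sum]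
    refine Finset.sum_congr rfl fun j _ => ?_
    simp [he]; ring
  have hlx : l x = ∑ i, x i * l (e i) := by
    simpa using lin_sum l x
  have hnorm : ‖x‖^2 = ∑ i, x i ^ 2 := EuclideanSpace.real_norm_sq_eq x
  have hrr : ∀ i j, l (rot i j (rot i j x)) =
      ((if i = j then x i else 0) - x j) * l (e j) - (x i - (if i = j then x j else 0)) * l (e i) := by
    intro i j
    rw [hrot, map_sub, map_smul, map_smul, hrot]
    simp only [he, PiLp.sub_apply, PiLp.smul_apply, PiLp.single_apply, smul_eq_mul]
    by_cases hij : i = j <;> simp [hij, eq_comm]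
  have hHr : ∀ i j, H (rot i j x) (rot i j x) =
      x i ^2 * H (e j) (e j) + x j ^2 * H (e i) (e i) - 2 * (x i * x j * H (e i) (e j)) := by
    intro i j
    rw [hrot]
    simp only [map_sub, map_smul, sub_apply, smul_apply, smul_eq_mul]
    rw [hsym (e j) (e i)]; ring
  have hA : ∑ q : Fin n × Fin n, H (rot q.1 q.2 x) (rot q.1 q.2 x) = 2 * (‖x‖^2 * ∑ i, H (e i) (e i)) - 2 * H x x := by
    rw [Fintype.sum_prod_type]
    simp only [hHr, Finset.sum_sub_distrib, Finset.sum_add_distrib, ← Finset.mul_sum, ← Finset.sum_mul]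
    rw [hHx, hnorm, Finset.mul_sum]
    ring
  have hB : ∑ q : Fin n × Fin n, l (rot q.1 q.2 (rot q.1 q.2 x)) = 2 * (1 - (n:ℝ)) * l x := by
    rw [Fintype.sum_prod_type]
    simp only [hrr, sub_mul, ite_mul, zero_mul, Finset.sum_sub_distrib, Finset.sum_ite_eq, Finset.mem_univ, if_true]
    rw [hlx]
    have h7 : ∑ i, ((n:ℝ) * (x i * l (e i))) = n * ∑ i, x i * l (e i) := by rw [Finset.mul_sum]
    simp
    simp only [mul_assoc, h7]
    ring
  rw [Finset.sum_add_distrib, hA, hB]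
  simp
  ring

end AA

namespace AA
variable {n : ℕ}

/-! ### Green formula -/

lemma ibp1 {F G : EE n → ℝ} (hF : ContDiff ℝ (⊤ : ℕ∞) F) (hG : ContDiff ℝ (⊤ : ℕ∞) G)
    (hc : HasCompactSupport F) (v : EE n) :
    ∫ x, F x * fderiv ℝ G x v = - ∫ x, fderiv ℝ F x v * G x := by
  have cF : Continuous fun x => fderiv ℝ F x v :=
    (hF.continuous_fderiv (by simp)).clm_apply continuous_const
  have cG : Continuous fun x => fderiv ℝ G x v :=
    (hG.continuous_fderiv (by simp)).clm_apply continuous_const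
  have hc' : HasCompactSupport fun x => fderiv ℝ F x v :=
    (hc.fderiv ℝ).comp_left (g := fun l : EE n →L[ℝ] ℝ => l v) (by simp)
  refine integral_mul_fderiv_eq_neg_fderiv_mul_of_integrable ?_ ?_ ?_
    (fun x _ => hF.differentiable (by simp) x) (fun x _ => hG.differentiable (by simp) x)
  · exact (cF.mul hG.continuous).integrable_of_hasCompactSupport hc'.mul_right
  · exact (hF.continuous.mul cG).integrable_of_hasCompactSupport hc.mul_right
  · exact (hF.continuous.mul hG.continuous).integrable_of_hasCompactSupport hc.mul_right

lemma pd_smooth {F : EE n → ℝ} (hF : ContDiff ℝ (⊤ : ℕ∞) F) (v : EE n) :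
    ContDiff ℝ (⊤ : ℕ∞) fun x => fderiv ℝ F x v :=
  (hF.fderiv_right (by simp)).clm_apply contDiff_const

lemma pd_cs {F : EE n → ℝ} (hc : HasCompactSupport F) (v : EE n) :
    HasCompactSupport fun x => fderiv ℝ F x v :=
  (hc.fderiv ℝ).comp_left (g := fun l : EE n →L[ℝ] ℝ => l v) (by simp)

lemma lap_pd {F : EE n → ℝ} (hF : ContDiff ℝ (⊤ : ℕ∞) F) (x : EE n) :
    laplacian F x = ∑ i, fderiv ℝ (fun y => fderiv ℝ F y (EuclideanSpace.single i 1)) x (EuclideanSpace.single i 1) := by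
  rw [lap_eq]
  refine Finset.sum_congr rfl fun i _ => ?_
  have h1 : ContDiff ℝ (⊤ : ℕ∞) (fderiv ℝ F) := hF.fderiv_right (by simp)
  have := fderiv_clm_apply (h1.differentiable (by simp) x)
    (differentiableAt_const (c := (EuclideanSpace.single i 1 : EE n)))
  rw [this]
  simp

lemma lap_sm {F : EE n → ℝ} (hF : ContDiff ℝ (⊤ : ℕ∞) F) : ContDiff ℝ (⊤ : ℕ∞) (laplacian F) :=
  contDiff_iff_contDiffAt.mpr fun _ => lap_smooth hF.contDiffAt

lemma lap_cs {F : EE n → ℝ} (hc : HasCompactSupport F) : HasCompactSupport (laplacian F) := by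
  have h2 : HasCompactSupport (fderiv ℝ (fderiv ℝ F)) := (hc.fderiv ℝ).fderiv ℝ
  refine h2.mono fun x hx => ?_
  intro h0; apply hx
  rw [lap_eq]
  rw [h0]; simp

lemma green {F G : EE n → ℝ} (hF : ContDiff ℝ (⊤ : ℕ∞) F) (hG : ContDiff ℝ (⊤ : ℕ∞) G)
    (hc : HasCompactSupport F) :
    ∫ x, F x * laplacian G x =
      - ∑ i, ∫ x, fderiv ℝ F x (EuclideanSpace.single i 1) * fderiv ℝ G x (EuclideanSpace.single i 1) := by
  simp_rw [lap_pd hG, Finset.mul_sum]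
  rw [integral_finsetSum, ← Finset.sum_neg_distrib]
  · exact Finset.sum_congr rfl fun i _ => ibp1 hF (pd_smooth hG _) hc _
  · intro i _
    exact (hF.continuous.mul (pd_smooth (pd_smooth hG _) _).continuous).integrable_of_hasCompactSupport
      hc.mul_right

lemma green2 {F G : EE n → ℝ} (hF : ContDiff ℝ (⊤ : ℕ∞) F) (hG : ContDiff ℝ (⊤ : ℕ∞) G)
    (hc : HasCompactSupport F) (hc' : HasCompactSupport G) :
    ∫ x, F x * laplacian G x = ∫ x, laplacian F x * G x := by
  rw [green hF hG hc]
  have : ∫ x, laplacian F x * G x = ∫ x, G x * laplacian F x := by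
    congr 1; funext x; ring
  rw [this, green hG hF hc']
  congr 1
  refine Finset.sum_congr rfl fun i _ => ?_
  congr 1; funext x; ring

lemma grad_norm (g : EE n → ℝ) (x : EE n) :
    ‖gradient g x‖^2 = ∑ i, fderiv ℝ g x (EuclideanSpace.single i 1) * fderiv ℝ g x (EuclideanSpace.single i 1) := by
  rw [EuclideanSpace.real_norm_sq_eq]
  refine Finset.sum_congr rfl fun i _ => ?_
  have : fderiv ℝ g x (EuclideanSpace.single i 1) = (gradient g x) i := by
    have : fderiv ℝ g x = InnerProductSpace.toDual ℝ (EE n) (gradient g x) := by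
      simp [gradient]
    rw [this, InnerProductSpace.toDual_apply_apply, EuclideanSpace.inner_single_right]
    simp
  rw [this]; ring

lemma energy_eq {F : EE n → ℝ} (hF : ContDiff ℝ (⊤ : ℕ∞) F) (hc : HasCompactSupport F) :
    ∫ x, ‖gradient (laplacian F) x‖^2 = - ∫ x, F x * laplacian (laplacian (laplacian F)) x := by
  have h1 := lap_sm hF
  have c1 := lap_cs hc
  rw [green2 hF (lap_sm h1) hc (lap_cs c1), green h1 h1 c1, neg_neg]
  simp_rw [grad_norm]
  rw [integral_finsetSum]
  intro i _
  exact ((pd_smooth h1 _).continuous.mul (pd_smooth h1 _).continuous).integrable_of_hasCompactSupport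
      (pd_cs c1 _).mul_right

/-! ### Conjugation -/

lemma D_Nr (hn : 1 ≤ n) (s : ℝ) (w : AA n) :
    (cy n hn).D (Nr s * w) = Nr s * ((cy n hn).D w + s • w) := by
  have : (cy n hn).D (Nr s) = s • Nr s := by
    have := X_Nr (ContinuousLinearMap.id ℝ (EE n)) id_inner s
    rw [one_mul] at this
    exact this
  rw [(cy n hn).leibniz, this, mul_add, mul_smul_comm, smul_mul_assoc, add_comm]

lemma Nr_rad (hn : 1 ≤ n) (s : ℝ) : (Nr s : AA n) ∈ (cy n hn).Rad := (tm n hn).R_rad _ (Nr_smooth s)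

lemma lap_conj (hn : 1 ≤ n) (s : ℝ) (f w : AA n) (h : ∀ x, x ≠ 0 → f x = (Nr s * w : AA n) x) :
    ∀ x, x ≠ 0 → lapA f x = (Nr (s-2) * (cy n hn).QQ ((((n:ℝ)-2)/2)^2) (s + ((n:ℝ)-2)/2) w : AA n) x := by
  intro x hx
  have h1 := lap_polar hn f hx
  have hD : ∀ g : AA n, (cy n hn).D g = X (.id ℝ _) g := fun _ => rfl
  have hDf : (cy n hn).D f = (cy n hn).D (Nr s * w) := X_congr _ h
  have hΛf : (cy n hn).Lam f = (cy n hn).Lam (Nr s * w) := by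
    show (pre n hn).lam f = (pre n hn).lam _
    rw [PreCyl.lam_apply, PreCyl.lam_apply]
    congr 1
    refine Finset.sum_congr rfl fun q _ => ?_
    show X _ (X _ _) = X _ (X _ _)
    rw [X_congr _ h]
  rw [hDf, hΛf, (cy n hn).Lam_rad _ (Nr_rad hn s), D_Nr, D_Nr] at h1
  have h2 : (Nr s * ((cy n hn).D ((cy n hn).D w + s • w) + s • ((cy n hn).D w + s • w)) +
      ((n:ℝ)-2) • (Nr s * ((cy n hn).D w + s • w)) - Nr s * (cy n hn).Lam w : AA n) =
      Nr s * (cy n hn).QQ ((((n:ℝ)-2)/2)^2) (s + ((n:ℝ)-2)/2) w := by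
    rw [Cyl.QQ, ← mul_smul_comm, ← mul_add, ← mul_sub]
    congr 1
    rw [map_add, map_smul]
    module
  rw [h2, mul_ap, Nr_ap _ hx] at h1
  rw [mul_ap, Nr_ap _ hx]
  have hp : 0 < ‖x‖ := norm_pos_iff.mpr hx
  show laplacian (f : EE n → ℝ) x = _
  rw [Real.rpow_sub hp, Real.rpow_two]
  rw [div_mul_eq_mul_div, eq_div_iff (by positivity), ← h1]
  ring

lemma lap3_conj (hn : 1 ≤ n) (s : ℝ) (f w : AA n) (h : ∀ x, x ≠ 0 → f x = (Nr s * w : AA n) x) :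
    ∀ x, x ≠ 0 → laplacian (laplacian (laplacian (f : EE n → ℝ))) x =
      ‖x‖ ^ (s - 6) * (cy n hn).PP (s + ((n:ℝ)-6)/2) ((((n:ℝ)-2)/2)^2) w x := by
  intro x hx
  have h1 := lap_conj hn (s-2-2) _ _ (lap_conj hn (s-2) _ _ (lap_conj hn s f w h)) x hx
  rw [mul_ap, Nr_ap _ hx] at h1
  rw [Cyl.PP_eq]
  rw [show s + ((n:ℝ)-6)/2 - 2 = s - 2 - 2 + ((n:ℝ)-2)/2 by ring, show s + ((n:ℝ)-6)/2 = s - 2 + ((n:ℝ)-2)/2 by ring,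
      show s - 2 + ((n:ℝ)-2)/2 + 2 = s + ((n:ℝ)-2)/2 by ring, show s - 6 = s - 2 - 2 - 2 by ring]
  exact h1

lemma lap_trans (u : EE n → ℝ) (c : EE n) : laplacian (fun x => u (c + x)) = fun x => laplacian u (c + x) := by
  funext x
  rw [lap_eq, lap_eq]
  have h1 : ∀ {F : Type} [NormedAddCommGroup F] [NormedSpace ℝ F] (g : EE n → F), fderiv ℝ (fun x => g (c + x)) = fun x => fderiv ℝ g (c + x) := by
    intro F _ _ g; funext y; exact fderiv_comp_add_left c
  rw [h1, h1]

end AA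

namespace AA
variable {n : ℕ}

def vA (u : EE n → ℝ) (hu : ContDiff ℝ (⊤ : ℕ∞) u) (c : EE n) : AA n :=
  ⟨fun x => u (c + x), fun _ _ => (hu.comp (contDiff_const.add contDiff_id)).contDiffAt⟩

def wA (u : EE n → ℝ) (hu : ContDiff ℝ (⊤ : ℕ∞) u) (k : ℝ) (c : EE n) : AA n := Nr k * vA u hu c

lemma wA_ap (u : EE n → ℝ) (hu : ContDiff ℝ (⊤ : ℕ∞) u) (k : ℝ) (c : EE n) {x : EE n} (hx : x ≠ 0) :
    wA u hu k c x = ‖x‖^k * u (c + x) := by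
  rw [wA, mul_ap, Nr_ap _ hx]; rfl

def fA (hn : 1 ≤ n) (u : EE n → ℝ) (hu : ContDiff ℝ (⊤ : ℕ∞) u) (k : ℝ) (c : EE n) : AA n :=
  - (cy n hn).PP (-k + ((n:ℝ)-6)/2) ((((n:ℝ)-2)/2)^2) (wA u hu k c)

lemma fA_ap (hn : 1 ≤ n) {u : EE n → ℝ} (hu : ContDiff ℝ (⊤ : ℕ∞) u) {k p : ℝ} (hk : k * (p - 1) = 6)
    (heq : ∀ x, laplacian (laplacian (laplacian u)) x = -(|u x| ^ (p - 1) * u x)) (c : EE n)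
    {x : EE n} (hx : x ≠ 0) :
    fA hn u hu k c x = |wA u hu k c x| ^ (p-1) * wA u hu k c x := by
  have hpos : 0 < ‖x‖ := norm_pos_iff.mpr hx
  have h1 := lap3_conj hn (-k) (vA u hu c) (wA u hu k c) (fun y hy => by
    have : 0 < ‖y‖ := norm_pos_iff.mpr hy
    rw [mul_ap, Nr_ap _ hy, wA_ap _ _ _ _ hy, ← mul_assoc, ← Real.rpow_add this, neg_add_cancel,
      Real.rpow_zero, one_mul]; rfl) x hx
  have h2 : laplacian (laplacian (laplacian (vA u hu c : EE n → ℝ))) x = -(|u (c+x)| ^ (p-1) * u (c+x)) := by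
    show laplacian (laplacian (laplacian (fun x => u (c + x)))) x = _
    rw [lap_trans, lap_trans, lap_trans]; exact heq (c + x)
  rw [h2] at h1
  rw [wA_ap _ _ _ _ hx, abs_mul, abs_of_pos (Real.rpow_pos_of_pos hpos _),
    Real.mul_rpow (by positivity) (abs_nonneg _), ← Real.rpow_mul hpos.le, hk, fA, neg_ap]
  have h3 : ‖x‖ ^ (-k-6) * ‖x‖ ^ (6+k) = 1 := by
    rw [← Real.rpow_add hpos, show -k-6+(6+k) = (0:ℝ) by ring, Real.rpow_zero]
  have h4 : ‖x‖ ^ (6:ℝ) * ‖x‖ ^ k = ‖x‖^(6+k) := by rw [← Real.rpow_add hpos]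
  rw [show ‖x‖ ^ (6:ℝ) * |u (c+x)| ^ (p-1) * (‖x‖^k * u (c+x)) = (‖x‖ ^ (6:ℝ) * ‖x‖ ^ k) * (|u (c+x)| ^ (p-1) * u (c+x)) by ring,
    h4]
  have h5 : |u (c + x)| ^ (p - 1) * u (c + x) = - (‖x‖ ^ (-k - 6) *
    ((cy n hn).PP (-k + ((n:ℝ)-6)/2) ((((n:ℝ)-2)/2)^2) (wA u hu k c)) x) := by linarith
  rw [h5]
  linear_combination (((cy n hn).PP (-k + ((n:ℝ)-6)/2) ((((n:ℝ)-2)/2)^2) (wA u hu k c)) x) * h3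

lemma wf_ap (hn : 1 ≤ n) {u : EE n → ℝ} (hu : ContDiff ℝ (⊤ : ℕ∞) u) {k p : ℝ} (hp : 1 < p) (hk : k * (p - 1) = 6)
    (heq : ∀ x, laplacian (laplacian (laplacian u)) x = -(|u x| ^ (p - 1) * u x)) (c : EE n)
    {x : EE n} (hx : x ≠ 0) :
    (wA u hu k c * fA hn u hu k c : AA n) x = |wA u hu k c x| ^ (p+1) := by
  rw [mul_ap, fA_ap hn hu hk heq c hx]
  rw [show p + 1 = (p - 1) + 2 by ring, Real.rpow_add' (abs_nonneg _) (by linarith), Real.rpow_two, sq_abs]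
  ring

lemma sol (hn : 1 ≤ n) {u : EE n → ℝ} (hu : ContDiff ℝ (⊤ : ℕ∞) u) {k p : ℝ} (hp : 1 < p) (hk : k * (p - 1) = 6)
    (heq : ∀ x, laplacian (laplacian (laplacian u)) x = -(|u x| ^ (p - 1) * u x)) (c : EE n) :
    (cy n hn).Sol (-k + ((n:ℝ)-6)/2) ((((n:ℝ)-2)/2)^2) p (wA u hu k c) (fA hn u hu k c) where
  eq := rfl
  pow x := by
    rw [ev_ap, ev_ap, wf_ap hn hu hp hk heq c x.2]
  Dx x := by
    rw [ev_ap, ev_ap, mul_ap, fA_ap hn hu hk heq c x.2]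
    show fderiv ℝ ((wA u hu k c * fA hn u hu k c : AA n) : EE n → ℝ) x.1 x.1
      = (p+1) * (_ * fderiv ℝ (wA u hu k c : EE n → ℝ) x.1 x.1)
    have h1 : ((wA u hu k c * fA hn u hu k c : AA n) : EE n → ℝ) =ᶠ[nhds x.1]
        ((fun y : ℝ => |y| ^ (p+1)) ∘ (wA u hu k c : EE n → ℝ)) := by
      filter_upwards [isOpen_ne.mem_nhds x.2] with y hy
      exact wf_ap hn hu hp hk heq c hy
    have h2 := (hasDerivAt_abs_rpow (wA u hu k c x.1) (p := p+1) (by linarith)).comp_hasFDerivAt x.1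
      ((df (wA u hu k c) x.2).hasFDerivAt)
    rw [h1.fderiv_eq, h2.fderiv]
    simp only [ContinuousLinearMap.coe_smul', Pi.smul_apply, smul_eq_mul]
    rw [show p + 1 - 2 = p - 1 by ring]
    ring

/-- stability transfers to the cylinder -/
lemma stab (hn : 1 ≤ n) {u : EE n → ℝ} (hu : ContDiff ℝ (⊤ : ℕ∞) u) {k p : ℝ} (hp : 1 < p) (hk : k * (p - 1) = 6)
    (heq : ∀ x, laplacian (laplacian (laplacian u)) x = -(|u x| ^ (p - 1) * u x)) (c : EE n) (a b : ℝ)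
    (hst : ∀ φ : EE n → ℝ, ContDiff ℝ (⊤ : ℕ∞) φ → HasCompactSupport φ →
      (∀ x, φ x ≠ 0 → Real.exp a ≤ ‖x - c‖ ∧ ‖x - c‖ ≤ Real.exp b) →
      p * (∫ x, |u x| ^ (p - 1) * φ x ^ 2) ≤ ∫ x, ‖gradient (laplacian φ) x‖ ^ 2) :
    (tm n hn).Stab ((((n:ℝ)-2)/2)^2) p (wA u hu k c) (fA hn u hu k c) a b := by
  intro χ hχ hs
  have hn0 : -(n:ℝ) ≠ 0 := by
    have : (n:ℝ) ≠ 0 := by exact_mod_cast (by omega : n ≠ 0)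
    simpa using this
  set w := wA u hu k c with hw
  set f := fA hn u hu k c with hf
  have hRR : (tm n hn).R χ = R χ := rfl
  rw [hRR]
  have hRcs : (R χ : AA n) ∈ CS n := R_CS hχ a b hs
  set ψ : AA n := R χ * w with hψ
  have hψcs : ψ ∈ CS n := (CS n).mul_mem_right _ hRcs
  have hψ0 : ψ 0 = 0 := by rw [hψ, mul_ap, R_zero, zero_mul]
  set s : ℝ := -(((n:ℝ)-6)/2) with hsdef
  obtain ⟨g1, g2⟩ := gd hψcs s (Or.inr hψ0)
  set φ0 : EE n → ℝ := fun x => ψ x * ‖x‖ ^ s with hφ0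
  have hφ00 : φ0 0 = 0 := by rw [hφ0]; simp only [hψ0, zero_mul]
  -- the energy
  have hE : ∫ x, ‖gradient (laplacian φ0) x‖ ^ 2 = (cy n hn).SS ((((n:ℝ)-2)/2)^2) ψ := by
    rw [energy_eq g1 g2, Cyl.SS_eq _ (show ψ ∈ (cy n hn).CS from hψcs)]
    congr 1
    rw [show (cy n hn).I = II n hn from rfl, II_eq hn ((CS n).mul_mem_right _ hψcs)]
    congr 1; funext x
    by_cases hx : x = 0
    · rw [hx, hφ00]; simp [Real.zero_rpow hn0]
    · have hpos : 0 < ‖x‖ := norm_pos_iff.mpr hx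
      have h1 := lap3_conj hn s ⟨φ0, fun y _ => g1.contDiffAt⟩ ψ (fun y hy => by
        rw [mul_ap, Nr_ap _ hy, mul_comm]) x hx
      have h1' : laplacian (laplacian (laplacian φ0)) x =
        ‖x‖ ^ (s - 6) * (cy n hn).PP (s + ((n:ℝ)-6)/2) ((((n:ℝ)-2)/2)^2) ψ x := h1
      rw [h1', mul_ap, hφ0, show s + ((n:ℝ)-6)/2 = 0 by rw [hsdef]; ring]
      have h2 : ‖x‖ ^ (-(n:ℝ)) = ‖x‖ ^ s * ‖x‖ ^ (s-6) := by
        rw [← Real.rpow_add hpos]; congr 1; rw [hsdef]; ring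
      rw [h2]; ring
  -- the potential
  have hP : ∫ x, |u (c + x)| ^ (p-1) * φ0 x ^ 2 = (cy n hn).I (R χ ^ 2 * (w * f)) := by
    rw [show (cy n hn).I = II n hn from rfl, II_eq hn ((CS n).mul_mem_right _ (Ideal.pow_mem_of_mem _ hRcs 2 (by norm_num)))]
    congr 1; funext x
    by_cases hx : x = 0
    · rw [hx, hφ00]; simp [Real.zero_rpow hn0]
    · have hpos : 0 < ‖x‖ := norm_pos_iff.mpr hx
      rw [mul_ap, pow_ap, mul_ap, hf, fA_ap hn hu hk heq c hx, ← hw, hφ0]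
      simp only
      rw [hψ, mul_ap, hw, wA_ap _ _ _ _ hx, abs_mul, abs_of_pos (Real.rpow_pos_of_pos hpos _),
        Real.mul_rpow (by positivity) (abs_nonneg _), ← Real.rpow_mul hpos.le, hk]
      have h2 : ‖x‖ ^ s * ‖x‖ ^ s = ‖x‖ ^ (6:ℝ) * ‖x‖ ^ (-(n:ℝ)) := by
        rw [← Real.rpow_add hpos, ← Real.rpow_add hpos]; congr 1; rw [hsdef]; ring
      linear_combination (|u (c + x)| ^ (p-1) * (R χ x)^2 * (‖x‖^k * u (c+x))^2) * h2
  rw [← hE, ← hP]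
  -- translate
  have key := hst (fun x => φ0 (-c + x)) (g1.comp (contDiff_const.add contDiff_id))
    (g2.comp_homeomorph (Homeomorph.addLeft (-c))) (fun x hx => by
      have hx0 : -c + x ≠ 0 := by
        intro h; apply hx; simp only [h, hφ00]
      have hR : R χ (-c + x) ≠ 0 := by
        intro h; apply hx
        simp only [hφ0, hψ, mul_ap, h, zero_mul]
      rw [R_ap hχ hx0] at hR
      have hpos : 0 < ‖x - c‖ := by rw [show x - c = -c + x by abel]; exact norm_pos_iff.mpr hx0
      rw [show -c + x = x - c by abel] at hR
      by_contra hc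
      apply hR
      apply hs
      by_contra hcc
      push Not at hcc
      exact hc ⟨((Real.lt_log_iff_exp_lt hpos).mp hcc.1).le, ((Real.log_lt_iff_lt_exp hpos).mp hcc.2).le⟩)
  have e1 : ∫ x, |u x| ^ (p - 1) * φ0 (-c + x) ^ 2 = ∫ x, |u (c + x)| ^ (p-1) * φ0 x ^ 2 := by
    rw [← integral_add_left_eq_self (fun x => |u x| ^ (p - 1) * φ0 (-c + x) ^ 2) c]
    simp
  have e2 : ∫ x, ‖gradient (laplacian fun x => φ0 (-c + x)) x‖ ^ 2 = ∫ x, ‖gradient (laplacian φ0) x‖ ^ 2 := by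
    rw [lap_trans]
    have : ∀ x, gradient (fun x => laplacian φ0 (-c + x)) x = gradient (laplacian φ0) (-c + x) := by
      intro x
      rw [gradient, gradient, fderiv_comp_add_left]
    simp_rw [this]
    exact integral_add_left_eq_self (fun x => ‖gradient (laplacian φ0) x‖ ^ 2) (-c)
  rw [e1, e2] at key
  exact key

end AA

namespace AA
variable {n : ℕ}

/-- stability against test functions supported in a closed ball -/
def StabOn (u : EE n → ℝ) (p : ℝ) (y : EE n) (r : ℝ) : Prop :=
  ∀ φ : EE n → ℝ, ContDiff ℝ (⊤ : ℕ∞) φ → HasCompactSupport φ → (∀ x, φ x ≠ 0 → ‖x - y‖ ≤ r) →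
      p * (∫ x, |u x| ^ (p - 1) * φ x ^ 2) ≤ ∫ x, ‖gradient (laplacian φ) x‖ ^ 2

lemma rpow_ratio {a r z : ℝ} (hr : 0 < r) (h1 : r / 2 ≤ z) (h2 : z ≤ 3 * r / 2) :
    1 ≤ ((2:ℝ) ^ (2 * |a|) * r ^ (2 * a)) * z ^ (-(2 * a)) := by
  have hz : 0 < z := by linarith
  rw [mul_assoc, Real.rpow_def_of_pos two_pos, Real.rpow_def_of_pos hr, Real.rpow_def_of_pos hz,
    ← Real.exp_add, ← Real.exp_add]
  apply Real.one_le_exp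
  have l1 : Real.log r - Real.log 2 ≤ Real.log z := by
    rw [← Real.log_div hr.ne' two_ne_zero]; exact Real.log_le_log (by linarith) h1
  have l2 : Real.log z ≤ Real.log r + Real.log 2 := by
    rw [← Real.log_mul hr.ne' two_ne_zero]; exact Real.log_le_log hz (by linarith)
  have h3 : |Real.log r - Real.log z| ≤ Real.log 2 := by rw [abs_le]; constructor <;> linarith
  have h4 : |a * (Real.log r - Real.log z)| ≤ |a| * Real.log 2 := by
    rw [abs_mul]; exact mul_le_mul_of_nonneg_left h3 (abs_nonneg _)
  have h5 := neg_abs_le (a * (Real.log r - Real.log z))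
  nlinarith

lemma ball_le (hn : 1 ≤ n) {u : EE n → ℝ} (hu : ContDiff ℝ (⊤ : ℕ∞) u) {k p : ℝ} (hp : 1 < p) (hk : k * (p - 1) = 6)
    (heq : ∀ x, laplacian (laplacian (laplacian u)) x = -(|u x| ^ (p - 1) * u x)) (c y : EE n) {r : ℝ}
    (hr : 0 < r) (hc : ‖y - c‖ = r) {α : ℝ} (hα : α = -k + ((n:ℝ)-6)/2) :
    ∫ x in Metric.closedBall y (r/2), |u x| ^ (p+1) ≤ ((2:ℝ) ^ (2 * |α|) * r ^ (2 * α)) *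
      (cy n hn).I ((tm n hn).R (cut (Real.log r - 2) (Real.log r + 2)) * (wA u hu k c * fA hn u hu k c)) := by
  have hn0 : -(n:ℝ) ≠ 0 := by
    have : (n:ℝ) ≠ 0 := by exact_mod_cast (by omega : n ≠ 0)
    simpa using this
  set M := ((2:ℝ) ^ (2 * |α|) * r ^ (2 * α)) with hM
  have hM0 : 0 < M := by positivity
  set χ := cut (Real.log r - 2) (Real.log r + 2) with hχ
  have sχ : ContDiff ℝ (⊤ : ℕ∞) χ := cut_smooth _ _
  have hRcs : (R χ : AA n) ∈ CS n := R_CS sχ _ _ (fun s hs => cut_zero hs)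
  set F : AA n := R χ * (wA u hu k c * fA hn u hu k c) with hF
  have hFcs : F ∈ CS n := (CS n).mul_mem_right _ hRcs
  have e0 : (cy n hn).I ((tm n hn).R χ * (wA u hu k c * fA hn u hu k c)) = ∫ x, F x * ‖x‖ ^ (-(n:ℝ)) := II_eq hn hFcs
  rw [e0]
  obtain ⟨g1, g2⟩ := gd hFcs (-(n:ℝ)) (Or.inl hn0)
  set G : EE n → ℝ := fun x => F x * ‖x‖ ^ (-(n:ℝ)) with hG
  have Gnn : ∀ x, 0 ≤ G x := by
    intro x
    by_cases hx : x = 0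
    · simp only [hG, hx, norm_zero, Real.zero_rpow hn0, mul_zero, le_refl]
    · simp only [hG]
      refine mul_nonneg ?_ (by positivity)
      rw [hF, mul_ap, R_ap sχ hx, wf_ap hn hu hp hk heq c hx]
      exact mul_nonneg (cut_nn _ _ _) (by positivity)
  have Gi : Integrable (fun x => G (x - c)) := by
    have := g1.continuous.integrable_of_hasCompactSupport g2 (μ := volume)
    exact this.comp_sub_right c
  rw [← integral_sub_right_eq_self G c, ← integral_const_mul]
  have cu : Continuous fun x => |u x| ^ (p+1) := by
    have := hu.continuous
    exact (this.abs).rpow_const (fun x => Or.inr (by linarith))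
  calc _ ≤ ∫ x in Metric.closedBall y (r/2), M * G (x - c) := by
        refine setIntegral_mono_on (cu.continuousOn.integrableOn_compact (isCompact_closedBall _ _))
          (Gi.const_mul M).integrableOn Metric.isClosed_closedBall.measurableSet ?_
        intro x hx
        rw [Metric.mem_closedBall, dist_eq_norm] at hx
        have hz1 : r / 2 ≤ ‖x - c‖ := by
          have : ‖y - c‖ ≤ ‖x - c‖ + ‖x - y‖ := by
            rw [show y - c = (x - c) - (x - y) by abel]; exact norm_sub_le _ _
          linarith
        have hz2 : ‖x - c‖ ≤ 3 * r / 2 := by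
          have : ‖x - c‖ ≤ ‖x - y‖ + ‖y - c‖ := by
            rw [show x - c = (x - y) + (y - c) by abel]; exact norm_add_le _ _
          linarith
        have hzp : 0 < ‖x - c‖ := by linarith
        have hz : x - c ≠ 0 := norm_pos_iff.mp hzp
        have hcut : χ (Real.log ‖x - c‖) = 1 := by
          have e2 : Real.log 2 ≤ 2 := by have := Real.log_two_lt_d9; linarith
          refine cut_one ?_ ?_
          · have : Real.log r - Real.log 2 ≤ Real.log ‖x - c‖ := by
              rw [← Real.log_div hr.ne' two_ne_zero]; exact Real.log_le_log (by linarith) hz1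
            linarith
          · have : Real.log ‖x - c‖ ≤ Real.log r + Real.log 2 := by
              rw [← Real.log_mul hr.ne' two_ne_zero]; exact Real.log_le_log hzp (by linarith)
            linarith
        have hGx : G (x - c) = ‖x - c‖ ^ (-(2*α)) * |u x| ^ (p+1) := by
          simp only [hG]
          rw [hF, mul_ap, R_ap sχ hz, hcut, wf_ap hn hu hp hk heq c hz, wA_ap _ _ _ _ hz, one_mul,
            abs_mul, abs_of_pos (Real.rpow_pos_of_pos hzp _), Real.mul_rpow (by positivity) (abs_nonneg _),
            ← Real.rpow_mul hzp.le, show c + (x - c) = x by abel,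
            show ‖x - c‖ ^ (k * (p+1)) * |u x| ^ (p+1) * ‖x - c‖ ^ (-(n:ℝ)) =
              ‖x - c‖ ^ (k * (p+1)) * ‖x - c‖ ^ (-(n:ℝ)) * |u x| ^ (p+1) by ring, ← Real.rpow_add hzp]
          congr 2
          rw [hα]; linear_combination hk
        rw [hGx, ← mul_assoc]
        exact le_mul_of_one_le_left (by positivity) (rpow_ratio hr hz1 hz2)
    _ ≤ _ := setIntegral_le_integral (Gi.const_mul M) (Eventually.of_forall fun x => mul_nonneg hM0.le (Gnn _))

lemma ex_center (hn : 1 ≤ n) (y : EE n) {r : ℝ} (hr : 0 < r) : ∃ c : EE n, ‖y - c‖ = r := by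
  refine ⟨y - r • EuclideanSpace.single ⟨0, by omega⟩ 1, ?_⟩
  simp [norm_smul, abs_of_pos hr]

theorem core (hn : 1 ≤ n) {p : ℝ} (hp : 1 < p) (hpc : 15 ≤ n → p < pc n)
    {u : EE n → ℝ} (hu : ContDiff ℝ (⊤ : ℕ∞) u)
    (heq : ∀ x, laplacian (laplacian (laplacian u)) x = -(|u x| ^ (p - 1) * u x))
    {α : ℝ} (hα : α = -(6/(p-1)) + ((n:ℝ)-6)/2) {ε : ℝ} (hε : 0 < ε) :
    ∃ B : ℝ, 1 ≤ B ∧ ∀ (y : EE n) (l : ℝ), 0 < l → StabOn u p y (B * l) →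
      ∫ x in Metric.closedBall y (l/2), |u x| ^ (p+1) ≤ ε * l ^ (2 * α) := by
  have hk : (6/(p-1)) * (p - 1) = 6 := by
    have : p - 1 ≠ 0 := by linarith
    field_simp
  set k := 6/(p-1) with hkd
  set m2 : ℝ := (((n:ℝ)-2)/2)^2 with hm2
  set K : ℝ := (2:ℝ) ^ (2 * |α|) with hK
  have hK0 : 0 < K := by positivity
  rcases le_or_gt 0 α with h0 | h0
  · have hco : α = 0 ∨ Cyl.Coef α m2 p := by
      rcases h0.eq_or_lt with h | h
      · exact Or.inl h.symm
      · exact Or.inr (coef_of n p hp hpc α m2 (by rw [hα]; ring) hm2 h)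
    obtain ⟨H, hH, hD⟩ := (tm n hn).absD α m2 p hp hco (ε := ε / K) (by positivity)
    refine ⟨Real.exp H + 1, by linarith [Real.exp_pos H], fun y l hl hst => ?_⟩
    obtain ⟨c, hc⟩ := ex_center hn y hl
    refine (ball_le hn hu hp hk heq c y hl hc hα).trans ?_
    have := hD (Real.log l) (wA u hu k c) (fA hn u hu k c) (by rw [hα]; exact sol hn hu hp hk heq c)
      (stab hn hu hp hk heq c _ _ (fun φ h1 h2 h3 => hst φ h1 h2 (fun x hx => by
        have := (h3 x hx).2
        rw [Real.exp_add, Real.exp_log hl] at this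
        calc ‖x - y‖ = ‖(x - c) - (y - c)‖ := by congr 1; abel
          _ ≤ ‖x - c‖ + ‖y - c‖ := norm_sub_le _ _
          _ ≤ _ := by rw [hc]; linarith)))
    calc _ ≤ K * l ^ (2 * α) * (ε / K) := mul_le_mul_of_nonneg_left this (by positivity)
      _ = ε * l ^ (2 * α) := by field_simp
  · obtain ⟨C, hC, hA⟩ := (tm n hn).absA α m2 p hp
    obtain ⟨S, hS0, hS⟩ : ∃ S : ℝ, 1 ≤ S ∧ K * S ^ (2*α) * C ≤ ε := by
      have h1 : Tendsto (fun S : ℝ => K * S ^ (2*α) * C) atTop (nhds 0) := by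
        have := ((tendsto_rpow_neg_atTop (y := -(2*α)) (by linarith)).const_mul K).mul_const C
        simpa using this
      exact ((eventually_ge_atTop (1:ℝ)).and (h1.eventually_le_const hε)).exists
    have hSp : 0 < S := by linarith
    refine ⟨(Real.exp 10 + 1) * S, by nlinarith [Real.exp_pos 10], fun y l hl hst => ?_⟩
    have hr : 0 < S * l := by positivity
    obtain ⟨c, hc⟩ := ex_center hn y hr
    have hb := ball_le hn hu hp hk heq c y hr hc hα
    have := hA (Real.log (S * l)) (wA u hu k c) (fA hn u hu k c) (by rw [hα]; exact sol hn hu hp hk heq c)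
      (stab hn hu hp hk heq c _ _ (fun φ h1 h2 h3 => hst φ h1 h2 (fun x hx => by
        have := (h3 x hx).2
        rw [Real.exp_add, Real.exp_log hr] at this
        calc ‖x - y‖ = ‖(x - c) - (y - c)‖ := by congr 1; abel
          _ ≤ ‖x - c‖ + ‖y - c‖ := norm_sub_le _ _
          _ ≤ _ := by rw [hc]; linarith)))
    have cu : Continuous fun x => |u x| ^ (p+1) := by
      have := hu.continuous
      exact (this.abs).rpow_const (fun x => Or.inr (by linarith))
    calc ∫ x in Metric.closedBall y (l/2), |u x| ^ (p+1)
        ≤ ∫ x in Metric.closedBall y (S*l/2), |u x| ^ (p+1) := by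
          refine setIntegral_mono_set (cu.continuousOn.integrableOn_compact (isCompact_closedBall _ _))
            (Eventually.of_forall fun x => by positivity) (LE.le.eventuallyLE ?_)
          exact Metric.closedBall_subset_closedBall (by nlinarith)
      _ ≤ _ := hb
      _ ≤ K * (S*l) ^ (2 * α) * C := mul_le_mul_of_nonneg_left this (by positivity)
      _ = (K * S ^ (2*α) * C) * l ^ (2*α) := by rw [Real.mul_rpow hSp.le hl.le]; ring
      _ ≤ ε * l ^ (2*α) := mul_le_mul_of_nonneg_right hS (by positivity)

end AA

namespace AA
variable {n : ℕ}

/-! ### A mean value inequality -/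

/-- radial profile, smooth and supported in `(-∞,1]` -/
structure Prof (h : ℝ → ℝ) : Prop where
  sm : ContDiff ℝ (⊤ : ℕ∞) h
  z : ∀ t, 1 ≤ t → h t = 0

lemma Prof.prim {h : ℝ → ℝ} (hh : Prof h) : ∃ g, Prof g ∧ ∀ t, HasDerivAt g (-(h t)/2) t := by
  have hd : ∀ t, HasDerivAt (fun t => -(∫ s in (1:ℝ)..t, h s)/2) (-(h t)/2) t := by
    intro t
    exact ((hh.sm.continuous.integral_hasStrictDerivAt 1 t).hasDerivAt.neg).div_const 2
  refine ⟨fun t => -(∫ s in (1:ℝ)..t, h s)/2, ⟨?_, ?_⟩, hd⟩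
  · rw [contDiff_infty_iff_deriv]
    refine ⟨fun t => (hd t).differentiableAt, ?_⟩
    have : deriv (fun t => -(∫ s in (1:ℝ)..t, h s)/2) = fun t => -(h t)/2 := funext fun t => (hd t).deriv
    rw [this]
    exact hh.sm.neg.div_const 2
  · intro t ht
    have : ∫ s in (1:ℝ)..t, h s = ∫ s in (1:ℝ)..t, 0 := by
      apply intervalIntegral.integral_congr
      intro s hs
      rw [Set.uIcc_of_le ht] at hs
      exact hh.z s hs.1
    simp [this]

/-- radial kernel -/
def rk (h : ℝ → ℝ) (x : EE n) : ℝ := h (‖x‖^2)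

lemma Prof.rk_sm {h : ℝ → ℝ} (hh : Prof h) : ContDiff ℝ (⊤ : ℕ∞) (rk h : EE n → ℝ) :=
  hh.sm.comp (contDiff_norm_sq ℝ)

lemma Prof.rk_z {h : ℝ → ℝ} (hh : Prof h) {x : EE n} (hx : x ∉ Metric.closedBall (0 : EE n) 1) : rk h x = 0 := by
  apply hh.z
  rw [Metric.mem_closedBall, dist_zero_right, not_le] at hx
  nlinarith

lemma Prof.rk_cs {h : ℝ → ℝ} (hh : Prof h) : HasCompactSupport (rk h : EE n → ℝ) :=
  HasCompactSupport.intro (isCompact_closedBall (0 : EE n) 1) fun _ hx => hh.rk_z hx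

lemma rk_fd {h g : ℝ → ℝ} (hg : ∀ t, HasDerivAt g (-(h t)/2) t) (x v : EE n) :
    fderiv ℝ (rk g) x v = - (rk h x * inner ℝ x v) := by
  have h1 := (hg (‖x‖^2)).comp_hasFDerivAt x (hasStrictFDerivAt_norm_sq x).hasFDerivAt
  have h2 : fderiv ℝ (rk g) x = _ := h1.fderiv
  rw [h2]
  simp [rk]
  ring

/-- weighted averages -/
def av (h : ℝ → ℝ) (f : EE n → ℝ) (y : EE n) (s : ℝ) : ℝ := ∫ x, f (y + s • x) * rk h x

lemma av_deriv {h g : ℝ → ℝ} (hh : Prof h) (hg : Prof g) (hd : ∀ t, HasDerivAt g (-(h t)/2) t)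
    {f : EE n → ℝ} (hf : ContDiff ℝ (⊤ : ℕ∞) f) (y : EE n) (s : ℝ) :
    HasDerivAt (av h f y) (s * av g (laplacian f) y s) s := by
  have cf : Continuous (fderiv ℝ f) := hf.continuous_fderiv (by simp)
  have ch : Continuous (rk h : EE n → ℝ) := hh.rk_sm.continuous
  set F' : ℝ → EE n → ℝ := fun s x => fderiv ℝ f (y + s • x) x * rk h x with hF'
  have cF' : Continuous (Function.uncurry F') := by
    simp only [hF', Function.uncurry_def]
    refine Continuous.mul ?_ (by fun_prop)
    exact (cf.comp (by fun_prop)).clm_apply continuous_snd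
  obtain ⟨K, hK⟩ := ((isCompact_closedBall s 1).prod (isCompact_closedBall (0 : EE n) 1)).exists_bound_of_continuousOn
    cF'.continuousOn
  have key := (hasDerivAt_integral_of_dominated_loc_of_deriv_le (μ := volume) (F := fun s x => f (y + s • x) * rk h x)
    (F' := F') (x₀ := s) (s := Metric.ball s 1) (bound := (Metric.closedBall (0 : EE n) 1).indicator fun _ => K)
    (Metric.ball_mem_nhds s one_pos) ?_ ?_ ?_ ?_ ?_ ?_).2
  · have e : ∫ x, F' s x = s * av g (laplacian f) y s := by
      have e1 : ∀ x, F' s x = - ∑ i, fderiv ℝ (rk g) x (EuclideanSpace.single i 1) *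
          fderiv ℝ f (y + s • x) (EuclideanSpace.single i 1) := by
        intro x
        simp only [hF']
        rw [lin_sum (fderiv ℝ f (y + s • x)) x, Finset.sum_mul, ← Finset.sum_neg_distrib]
        refine Finset.sum_congr rfl fun i _ => ?_
        rw [rk_fd hd]
        have : inner ℝ x (EuclideanSpace.single i (1:ℝ)) = x i := by
          rw [EuclideanSpace.inner_single_right]; simp
        rw [this, smul_eq_mul]
        ring
      have sG : ∀ i : Fin n, ContDiff ℝ (⊤ : ℕ∞) (fun x : EE n => fderiv ℝ f (y + s • x) (EuclideanSpace.single i 1)) := by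
        intro i
        exact (pd_smooth hf (EuclideanSpace.single i 1)).comp (contDiff_const.add (contDiff_id.const_smul s))
      have e3 : ∀ x, s * laplacian f (y + s • x) = ∑ i, fderiv ℝ (fun x : EE n => fderiv ℝ f (y + s • x) (EuclideanSpace.single i 1)) x
          (EuclideanSpace.single i 1) := by
        intro x
        rw [lap_pd hf, Finset.mul_sum]
        refine Finset.sum_congr rfl fun i _ => ?_
        have h1 : HasFDerivAt (fun x : EE n => y + s • x) (s • ContinuousLinearMap.id ℝ (EE n)) x :=
          ((hasFDerivAt_id x).const_smul s).const_add y
        have h2 := (((pd_smooth hf (EuclideanSpace.single i 1)).differentiable (by simp) (y + s • x)).hasFDerivAt).comp x h1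
        have h3 : fderiv ℝ (fun x : EE n => fderiv ℝ f (y + s • x) (EuclideanSpace.single i 1)) x = _ := h2.fderiv
        rw [h3]
        simp
      calc ∫ x, F' s x = - ∑ i, ∫ x, fderiv ℝ (rk g) x (EuclideanSpace.single i 1) *
          fderiv ℝ f (y + s • x) (EuclideanSpace.single i 1) := by
            simp_rw [e1]
            rw [integral_neg, integral_finsetSum]
            intro i _
            exact ((pd_smooth hg.rk_sm _).continuous.mul (sG i).continuous).integrable_of_hasCompactSupport
              (pd_cs hg.rk_cs _).mul_right
        _ = ∑ i, ∫ x, rk g x * fderiv ℝ (fun x : EE n => fderiv ℝ f (y + s • x) (EuclideanSpace.single i 1)) x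
          (EuclideanSpace.single i 1) := by
            rw [← Finset.sum_neg_distrib]
            exact Finset.sum_congr rfl fun i _ => (ibp1 hg.rk_sm (sG i) hg.rk_cs _).symm
        _ = ∫ x, s * (laplacian f (y + s • x) * rk g x) := by
            rw [← integral_finsetSum]
            · congr 1; funext x; rw [← Finset.mul_sum, ← e3]; ring
            · intro i _
              exact (hg.rk_sm.continuous.mul (pd_smooth (sG i) _).continuous).integrable_of_hasCompactSupport
                hg.rk_cs.mul_right
        _ = _ := by rw [integral_const_mul]; rfl
    rw [← e]
    exact key
  · refine Eventually.of_forall fun t => Continuous.aestronglyMeasurable ?_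
    exact (hf.continuous.comp (by fun_prop)).mul ch
  · exact ((hf.continuous.comp (by fun_prop)).mul ch).integrable_of_hasCompactSupport hh.rk_cs.mul_left
  · exact (cF'.comp (by fun_prop : Continuous fun x : EE n => (s, x))).aestronglyMeasurable
  · refine Eventually.of_forall fun x t ht => ?_
    by_cases hx : x ∈ Metric.closedBall (0 : EE n) 1
    · rw [Set.indicator_of_mem hx]
      exact hK (t, x) ⟨Metric.ball_subset_closedBall ht, hx⟩
    · rw [Set.indicator_of_notMem hx]
      simp [hF', hh.rk_z hx]
  · exact (integrable_indicator_iff Metric.isClosed_closedBall.measurableSet).mpr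
      (integrableOn_const (measure_closedBall_lt_top.ne))
  · refine Eventually.of_forall fun x t _ => ?_
    have h1 : HasDerivAt (fun t : ℝ => y + t • x) x t := by
      simpa using ((hasDerivAt_id t).smul_const x).const_add y
    exact (((hf.differentiable (by simp) (y + t • x)).hasFDerivAt).comp_hasDerivAt t h1).mul_const _

lemma mv1 {f f' : ℝ → ℝ} (hf : ∀ s, HasDerivAt f (f' s) s) {C S : ℝ} (h0 : f 0 = 0)
    (hC : ∀ s ∈ Set.Icc 0 S, |f' s| ≤ C) : ∀ s ∈ Set.Icc 0 S, |f s| ≤ C * S := by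
  intro s hs
  have h := (convex_Icc (0:ℝ) S).norm_image_sub_le_of_norm_hasDerivWithin_le (f := f) (f' := f') (C := C)
    (fun x _ => (hf x).hasDerivWithinAt) hC (x := 0) (y := s) ⟨le_refl _, hs.1.trans hs.2⟩ hs
  rw [h0, sub_zero, sub_zero, Real.norm_eq_abs, Real.norm_eq_abs, abs_of_nonneg hs.1] at h
  have hC0 : 0 ≤ C := (abs_nonneg _).trans (hC s hs)
  exact h.trans (mul_le_mul_of_nonneg_left hs.2 hC0)

lemma mv3 {A0 A1 A2 A3 : ℝ → ℝ} (h0 : ∀ s, HasDerivAt A0 (s * A1 s) s) (h1 : ∀ s, HasDerivAt A1 (s * A2 s) s)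
    (h2 : ∀ s, HasDerivAt A2 (s * A3 s) s) {M S : ℝ} (hS : 0 < S) (hM : ∀ s ∈ Set.Icc 0 S, |A3 s| ≤ M) :
    |A0 0| ≤ 2 * (|A0 (S/3)| + |A0 (2*S/3)| + |A0 S|) + 3 * (M * S^6) := by
  have q2 : ∀ s : ℝ, HasDerivAt (fun s : ℝ => s^2/2) s s := fun s => by
    simpa using (hasDerivAt_pow 2 s).div_const 2
  have q4 : ∀ s : ℝ, HasDerivAt (fun s : ℝ => s^4/8) (s * (s^2/2)) s := fun s => by
    have := (hasDerivAt_pow 4 s).div_const 8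
    refine this.congr_deriv ?_
    push_cast; ring
  have b2 := mv1 (f := fun s => A2 s - A2 0) (fun s => (h2 s).sub_const _) (C := S * M) (S := S) (by simp) (fun s hs => by
    rw [abs_mul, abs_of_nonneg hs.1]
    exact mul_le_mul hs.2 (hM s hs) (abs_nonneg _) hS.le)
  have b1 := mv1 (f := fun s => A1 s - A1 0 - s^2/2 * A2 0) (f' := fun s => s * (A2 s - A2 0))
    (fun s => (((h1 s).sub_const _).sub ((q2 s).mul_const _)).congr_deriv (by ring))
    (C := S * (S * M * S)) (S := S) (by simp) (fun s hs => by
      rw [abs_mul, abs_of_nonneg hs.1]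
      exact mul_le_mul hs.2 (b2 s hs) (abs_nonneg _) hS.le)
  have b0 := mv1 (f := fun s => A0 s - A0 0 - s^2/2 * A1 0 - s^4/8 * A2 0) (f' := fun s => s * (A1 s - A1 0 - s^2/2 * A2 0))
    (fun s => ((((h0 s).sub_const _).sub ((q2 s).mul_const _)).sub ((q4 s).mul_const _)).congr_deriv (by ring))
    (C := S * (S * (S * M * S) * S)) (S := S) (by simp) (fun s hs => by
      rw [abs_mul, abs_of_nonneg hs.1]
      exact mul_le_mul hs.2 (b1 s hs) (abs_nonneg _) hS.le)
  have c1 := b0 (S/3) ⟨by positivity, by linarith⟩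
  have c2 := b0 (2*S/3) ⟨by positivity, by linarith⟩
  have c3 := b0 S ⟨hS.le, le_refl _⟩
  rw [show S * (S * (S * M * S) * S) * S = M * S^6 by ring] at c1 c2 c3
  set E := M * S^6
  rw [abs_le] at c1 c2 c3
  obtain ⟨c1a, c1b⟩ := c1
  obtain ⟨c2a, c2b⟩ := c2
  obtain ⟨c3a, c3b⟩ := c3
  have := le_abs_self (A0 (S/3))
  have := neg_abs_le (A0 (S/3))
  have := le_abs_self (A0 (2*S/3))
  have := neg_abs_le (A0 (2*S/3))
  have := le_abs_self (A0 S)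
  have := neg_abs_le (A0 S)
  have e2 : (2*S/3)^2/2 * A1 0 = 4 * ((S/3)^2/2 * A1 0) := by ring
  have e3 : S^2/2 * A1 0 = 9 * ((S/3)^2/2 * A1 0) := by ring
  have e4 : (2*S/3)^4/8 * A2 0 = 16 * ((S/3)^4/8 * A2 0) := by ring
  have e5 : S^4/8 * A2 0 = 81 * ((S/3)^4/8 * A2 0) := by ring
  rw [e2, e4] at c2a c2b
  rw [e3, e5] at c3a c3b
  rw [abs_le]
  constructor <;> linarith

lemma av_bound {h : ℝ → ℝ} (hh : Prof h) : ∃ K : ℝ, 0 < K ∧ ∀ (f : EE n → ℝ) (y : EE n) (s : ℝ) (M : ℝ), Continuous f →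
    (∀ x ∈ Metric.closedBall (0 : EE n) 1, |f (y + s • x)| ≤ M) → |av h f y s| ≤ K * M := by
  refine ⟨(∫ x : EE n, |rk h x|) + 1, by positivity, fun f y s M hf hM => ?_⟩
  have hM0 : 0 ≤ M := (abs_nonneg _).trans (hM 0 (by simp))
  have hi : Integrable (fun x : EE n => |rk h x|) :=
    (hh.rk_sm.continuous.abs).integrable_of_hasCompactSupport hh.rk_cs.abs
  calc |av h f y s| ≤ ∫ x : EE n, M * |rk h x| := by
        rw [av, ← Real.norm_eq_abs]
        refine norm_integral_le_of_norm_le (hi.const_mul M) (Eventually.of_forall fun x => ?_)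
        rw [Real.norm_eq_abs, abs_mul]
        by_cases hx : x ∈ Metric.closedBall (0 : EE n) 1
        · exact mul_le_mul_of_nonneg_right (hM x hx) (abs_nonneg _)
        · rw [hh.rk_z hx]; simp
    _ = M * ∫ x : EE n, |rk h x| := integral_const_mul _ _
    _ ≤ _ := by nlinarith

lemma young {a δ p : ℝ} (ha : 0 ≤ a) (hδ : 0 < δ) (hp : 0 < p) : a ≤ δ + δ ^ (-p) * a ^ (p+1) := by
  rcases le_or_gt a δ with h | h
  · have : 0 ≤ δ ^ (-p) * a ^ (p+1) := by positivity
    linarith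
  · have h1 : δ ^ (-p) * a ^ (p+1) = (a/δ) ^ p * a := by
      rw [Real.rpow_add (hδ.trans h), Real.rpow_one, Real.rpow_neg hδ.le, Real.div_rpow ha hδ.le]; ring
    have h2 : 1 ≤ (a/δ)^p := Real.one_le_rpow ((one_le_div hδ).mpr h.le) hp.le
    nlinarith

lemma av_bound2 {h : ℝ → ℝ} (hh : Prof h) : ∃ K : ℝ, 0 < K ∧ ∀ (f : EE n → ℝ) (y : EE n) (s δ p : ℝ), Continuous f →
    0 < s → 0 < δ → 0 < p → |av h f y s| ≤ K * (δ + δ ^ (-p) * (s⁻¹ ^ n * ∫ x in Metric.closedBall y s, |f x| ^ (p+1))) := by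
  obtain ⟨N, hN⟩ := (isCompact_closedBall (0 : EE n) 1).exists_bound_of_continuousOn
    (hh.rk_sm (n := n)).continuous.continuousOn
  have hN0 : 0 ≤ N := (norm_nonneg _).trans (hN 0 (by simp))
  set B := Metric.closedBall (0 : EE n) 1 with hB
  set V := volume.real B with hV
  refine ⟨N * V + N + 1, by positivity, fun f y s δ p hf hs hδ hp => ?_⟩
  set J := s⁻¹ ^ n * ∫ x in Metric.closedBall y s, |f x| ^ (p+1) with hJ
  have cg : Continuous fun x => |f x| ^ (p+1) := hf.abs.rpow_const (fun x => Or.inr (by linarith))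
  have hJ0 : 0 ≤ J := by
    rw [hJ]; exact mul_nonneg (by positivity) (integral_nonneg fun x => by positivity)
  have hJe : ∫ x in B, |f (y + s • x)| ^ (p+1) = J := by
    rw [← integral_indicator Metric.isClosed_closedBall.measurableSet, hJ,
      ← integral_indicator Metric.isClosed_closedBall.measurableSet]
    have e1 := Measure.integral_comp_smul_of_nonneg (volume : Measure (EE n))
      (fun x => (Metric.closedBall y s).indicator (fun x => |f x| ^ (p+1)) (y + x)) s (hR := hs.le)
    rw [integral_add_left_eq_self ((Metric.closedBall y s).indicator fun x => |f x| ^ (p+1)) y,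
      finrank_euclideanSpace_fin, smul_eq_mul, ← inv_pow] at e1
    rw [← e1]
    congr 1; funext x
    have hiff : x ∈ B ↔ y + s • x ∈ Metric.closedBall y s := by
      rw [hB, Metric.mem_closedBall, Metric.mem_closedBall, dist_zero_right, dist_eq_norm, add_sub_cancel_left,
        norm_smul, Real.norm_eq_abs, abs_of_pos hs]
      constructor
      · intro h; nlinarith
      · intro h; by_contra hc; push Not at hc; nlinarith
    by_cases hx : x ∈ B
    · rw [Set.indicator_of_mem hx, Set.indicator_of_mem (hiff.mp hx)]
    · rw [Set.indicator_of_notMem hx, Set.indicator_of_notMem (fun h => hx (hiff.mpr h))]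
  have i1 : IntegrableOn (fun x => |f (y + s • x)| ^ (p+1)) B :=
    (cg.comp (by fun_prop : Continuous fun x : EE n => y + s • x)).continuousOn.integrableOn_compact (isCompact_closedBall _ _)
  have i2 : IntegrableOn (fun _ => δ) B := integrableOn_const (measure_closedBall_lt_top.ne)
  have i3 : IntegrableOn (fun x => N * (δ + δ ^ (-p) * |f (y + s • x)| ^ (p+1))) B :=
    (i2.add (i1.const_mul _)).const_mul _
  calc |av h f y s| ≤ ∫ x, B.indicator (fun x => N * (δ + δ ^ (-p) * |f (y + s • x)| ^ (p+1))) x := by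
        rw [av, ← Real.norm_eq_abs]
        refine norm_integral_le_of_norm_le ((integrable_indicator_iff Metric.isClosed_closedBall.measurableSet).mpr i3)
          (Eventually.of_forall fun x => ?_)
        rw [Real.norm_eq_abs, abs_mul]
        by_cases hx : x ∈ B
        · rw [Set.indicator_of_mem hx, mul_comm]
          exact mul_le_mul (hN x hx) (young (abs_nonneg _) hδ hp) (abs_nonneg _) hN0
        · rw [hh.rk_z hx, Set.indicator_of_notMem hx]; simp
    _ = N * (V * δ + δ ^ (-p) * J) := by
        rw [integral_indicator Metric.isClosed_closedBall.measurableSet, integral_const_mul, integral_add i2 (i1.const_mul _),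
          integral_const_mul, hJe, setIntegral_const, smul_eq_mul]
    _ ≤ _ := by
        have : 0 ≤ δ ^ (-p) * J := by positivity
        have hV0 : 0 ≤ V := measureReal_nonneg
        have := mul_nonneg hN0 hV0
        nlinarith [mul_nonneg hN0 hδ.le, mul_nonneg this (by assumption : 0 ≤ δ ^ (-p) * J)]

theorem mean_value (n : ℕ) : ∃ C : ℝ, 0 < C ∧ ∀ (u : EE n → ℝ), ContDiff ℝ (⊤ : ℕ∞) u → ∀ (y : EE n) (S M δ p : ℝ),
    0 < S → 0 < δ → 0 < p → (∀ x ∈ Metric.closedBall y S, |laplacian (laplacian (laplacian u)) x| ≤ M) →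
    |u y| ≤ C * (δ + δ ^ (-p) * (S⁻¹ ^ n * ∫ x in Metric.closedBall y S, |u x| ^ (p+1)) + M * S^6) := by
  set h0 : ℝ → ℝ := fun t => Real.smoothTransition (1 - t) with hh0
  have P0 : Prof h0 := ⟨Real.smoothTransition.contDiff.comp (contDiff_const.sub contDiff_id), fun t ht =>
    Real.smoothTransition.zero_of_nonpos (by linarith)⟩
  obtain ⟨h1, P1, d1⟩ := P0.prim
  obtain ⟨h2, P2, d2⟩ := P1.prim
  obtain ⟨h3, P3, d3⟩ := P2.prim
  obtain ⟨K0, hK0, b0⟩ := av_bound2 (n := n) P0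
  obtain ⟨K3, hK3, b3⟩ := av_bound (n := n) P3
  set c0 : ℝ := ∫ x : EE n, rk h0 x with hc0
  have c0p : 0 < c0 := by
    refine (P0.rk_sm.continuous).integral_pos_of_hasCompactSupport_nonneg_nonzero P0.rk_cs
      (fun x => Real.smoothTransition.nonneg _) (x := 0) ?_
    simp [rk, hh0, Real.smoothTransition.one]
  refine ⟨c0⁻¹ * (6 * 3 ^ n * K0 + 3 * K3), by positivity, fun u hu y S M δ p hS hδ hp hM => ?_⟩
  have l1 := lap_sm hu
  have l2 := lap_sm l1
  have l3 := lap_sm l2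
  have m := mv3 (av_deriv P0 P1 d1 hu y) (av_deriv P1 P2 d2 l1 y) (av_deriv P2 P3 d3 l2 y) hS (M := K3 * M) (fun s hs => by
    refine b3 _ y s M l3.continuous fun x hx => hM _ ?_
    rw [Metric.mem_closedBall, dist_zero_right] at hx
    rw [Metric.mem_closedBall, dist_eq_norm, add_sub_cancel_left, norm_smul, Real.norm_eq_abs, abs_of_nonneg hs.1]
    nlinarith [hs.1, hs.2, norm_nonneg x])
  have e0 : av h0 u y 0 = u y * c0 := by
    simp only [av, zero_smul, add_zero]; rw [integral_const_mul]
  rw [e0, abs_mul, abs_of_pos c0p] at m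
  set J := ∫ x in Metric.closedBall y S, |u x| ^ (p+1) with hJ
  have hJ0 : 0 ≤ J := integral_nonneg fun x => by positivity
  have cg : Continuous fun x => |u x| ^ (p+1) := hu.continuous.abs.rpow_const (fun x => Or.inr (by linarith))
  have hb : ∀ s, S/3 ≤ s → s ≤ S → |av h0 u y s| ≤ 3 ^ n * K0 * (δ + δ ^ (-p) * (S⁻¹ ^ n * J)) := by
    intro s hs1 hs2
    have hs : 0 < s := by linarith
    refine (b0 u y s δ p hu.continuous hs hδ hp).trans ?_
    have f1 : ∫ x in Metric.closedBall y s, |u x| ^ (p+1) ≤ J :=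
      setIntegral_mono_set (cg.continuousOn.integrableOn_compact (isCompact_closedBall _ _))
            (Eventually.of_forall fun x => by positivity) (LE.le.eventuallyLE (Metric.closedBall_subset_closedBall hs2))
    have f2 : s⁻¹ ^ n ≤ 3 ^ n * S⁻¹ ^ n := by
      rw [← mul_pow]
      apply pow_le_pow_left₀ (by positivity)
      rw [show 3 * S⁻¹ = (S/3)⁻¹ by field_simp]
      exact inv_anti₀ (by positivity) hs1
    have f3 : s⁻¹ ^ n * ∫ x in Metric.closedBall y s, |u x| ^ (p+1) ≤ (3 ^ n * S⁻¹ ^ n) * J :=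
      mul_le_mul f2 f1 (integral_nonneg fun x => by positivity) (by positivity)
    have f4 : (1:ℝ) ≤ 3 ^ n := one_le_pow₀ (by norm_num)
    calc _ ≤ K0 * (3 ^ n * δ + δ ^ (-p) * ((3 ^ n * S⁻¹ ^ n) * J)) := by
          gcongr
          nlinarith
      _ = _ := by ring
  have g1 := hb (S/3) (le_refl _) (by linarith)
  have g2 := hb (2*S/3) (by linarith) (by linarith)
  have g3 := hb S (by linarith) (le_refl _)
  have hM0 : 0 ≤ M := (abs_nonneg _).trans (hM y (Metric.mem_closedBall_self hS.le))
  set Y := δ + δ ^ (-p) * (S⁻¹ ^ n * J) with hY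
  have hY0 : 0 ≤ Y := by positivity
  have hfin : |u y| * c0 ≤ (6 * 3 ^ n * K0 + 3 * K3) * (Y + M * S^6) := by
    have t1 : 0 ≤ 6 * 3 ^ n * K0 * (M * S^6) := by positivity
    have t2 : 0 ≤ 3 * K3 * Y := by positivity
    nlinarith
  rw [mul_assoc, inv_mul_eq_div, le_div_iff₀ c0p]
  exact hfin

end AA

namespace AA
variable {n : ℕ}

lemma key (hn : 1 ≤ n) {p : ℝ} (hp : 1 < p) (hpc : 15 ≤ n → p < pc n)
    {u : EE n → ℝ} (hu : ContDiff ℝ (⊤ : ℕ∞) u)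
    (heq : ∀ x, laplacian (laplacian (laplacian u)) x = -(|u x| ^ (p - 1) * u x)) :
    ∃ B : ℝ, 1 ≤ B ∧ ∀ (y : EE n) (l : ℝ), 0 < l → StabOn u p y (B * l) →
      |u y| = l ^ (-(6/(p-1))) → (∀ z ∈ Metric.closedBall y (l/2), |u z| ≤ 2 ^ (6/(p-1)) * l ^ (-(6/(p-1)))) → False := by
  have hk : (6/(p-1)) * (p - 1) = 6 := by
    have : p - 1 ≠ 0 := by linarith
    field_simp
  set k := 6/(p-1) with hkd
  obtain ⟨C, hC, hmv⟩ := mean_value n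
  set η : ℝ := 1 / (4 * C) with hη
  have hη0 : 0 < η := by positivity
  obtain ⟨τ, ht0, ht1, ht2⟩ : ∃ τ : ℝ, 0 < τ ∧ τ ≤ 1/2 ∧ C * (2 ^ (k*p) * τ^6) ≤ 1/4 := by
    set Q : ℝ := 4 * C * 2 ^ (k*p) with hQ
    have hQ0 : 0 < Q := by positivity
    refine ⟨1 / (2 + Q), by positivity, ?_, ?_⟩
    · rw [div_le_div_iff₀ (by positivity) (by norm_num)]; linarith
    · have h1 : (1 / (2 + Q)) ^ 6 ≤ 1 / Q := by
        have : (1 / (2 + Q)) ≤ 1 := by rw [div_le_one (by positivity)]; linarith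
        calc (1 / (2 + Q)) ^ 6 ≤ (1 / (2 + Q)) := pow_le_of_le_one (by positivity) this (by norm_num)
          _ ≤ 1 / Q := one_div_le_one_div_of_le hQ0 (by linarith)
      calc C * (2 ^ (k*p) * (1 / (2 + Q)) ^ 6) ≤ C * (2 ^ (k*p) * (1/Q)) := by gcongr
        _ = 1/4 := by rw [hQ]; field_simp
  set ε : ℝ := η ^ p * τ ^ n / (4 * C) with hε
  have hε0 : 0 < ε := by positivity
  obtain ⟨α, hα⟩ : ∃ α, α = -k + ((n:ℝ)-6)/2 := ⟨_, rfl⟩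
  obtain ⟨B, hB, hcore⟩ := core hn hp hpc hu heq hα hε0
  refine ⟨B, hB, fun y l hl hst huy hz => ?_⟩
  have hJ := hcore y l hl hst
  have hS : 0 < τ * l := by positivity
  have hSl : τ * l ≤ l / 2 := by nlinarith
  have cg : Continuous fun x => |u x| ^ (p+1) := hu.continuous.abs.rpow_const (fun x => Or.inr (by linarith))
  have hJ2 : ∫ x in Metric.closedBall y (τ * l), |u x| ^ (p+1) ≤ ε * l ^ (2*α) :=
    (setIntegral_mono_set (cg.continuousOn.integrableOn_compact (isCompact_closedBall _ _))
            (Eventually.of_forall fun x => by positivity) (LE.le.eventuallyLE (Metric.closedBall_subset_closedBall hSl))).trans hJ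
  have h := hmv u hu y (τ * l) ((2 ^ k * l ^ (-k)) ^ p) (η * l ^ (-k)) p hS (by positivity) (by linarith) (fun x hx => by
    rw [heq, abs_neg, abs_mul, abs_of_nonneg (by positivity : 0 ≤ |u x| ^ (p-1))]
    have : |u x| ^ (p-1) * |u x| = |u x| ^ p := by
      conv_rhs => rw [show p = (p - 1) + 1 by ring]
      rw [Real.rpow_add' (abs_nonneg _) (by linarith), Real.rpow_one]
    rw [this]
    exact Real.rpow_le_rpow (abs_nonneg _) (hz x (Metric.closedBall_subset_closedBall hSl hx)) (by linarith))
  set J := ∫ x in Metric.closedBall y (τ * l), |u x| ^ (p+1)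
  set L := l ^ (-k) with hL
  have hL0 : 0 < L := by positivity
  -- the three terms
  have T3 : (2 ^ k * L) ^ p * (τ * l) ^ 6 = (2 ^ (k*p) * τ^6) * L := by
    rw [Real.mul_rpow (by positivity) hL0.le, ← Real.rpow_mul two_pos.le, mul_pow, hL, ← Real.rpow_mul hl.le]
    have : l ^ (-k * p) * l ^ 6 = l ^ (-k) := by
      rw [← Real.rpow_natCast l 6, ← Real.rpow_add hl]; congr 1; push_cast; linear_combination -hk
    linear_combination (2 ^ (k*p) * τ^6) * this
  have T2 : (η * L) ^ (-p) * ((τ * l)⁻¹ ^ n * (ε * l ^ (2*α))) = (1 / (4 * C)) * L := by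
    rw [Real.mul_rpow hη0.le hL0.le, hL, ← Real.rpow_mul hl.le, hε]
    have e1 : η ^ (-p) * η ^ p = 1 := by rw [← Real.rpow_add hη0, neg_add_cancel, Real.rpow_zero]
    have e2 : l ^ (-k * -p) * (l⁻¹ ^ n * l ^ (2*α)) = l ^ (-k) := by
      rw [inv_pow, ← Real.rpow_natCast l n, ← Real.rpow_neg hl.le, ← Real.rpow_add hl, ← Real.rpow_add hl]
      congr 1; rw [hα]; linear_combination hk
    have e3 : τ⁻¹ ^ n * τ ^ n = 1 := by rw [← mul_pow, inv_mul_cancel₀ ht0.ne', one_pow]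
    rw [mul_inv, mul_pow]
    calc _ = (η ^ (-p) * η ^ p) * (τ⁻¹ ^ n * τ ^ n) * (1 / (4*C)) * (l ^ (-k * -p) * (l⁻¹ ^ n * l ^ (2*α))) := by ring
      _ = _ := by rw [e1, e2, e3]; ring
  have T2' : (η * L) ^ (-p) * ((τ * l)⁻¹ ^ n * J) ≤ (1 / (4 * C)) * L := by
    refine le_trans ?_ T2.le; gcongr
  rw [huy, T3] at h
  have hC4 : C * (1 / (4 * C)) = 1/4 := by field_simp
  have : L ≤ 3/4 * L := by
    calc L ≤ C * (η * L + (η * L) ^ (-p) * ((τ * l)⁻¹ ^ n * J) + 2 ^ (k*p) * τ^6 * L) := h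
      _ ≤ C * (η * L + (1 / (4 * C)) * L + 2 ^ (k*p) * τ^6 * L) := by gcongr
      _ = (C * (1 / (4 * C))) * L + (C * (1 / (4 * C))) * L + (C * (2 ^ (k*p) * τ^6)) * L := by rw [hη]; ring
      _ ≤ 3/4 * L := by rw [hC4]; nlinarith
  linarith

end AA

/-- **Lemma 6.1.** Let `u` be a smooth solution of `(-Δ)³ u = |u|^{p-1} u` that is stable
outside a compact set `Θ`, with `1 < p` and `p < p_c(n)` in case `n ≥ 15`. Then there are
`C > 0` and `R₀ > 0` with `|u(x)| ≤ C |x|^{-6/(p-1)}` for `|x| ≥ R₀`. -/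
theorem triharmonic_finiteMorse_decay (n : ℕ) (hn : 1 ≤ n) (p : ℝ) (hp : 1 < p)
    (hpc : 15 ≤ n → p < pc n)
    (u : EuclideanSpace ℝ (Fin n) → ℝ) (hu : ContDiff ℝ (⊤ : ℕ∞) u)
    (heq : ∀ x, laplacian (laplacian (laplacian u)) x = -(|u x| ^ (p - 1) * u x))
    (Θ : Set (EuclideanSpace ℝ (Fin n))) (hΘ : IsCompact Θ)
    (hstab : ∀ φ : EuclideanSpace ℝ (Fin n) → ℝ, ContDiff ℝ (⊤ : ℕ∞) φ →
      HasCompactSupport φ → tsupport φ ⊆ Θᶜ →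
      p * (∫ x, |u x| ^ (p - 1) * φ x ^ 2) ≤ ∫ x, ‖gradient (laplacian φ) x‖ ^ 2) :
    ∃ C : ℝ, 0 < C ∧ ∃ R₀ : ℝ, 0 < R₀ ∧
      ∀ x : EuclideanSpace ℝ (Fin n), R₀ ≤ ‖x‖ →
        |u x| ≤ C * ‖x‖ ^ (-(6 / (p - 1))) := by
  obtain ⟨B, hB, hkey⟩ := AA.key hn hp hpc hu heq
  obtain ⟨r0, hr0, hΘr⟩ := hΘ.isBounded.subset_closedBall_lt 0 0
  have hk0 : 0 < 6 / (p - 1) := div_pos (by norm_num) (by linarith)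
  set k := 6 / (p - 1) with hk
  refine ⟨(4 * B) ^ k, by positivity, 2 * r0 + 1, by positivity, fun x hx => ?_⟩
  have hxp : 0 < ‖x‖ := by linarith
  set ρ := ‖x‖ / 4 with hρ
  have hρ0 : 0 < ρ := by positivity
  set M : EuclideanSpace ℝ (Fin n) → ℝ := fun z => |u z| ^ (1/k) with hM
  have hMk : ∀ z, |u z| = M z ^ k := by
    intro z; simp only [hM]
    rw [← Real.rpow_mul (abs_nonneg _), one_div_mul_cancel hk0.ne', Real.rpow_one]
  have cM : Continuous M := hu.continuous.abs.rpow_const (fun z => Or.inr (by positivity))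
  have hMn : ∀ z, 0 ≤ M z := fun z => by positivity
  -- main claim
  have main : M x * ρ ≤ B := by
    by_contra hcon
    push Not at hcon
    obtain ⟨y, hy, hmax⟩ := (isCompact_closedBall x ρ).exists_isMaxOn (f := fun z => M z * (ρ - ‖z - x‖))
      ⟨x, Metric.mem_closedBall_self hρ0.le⟩ (by fun_prop)
    have hyx : B < M y * (ρ - ‖y - x‖) := by
      have := hmax (Metric.mem_closedBall_self hρ0.le)
      simp only [Set.mem_ofPred_eq, sub_self, norm_zero, sub_zero] at this
      linarith
    rw [Metric.mem_closedBall, dist_eq_norm] at hy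
    set d := ρ - ‖y - x‖ with hd
    have hd0 : 0 < d := by
      rcases (sub_nonneg.mpr hy).eq_or_lt with h | h
      · rw [hd, ← h, mul_zero] at hyx; linarith
      · exact h
    have hMy : 0 < M y := by
      rcases (hMn y).eq_or_lt with h | h
      · rw [← h, zero_mul] at hyx; linarith
      · exact h
    set l := 1 / M y with hl
    have hl0 : 0 < l := by positivity
    have hBl : B * l < d := by
      rw [hl, mul_one_div, div_lt_iff₀ hMy]; linarith
    have hld : l < d := by nlinarith
    have hlk : l ^ (-k) = M y ^ k := by
      rw [hl, one_div, Real.inv_rpow hMy.le, ← Real.rpow_neg hMy.le, neg_neg]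
    refine hkey y l hl0 ?_ ?_ ?_
    · intro φ h1 h2 h3
      refine hstab φ h1 h2 ?_
      have hsub : tsupport φ ⊆ Metric.closedBall y (B * l) := by
        refine closure_minimal (fun z hz => ?_) Metric.isClosed_closedBall
        rw [Metric.mem_closedBall, dist_eq_norm]
        exact h3 z hz
      intro z hz hzΘ
      have a1 := hsub hz
      have a2 := hΘr hzΘ
      rw [Metric.mem_closedBall, dist_eq_norm] at a1
      rw [Metric.mem_closedBall, dist_zero_right] at a2
      have a3 : ‖x‖ ≤ ‖z‖ + ‖z - y‖ + ‖y - x‖ := by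
        calc ‖x‖ = ‖z - (z - y) - (y - x)‖ := by congr 1; abel
          _ ≤ ‖z - (z - y)‖ + ‖y - x‖ := norm_sub_le _ _
          _ ≤ ‖z‖ + ‖z - y‖ + ‖y - x‖ := by gcongr; exact norm_sub_le _ _
      linarith
    · rw [hlk]; exact hMk y
    · intro z hz
      rw [Metric.mem_closedBall, dist_eq_norm] at hz
      have a3 : ‖z - x‖ ≤ ‖z - y‖ + ‖y - x‖ := by
        rw [show z - x = (z - y) + (y - x) by abel]; exact norm_add_le _ _
      have hzx : z ∈ Metric.closedBall x ρ := by
        rw [Metric.mem_closedBall, dist_eq_norm]; linarith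
      have := hmax hzx
      simp only [Set.mem_ofPred_eq] at this
      have h5 : d / 2 ≤ ρ - ‖z - x‖ := by linarith
      have h6 : M z * (d/2) ≤ M y * d := (mul_le_mul_of_nonneg_left h5 (hMn z)).trans this
      have h7 : M z ≤ 2 * M y := by
        by_contra hc; push Not at hc; nlinarith
      rw [hlk, hMk z, ← Real.mul_rpow two_pos.le hMy.le]
      exact Real.rpow_le_rpow (hMn z) h7 hk0.le
  have h1 : M x ≤ 4 * B * ‖x‖⁻¹ := by
    rw [← div_eq_mul_inv, le_div_iff₀ hxp]
    rw [hρ] at main; linarith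
  rw [hMk x, Real.rpow_neg hxp.le, ← Real.inv_rpow hxp.le, ← Real.mul_rpow (by positivity) (by positivity)]
  exact Real.rpow_le_rpow (hMn x) h1 hk0.le
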